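/- For all integers r, ℓ ≥ 2, there exists ε₀ > 0 such that for all ε ∈ (0, ε₀) there exists d₀ such that the following holds for all d ≥ d₀. Let H be an r-uniform hypergraph with |V(H)| ≤ exp(d^{ε³}) such that every vertex of H is contained in (1 ± d^{-ε})·d edges and every pair of distinct vertices is contained in at most d^{1−ε} edges. Let 𝒞 be a hypergraph with vertex set E(H) such that every edge C of 𝒞 satisfies 2 ≤ |C| ≤ ℓ, and, writing 𝒞^{(j)} for the subhypergraph of edges of 𝒞 of size j and Δ_{j'} for the maximum number of edges containing a fixed j'-set of vertices, assume: (C1) Δ₁(𝒞^{(j)}) ≤ ℓ·d^{j−1} for all 2 ≤ j ≤ ℓ; (C2) Δ_{j'}(𝒞^{(j)}) ≤ d^{j−j'−ε} for all 2 ≤ j' < j ≤ ℓ; (C3) for every edge e of H and every vertex v of H, the number of edges f of H with {e,f} an edge of 𝒞 and v ∈ f is at most d^{1−ε}; (C4) for all disjoint edges e, f of H, the number of edges g of H with both {e,g} and {f,g} edges of 𝒞 is at most d^{1−ε}. Then there exists a matching M in H such that no edge of 𝒞 is a subset of M, and M covers all but at most d^{−ε³}·|V(H)| vertices of H. -/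

import Mathlib

open Finset Filter

namespace ConflictFree

section Moments

variable {α ι : Type*} [DecidableEq α]

theorem sum_pow_card_sdiff_insert_le (A M S : Finset α) {p p' : ℝ} (hp' : 0 < p')
    (hA : 0 < A.card) (h : p' + 1 / A.card ≤ p) :
    ∑ e ∈ A, p' ^ (S \ insert e M).card ≤ A.card * p ^ (S \ M).card := by
  set m := (S \ M).card with hm
  have hA' : (0 : ℝ) < A.card := by exact_mod_cast hA
  have hterm : ∀ e ∈ A, p' ^ (S \ insert e M).card ≤
      p' ^ m + if e ∈ S \ M then p' ^ m / p' else 0 := by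
    intro e _
    have hs : S \ insert e M = (S \ M).erase e := by ext a; simp; tauto
    by_cases he : e ∈ S \ M
    · have hc : (S \ insert e M).card = m - 1 := by rw [hs, card_erase_of_mem he]
      have hm1 : 1 ≤ m := card_pos.2 ⟨e, he⟩
      have : p' ^ m / p' = p' ^ (m - 1) := by
        rw [div_eq_iff hp'.ne', ← pow_succ]; congr 1; omega
      rw [hc, if_pos he, this]
      have : 0 ≤ p' ^ m := by positivity
      linarith
    · rw [hs, erase_eq_of_notMem he, if_neg he, add_zero]
  calc ∑ e ∈ A, p' ^ (S \ insert e M).card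
      ≤ ∑ e ∈ A, (p' ^ m + if e ∈ S \ M then p' ^ m / p' else 0) := sum_le_sum hterm
    _ = A.card * p' ^ m + (A.filter (· ∈ S \ M)).card * (p' ^ m / p') := by
        rw [sum_add_distrib, sum_const, nsmul_eq_mul, ← sum_filter, sum_const, nsmul_eq_mul]
    _ ≤ A.card * p' ^ m + m * (p' ^ m / p') := by
        gcongr
        exact card_le_card fun a ha => (mem_filter.1 ha).2
    _ = A.card * (p' ^ m * (1 + m * (1 / (A.card * p')))) := by
        field_simp
    _ ≤ A.card * (p' ^ m * (1 + 1 / (A.card * p')) ^ m) := by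
        gcongr
        refine one_add_mul_le_pow (le_trans (by norm_num) (?_ : (0 : ℝ) ≤ _)) _
        positivity
    _ = A.card * (p' + 1 / A.card) ^ m := by
        rw [← mul_pow]; congr 2; field_simp
    _ ≤ A.card * p ^ m := by gcongr

/-- The `k`-fold sum of `p ^ |(S ∪ W i₁ ∪ ⋯ ∪ W iₖ) \ M|` over indices `i₁, …, iₖ ∈ F`. -/
noncomputable def moment (F : Finset ι) (W : ι → Finset α) (p : ℝ) (M : Finset α) :
    ℕ → Finset α → ℝ
  | 0, S => p ^ (S \ M).card
  | k + 1, S => ∑ i ∈ F, moment F W p M k (S ∪ W i)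

theorem moment_nonneg (F : Finset ι) (W : ι → Finset α) {p : ℝ} (hp : 0 ≤ p) (M : Finset α)
    (k : ℕ) (S : Finset α) : 0 ≤ moment F W p M k S := by
  induction k generalizing S with
  | zero => simp only [moment]; positivity
  | succ k ih => exact sum_nonneg fun i _ => ih _

theorem sum_moment_insert_le (F : Finset ι) (W : ι → Finset α) (A M : Finset α) {p p' : ℝ}
    (hp' : 0 < p') (hA : 0 < A.card) (h : p' + 1 / A.card ≤ p) (k : ℕ) (S : Finset α) :
    ∑ e ∈ A, moment F W p' (insert e M) k S ≤ A.card * moment F W p M k S := by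
  induction k generalizing S with
  | zero => exact sum_pow_card_sdiff_insert_le A M S hp' hA h
  | succ k ih =>
    simp only [moment]
    rw [sum_comm, mul_sum]
    exact sum_le_sum fun i _ => ih _

theorem mul_pow_le_moment (F : Finset ι) (W : ι → Finset α) {p : ℝ} (hp : 0 ≤ p) (hp1 : p ≤ 1)
    (M : Finset α) (k : ℕ) (S : Finset α) :
    p ^ (S \ M).card * (∑ i ∈ F, p ^ (W i \ M).card) ^ k ≤ moment F W p M k S := by
  induction k generalizing S with
  | zero => simp [moment]
  | succ k ih =>
    simp only [moment]
    rw [pow_succ, mul_comm (_ ^ k), ← mul_assoc, mul_sum, sum_mul]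
    refine sum_le_sum fun i _ => le_trans ?_ (ih _)
    rw [← pow_add]
    refine mul_le_mul_of_nonneg_right ?_ (pow_nonneg (sum_nonneg fun i _ => by positivity) _)
    refine pow_le_pow_of_le_one hp hp1 ?_
    rw [union_sdiff_distrib]
    exact card_union_le _ _

theorem moment_empty_le (F : Finset ι) (W : ι → Finset α) {p β : ℝ} (hp : 0 < p) (hβ : 0 ≤ β)
    (w N : ℕ) (hw : ∀ i ∈ F, (W i).card ≤ w)
    (hI : ∀ I : Finset α, ∑ i ∈ F with I ⊆ W i, p ^ (W i \ I).card ≤ β)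
    (k : ℕ) (S : Finset α) (hS : S.card + k * w ≤ N) :
    moment F W p ∅ k S ≤ p ^ S.card * (((N + 1 : ℕ) : ℝ) ^ w * β) ^ k := by
  induction k generalizing S with
  | zero => simp [moment]
  | succ k ih =>
    simp only [moment]
    have hcard : (((S.powerset.filter (·.card ≤ w)).card : ℕ) : ℝ) ≤ ((N + 1 : ℕ) : ℝ) ^ w := by
      have hSN : S.card ≤ N := le_trans (Nat.le_add_right _ _) hS
      have h1 : (S.powerset.filter (·.card ≤ w)).card ≤ (N + 1) ^ w := by
        have hsub : S.powerset.filter (·.card ≤ w) ⊆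
            (Fintype.piFinset fun _ : Fin w => insert none (S.map .some)).image
              (fun g => univ.biUnion fun j => (g j).toFinset) := by
          intro I hI
          obtain ⟨hIS, hIw⟩ := mem_filter.1 hI
          rw [mem_powerset] at hIS
          rw [mem_image]
          let e := I.equivFin.symm
          refine ⟨fun j => if h : j.1 < I.card then some (e ⟨j.1, h⟩ : α) else none, ?_, ?_⟩
          · rw [Fintype.mem_piFinset]
            intro j
            by_cases h : j.1 < I.card
            · simp only [h, dif_pos]
              refine mem_insert_of_mem (mem_map.2 ⟨_, hIS (e ⟨j.1, h⟩).2, rfl⟩)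
            · simp [h]
          · ext a
            simp only [mem_biUnion, mem_univ, true_and, Option.mem_toFinset, Option.mem_def]
            constructor
            · rintro ⟨j, hj⟩
              by_cases h : j.1 < I.card
              · simp only [h, dif_pos, Option.some.injEq] at hj
                rw [← hj]; exact (e ⟨j.1, h⟩).2
              · simp [h] at hj
            · intro ha
              have hlt : (I.equivFin ⟨a, ha⟩).1 < I.card := (I.equivFin ⟨a, ha⟩).2
              refine ⟨⟨(I.equivFin ⟨a, ha⟩).1, hlt.trans_le hIw⟩, ?_⟩
              simp [hlt, e]
        refine (card_le_card hsub).trans (card_image_le.trans ?_)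
        rw [Fintype.card_piFinset_const]
        refine Nat.pow_le_pow_left ?_ _
        refine (card_insert_le _ _).trans ?_
        rw [card_map]; omega
      exact_mod_cast h1
    have hkey : ∑ i ∈ F, p ^ (W i \ S).card ≤ ((N + 1 : ℕ) : ℝ) ^ w * β := by
      have hmaps : ∀ i ∈ F, W i ∩ S ∈ S.powerset.filter (·.card ≤ w) := fun i hi =>
        mem_filter.2 ⟨mem_powerset.2 inter_subset_right,
          (card_le_card inter_subset_left).trans (hw i hi)⟩
      rw [← sum_fiberwise_of_maps_to hmaps]
      calc _ ≤ ∑ I ∈ S.powerset.filter (·.card ≤ w), β := by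
            refine sum_le_sum fun I _ => le_trans ?_ (hI I)
            have : ∀ i ∈ F.filter (fun i => W i ∩ S = I),
                p ^ (W i \ S).card = p ^ (W i \ I).card := by
              intro i hi
              rw [← (mem_filter.1 hi).2, sdiff_inter_self_left]
            rw [sum_congr rfl this]
            refine sum_le_sum_of_subset_of_nonneg ?_ fun _ _ _ => by positivity
            intro i hi
            rw [mem_filter] at hi ⊢
            exact ⟨hi.1, hi.2 ▸ inter_subset_left⟩
        _ = _ := by rw [sum_const, nsmul_eq_mul]
        _ ≤ _ := by gcongr
    calc ∑ i ∈ F, moment F W p ∅ k (S ∪ W i)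
        ≤ ∑ i ∈ F, p ^ S.card * p ^ (W i \ S).card * (((N + 1 : ℕ) : ℝ) ^ w * β) ^ k := by
          refine sum_le_sum fun i hi => ?_
          have hc : (S ∪ W i).card = S.card + (W i \ S).card := by
            rw [← card_union_of_disjoint disjoint_sdiff, union_sdiff_self_eq_union]
          rw [← pow_add, ← hc]
          refine ih _ ?_
          have := hw i hi
          have := card_union_le S (W i)
          rw [add_mul, one_mul] at hS
          omega
      _ = p ^ S.card * (((N + 1 : ℕ) : ℝ) ^ w * β) ^ k * ∑ i ∈ F, p ^ (W i \ S).card := by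
          rw [mul_sum]; refine sum_congr rfl fun i _ => by ring
      _ ≤ p ^ S.card * (((N + 1 : ℕ) : ℝ) ^ w * β) ^ k * (((N + 1 : ℕ) : ℝ) ^ w * β) := by
          gcongr
      _ = _ := by ring

end Moments

section Exponential

theorem exp_mul_sub_le {c g p q η : ℝ} (hc : 0 ≤ c) (hp : 0 ≤ p) (hpg : p ≤ g) (hq : 0 ≤ q)
    (hqg : q ≤ g) (hη : 2 * (c * g) ≤ η) (hη1 : η ≤ 1) :
    Real.exp (c * (p - q)) ≤ 1 + c * ((1 + η) * p - (1 - η) * q) := by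
  have hg : 0 ≤ g := hp.trans hpg
  have habs : |p - q| ≤ g := abs_sub_le_iff.2 ⟨by linarith, by linarith⟩
  have habs' : |p - q| ≤ p + q := abs_sub_le_iff.2 ⟨by linarith, by linarith⟩
  have hx : |c * (p - q)| ≤ 1 := by
    rw [abs_mul, abs_of_nonneg hc]
    nlinarith [mul_le_mul_of_nonneg_left habs hc]
  have h1 := (abs_le.1 (Real.abs_exp_sub_one_sub_id_le hx)).2
  have h2 : (p - q) ^ 2 ≤ g * (p + q) := by
    rw [← sq_abs, sq]
    exact mul_le_mul habs habs' (abs_nonneg _) hg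
  have h3 : (c * (p - q)) ^ 2 ≤ c * (η * (p + q)) := by
    calc (c * (p - q)) ^ 2 = c * (c * (p - q) ^ 2) := by ring
      _ ≤ c * (c * (g * (p + q))) := by gcongr
      _ = c * ((c * g) * (p + q)) := by ring
      _ ≤ c * (η * (p + q)) := by
        gcongr
        nlinarith [mul_nonneg hc hg]
  nlinarith

/-- If the weighted changes `P i - Q i` of a tracked quantity have negative total drift with some
room to spare, then the exponential of the quantity does not increase on average. -/
theorem sum_exp_sub_le_zero {α : Type*} (I J : Finset α) (w P Q P' Q' Y Z : α → ℝ)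
    {c g η X : ℝ} (hc : 0 ≤ c) (hη : 2 * (c * g) ≤ η) (hη1 : η ≤ 1) (hw : ∀ j ∈ J, 0 ≤ w j)
    (hP : ∀ i ∈ I, 0 ≤ P i ∧ P i ≤ g) (hQ : ∀ i ∈ I, 0 ≤ Q i ∧ Q i ≤ g)
    (hP' : ∀ i ∈ J, 0 ≤ P' i ∧ P' i ≤ g) (hQ' : ∀ i ∈ J, 0 ≤ Q' i ∧ Q' i ≤ g)
    (hY : ∀ i ∈ I, Y i ≤ X + (P i - Q i)) (hZ : ∀ j ∈ J, Z j ≤ X + (P' j - Q' j))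
    (hdrift : (1 + η) * (∑ i ∈ I, P i + ∑ j ∈ J, w j * P' j) ≤
      (1 - η) * (∑ i ∈ I, Q i + ∑ j ∈ J, w j * Q' j)) :
    ∑ i ∈ I, (Real.exp (c * Y i) - Real.exp (c * X)) +
      ∑ j ∈ J, w j * (Real.exp (c * Z j) - Real.exp (c * X)) ≤ 0 := by
  have key : ∀ p q y : ℝ, 0 ≤ p ∧ p ≤ g → 0 ≤ q ∧ q ≤ g → y ≤ X + (p - q) →
      Real.exp (c * y) - Real.exp (c * X) ≤
        Real.exp (c * X) * c * ((1 + η) * p - (1 - η) * q) := by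
    intro p q y hp hq hy
    have h1 := exp_mul_sub_le hc hp.1 hp.2 hq.1 hq.2 hη hη1
    have h2 : Real.exp (c * y) ≤ Real.exp (c * X) * Real.exp (c * (p - q)) := by
      rw [← Real.exp_add]
      apply Real.exp_le_exp.2
      nlinarith
    nlinarith [mul_le_mul_of_nonneg_left h1 (Real.exp_pos (c * X)).le]
  have h1 := sum_le_sum fun i hi => key _ _ _ (hP i hi) (hQ i hi) (hY i hi)
  have h2 := sum_le_sum fun j hj =>
    mul_le_mul_of_nonneg_left (key _ _ _ (hP' j hj) (hQ' j hj) (hZ j hj)) (hw j hj)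
  refine (add_le_add h1 h2).trans ?_
  have : ∑ i ∈ I, Real.exp (c * X) * c * ((1 + η) * P i - (1 - η) * Q i) +
      ∑ j ∈ J, w j * (Real.exp (c * X) * c * ((1 + η) * P' j - (1 - η) * Q' j)) =
      Real.exp (c * X) * c * ((1 + η) * (∑ i ∈ I, P i + ∑ j ∈ J, w j * P' j) -
        (1 - η) * (∑ i ∈ I, Q i + ∑ j ∈ J, w j * Q' j)) := by
    simp only [mul_add, mul_sub, sum_sub_distrib, mul_sum]
    have e1 : ∀ (f : α → ℝ) (a : ℝ) , ∑ j ∈ J, w j * (Real.exp (c * X) * c * (a * f j)) =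
        ∑ j ∈ J, Real.exp (c * X) * c * (a * (w j * f j)) := fun f a =>
      sum_congr rfl fun j _ => by ring
    rw [e1, e1]; ring
  rw [this]
  exact mul_nonpos_of_nonneg_of_nonpos (mul_nonneg (Real.exp_pos _).le hc) (by linarith)

end Exponential

variable {V : Type*} [DecidableEq V]

/-- Adding both `e` and `c` to the matching `M` completes a conflict. -/
def Blocks (𝒞 : Finset (Finset (Finset V))) (M : Finset (Finset V)) (e c : Finset V) : Prop :=
  ∃ C ∈ 𝒞, C ⊆ insert c (insert e M)

instance (𝒞 : Finset (Finset (Finset V))) (M : Finset (Finset V)) (e c : Finset V) :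
    Decidable (Blocks 𝒞 M e c) := by
  unfold Blocks; infer_instance

/-- The edge `c` is no longer available once `e` has been added to the matching `M`. -/
def Excl (𝒞 : Finset (Finset (Finset V))) (M : Finset (Finset V)) (e c : Finset V) : Prop :=
  ¬ Disjoint e c ∨ Blocks 𝒞 M e c

instance (𝒞 : Finset (Finset (Finset V))) (M : Finset (Finset V)) (e c : Finset V) :
    Decidable (Excl 𝒞 M e c) := by
  unfold Excl; infer_instance

theorem Blocks.symm {𝒞 : Finset (Finset (Finset V))} {M : Finset (Finset V)} {e c : Finset V}
    (h : Blocks 𝒞 M e c) : Blocks 𝒞 M c e := by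
  obtain ⟨C, hC, h⟩ := h
  exact ⟨C, hC, by rwa [Finset.insert_comm]⟩

theorem Excl.symm {𝒞 : Finset (Finset (Finset V))} {M : Finset (Finset V)} {e c : Finset V}
    (h : Excl 𝒞 M e c) : Excl 𝒞 M c e :=
  h.imp (fun h h' => h h'.symm) Blocks.symm

/-- The number of edges of `A` at the vertex `v`. -/
def deg (A : Finset (Finset V)) (v : V) : ℕ := (A.filter fun e => v ∈ e).card

/-- The edges of `A` that are disjoint from `c` but whose addition to `M` excludes `c`. -/
def blockers (𝒞 : Finset (Finset (Finset V))) (M A : Finset (Finset V)) (c : Finset V) :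
    Finset (Finset V) :=
  A.filter fun e => Disjoint e c ∧ Blocks 𝒞 M e c

/-- The edges of `A` that remain available after `e` has been added to `M`. -/
def remaining (𝒞 : Finset (Finset (Finset V))) (M A : Finset (Finset V)) (e : Finset V) :
    Finset (Finset V) :=
  A.filter fun c => ¬ Excl 𝒞 M e c

section Counting

variable (A : Finset (Finset V))

theorem card_not_disjoint_le (W : Finset V) :
    (A.filter fun e => ¬ Disjoint e W).card ≤ ∑ w ∈ W, deg A w := by
  have : (A.filter fun e => ¬ Disjoint e W) ⊆ W.biUnion fun w => A.filter fun e => w ∈ e := by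
    intro e he
    obtain ⟨he, h⟩ := mem_filter.1 he
    obtain ⟨w, hw, hw'⟩ := not_disjoint_iff.1 h
    exact mem_biUnion.2 ⟨w, hw', mem_filter.2 ⟨he, hw⟩⟩
  exact (card_le_card this).trans card_biUnion_le

theorem le_card_not_disjoint (W : Finset V) :
    ∑ w ∈ W, (deg A w : ℝ) -
      ∑ p ∈ W.offDiag, ((A.filter fun e => p.1 ∈ e ∧ p.2 ∈ e).card : ℝ) ≤
      ((A.filter fun e => ¬ Disjoint e W).card : ℝ) := by
  have h1 : ∑ w ∈ W, (deg A w : ℝ) = ∑ e ∈ A, ((W.filter fun w => w ∈ e).card : ℝ) := by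
    simp only [deg, card_filter, Nat.cast_sum]
    rw [sum_comm]
  have h2 : ∑ p ∈ W.offDiag, ((A.filter fun e => p.1 ∈ e ∧ p.2 ∈ e).card : ℝ) =
      ∑ e ∈ A, ((W.filter fun w => w ∈ e).offDiag.card : ℝ) := by
    have : ∀ e : Finset V, (W.filter fun w => w ∈ e).offDiag =
        W.offDiag.filter fun p => p.1 ∈ e ∧ p.2 ∈ e := by
      intro e; ext p; simp only [mem_offDiag, mem_filter]; tauto
    simp only [this, card_filter, Nat.cast_sum]
    rw [sum_comm]
  rw [h1, h2, card_filter, Nat.cast_sum, ← sum_sub_distrib]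
  refine sum_le_sum fun e _ => ?_
  rw [offDiag_card]
  set k := (W.filter fun w => w ∈ e).card with hk
  by_cases hd : Disjoint e W
  · have : k = 0 := by
      rw [hk, card_eq_zero, filter_eq_empty_iff]
      exact fun w hw hwe => (disjoint_left.1 hd hwe) hw
    simp [hd, this]
  · rw [if_pos hd, Nat.cast_sub (Nat.le_mul_self k)]
    push_cast
    nlinarith [sq_nonneg ((k : ℝ) - 1)]

variable {A}

theorem le_card_not_disjoint_of_mem {r : ℕ} {D err Δ : ℝ} {f : Finset V} (hf : f.card = r)
    (hΔ : 0 ≤ Δ)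
    (hcod : ∀ u v : V, u ≠ v → ((A.filter fun e => u ∈ e ∧ v ∈ e).card : ℝ) ≤ Δ)
    (hdeg : ∀ v ∈ f, D - err ≤ deg A v) {v : V} (hv : v ∈ f) :
    (r - 1) * (D - err) - r ^ 2 * Δ + deg A v ≤
      ((A.filter fun e => ¬ Disjoint e f).card : ℝ) := by
  refine le_trans ?_ (le_card_not_disjoint A f)
  have h1 : (r - 1) * (D - err) + deg A v ≤ ∑ w ∈ f, (deg A w : ℝ) := by
    rw [← add_sum_erase _ _ hv]
    have := card_nsmul_le_sum (f.erase v) (fun w => (deg A w : ℝ)) _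
      fun w hw => hdeg w (mem_of_mem_erase hw)
    rw [card_erase_of_mem hv, nsmul_eq_mul, hf,
      Nat.cast_sub (hf ▸ card_pos.2 ⟨v, hv⟩ : 1 ≤ r), Nat.cast_one] at this
    linarith
  have h2 : ∑ p ∈ f.offDiag, ((A.filter fun e => p.1 ∈ e ∧ p.2 ∈ e).card : ℝ) ≤
      f.offDiag.card • Δ :=
    sum_le_card_nsmul _ _ _ fun p hp => hcod _ _ (mem_offDiag.1 hp).2.2
  rw [offDiag_card, hf, nsmul_eq_mul, Nat.cast_sub (Nat.le_mul_self r)] at h2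
  push_cast at h2
  have h3 : 0 ≤ (r : ℝ) * Δ := by positivity
  nlinarith

theorem card_not_disjoint_le_of_mem {r : ℕ} {D err : ℝ} {f : Finset V} (hf : f.card = r)
    (hdeg : ∀ v ∈ f, (deg A v : ℝ) ≤ D + err) {v : V} (hv : v ∈ f) :
    ((A.filter fun e => ¬ Disjoint e f).card : ℝ) ≤ (r - 1) * (D + err) + deg A v := by
  have h0 : ((A.filter fun e => ¬ Disjoint e f).card : ℝ) ≤ ∑ w ∈ f, (deg A w : ℝ) := by
    exact_mod_cast card_not_disjoint_le A f
  refine h0.trans ?_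
  rw [← add_sum_erase _ _ hv]
  have := sum_le_card_nsmul (f.erase v) (fun w => (deg A w : ℝ)) _
    fun w hw => hdeg w (mem_of_mem_erase hw)
  rw [card_erase_of_mem hv, nsmul_eq_mul, hf,
    Nat.cast_sub (hf ▸ card_pos.2 ⟨v, hv⟩ : 1 ≤ r), Nat.cast_one] at this
  linarith

end Counting

theorem sum_le_sum_of_injOn {α ι : Type*} [DecidableEq ι] (B : Finset α) (F : Finset ι)
    (f : α → ℝ) (w : ι → ℝ) (φ : α → ι) (hw : ∀ i ∈ F, 0 ≤ w i) (hφ : ∀ b ∈ B, φ b ∈ F)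
    (hinj : ∀ b ∈ B, ∀ b' ∈ B, φ b = φ b' → b = b') (hf : ∀ b ∈ B, f b ≤ w (φ b)) :
    ∑ b ∈ B, f b ≤ ∑ i ∈ F, w i := by
  calc ∑ b ∈ B, f b ≤ ∑ b ∈ B, w (φ b) := sum_le_sum hf
    _ = ∑ i ∈ B.image φ, w i := (sum_image fun b hb b' hb' h => hinj b hb b' hb' h).symm
    _ ≤ ∑ i ∈ F, w i := sum_le_sum_of_subset_of_nonneg
        (fun i hi => by obtain ⟨b, hb, rfl⟩ := mem_image.1 hi; exact hφ b hb)
        fun i hi _ => hw i hi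

section Families

variable {V : Type*} [DecidableEq V]

/-- Pairs of a conflict through `e` and a second edge of it containing `v`. -/
def famT (𝒞 : Finset (Finset (Finset V))) (H : Finset (Finset V)) (e : Finset V) (v : V) :
    Finset (Finset (Finset V) × Finset V) :=
  (𝒞 ×ˢ H).filter fun q => e ∈ q.1 ∧ q.2 ∈ q.1 ∧ q.2 ≠ e ∧ v ∈ q.2

/-- The part of a conflict that has to be chosen besides the two distinguished edges. -/
def wT (e : Finset V) (q : Finset (Finset V) × Finset V) : Finset (Finset V) := q.1 \ {e, q.2}

/-- Pairs of a conflict through `f` and `g` and a third edge of it. -/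
def famR (𝒞 : Finset (Finset (Finset V))) (H : Finset (Finset V)) (f g : Finset V) :
    Finset (Finset (Finset V) × Finset V) :=
  (𝒞 ×ˢ H).filter fun q => f ∈ q.1 ∧ g ∈ q.1 ∧ q.2 ∈ q.1 ∧ f ≠ g ∧ q.2 ≠ f ∧ q.2 ≠ g

/-- The part of a conflict that has to be chosen besides the three distinguished edges. -/
def wR (f g : Finset V) (q : Finset (Finset V) × Finset V) : Finset (Finset V) :=
  q.1 \ {f, g, q.2}

/-- Pairs of conflicts, through `c` and `c'` respectively, with a common edge. -/
def famP (𝒞 : Finset (Finset (Finset V))) (H : Finset (Finset V)) (c c' : Finset V) :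
    Finset (Finset (Finset V) × Finset (Finset V) × Finset V) :=
  (𝒞 ×ˢ 𝒞 ×ˢ H).filter fun q =>
    c ∈ q.1 ∧ c ∉ q.2.1 ∧ c' ∈ q.2.1 ∧ c' ∉ q.1 ∧ q.2.2 ∈ q.1 ∧ q.2.2 ∈ q.2.1

/-- The part of a pair of conflicts that has to be chosen besides the distinguished edges. -/
def wP (c c' : Finset V) (q : Finset (Finset V) × Finset (Finset V) × Finset V) :
    Finset (Finset V) :=
  (q.1 ∪ q.2.1) \ {c, c', q.2.2}

/-- The conflicts through `f` whose other edges are all chosen or available. -/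
def live (𝒟 : Finset (Finset (Finset V))) (M A : Finset (Finset V)) (f : Finset V) :
    Finset (Finset (Finset V)) :=
  𝒟.filter fun C => f ∈ C ∧ C.erase f ⊆ M ∪ A

/-- The weighted number of conflicts that can still block `f`. -/
noncomputable def danger (𝒟 : Finset (Finset (Finset V))) (M A : Finset (Finset V)) (y : ℝ)
    (f : Finset V) : ℝ :=
  ∑ C ∈ live 𝒟 M A f, y ^ (C.erase f \ M).card

/-- A partial matching `M` and a set `A` of available edges without any conflict in `𝒞`. -/
structure Valid (r : ℕ) (H : Finset (Finset V)) (𝒞 : Finset (Finset (Finset V)))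
    (M A : Finset (Finset V)) : Prop where
  subM : M ⊆ H
  subA : A ⊆ H
  matching : ∀ e ∈ M, ∀ f ∈ M, e ≠ f → Disjoint e f
  disj : ∀ e ∈ M, ∀ a ∈ A, Disjoint e a
  free : ∀ C ∈ 𝒞, ¬ C ⊆ M
  avail : ∀ a ∈ A, ∀ C ∈ 𝒞, ¬ C ⊆ insert a M

/-- Sparse conflicts: the twin pairs `𝒯` are to be avoided altogether, and the conflicts in `𝒟`
consist of pairwise disjoint edges without twins. -/
structure Sparse (r ℓ : ℕ) (H : Finset (Finset V)) (𝒟 𝒯 : Finset (Finset (Finset V)))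
    (σ : ℝ) : Prop where
  card_edge : ∀ e ∈ H, e.card = r
  codeg : ∀ u v : V, u ≠ v → ((H.filter fun e => u ∈ e ∧ v ∈ e).card : ℝ) ≤ σ
  sub : ∀ C ∈ 𝒟 ∪ 𝒯, C ⊆ H
  card_le : ∀ C ∈ 𝒟 ∪ 𝒯, C.card ≤ ℓ
  pairwise : ∀ C ∈ 𝒟, ∀ e ∈ C, ∀ f ∈ C, e ≠ f → Disjoint e f
  twinfree : ∀ C ∈ 𝒟, ∀ e ∈ C, ∀ f ∈ C, ({e, f} : Finset (Finset V)) ∉ 𝒯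
  card_twin : ∀ C ∈ 𝒯, C.card = 2
  twins : ∀ e ∈ H, ((H.filter fun f => ({e, f} : Finset (Finset V)) ∈ 𝒯).card : ℝ) ≤ σ

/-- Upper bounds for the weighted numbers of the configurations in `famT`, `famR`, `famP`. -/
structure Bounded (H : Finset (Finset V)) (𝒟 𝒯 : Finset (Finset (Finset V)))
    (M : Finset (Finset V)) (q σ : ℝ) : Prop where
  T : ∀ e ∈ H, ∀ v, ∑ i ∈ famT (𝒟 ∪ 𝒯) H e v, q ^ (wT e i \ M).card ≤ σ
  R : ∀ f ∈ H, ∀ g ∈ H, ∑ i ∈ famR (𝒟 ∪ 𝒯) H f g, q ^ (wR f g i \ M).card ≤ σ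
  P : ∀ c ∈ H, ∀ c' ∈ H, Disjoint c c' → ({c, c'} : Finset (Finset V)) ∉ 𝒯 →
    ∑ i ∈ famP (𝒟 ∪ 𝒯) H c c', q ^ (wP c c' i \ M).card ≤ σ

theorem Bounded.mono {H : Finset (Finset V)} {𝒟 𝒯 : Finset (Finset (Finset V))}
    {M : Finset (Finset V)} {q q' σ : ℝ} (hq : 0 ≤ q') (hqq : q' ≤ q)
    (h : Bounded H 𝒟 𝒯 M q σ) : Bounded H 𝒟 𝒯 M q' σ where
  T e he v := (sum_le_sum fun _ _ => by gcongr).trans (h.T e he v)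
  R f hf g hg := (sum_le_sum fun _ _ => by gcongr).trans (h.R f hf g hg)
  P c hc c' hc' hd ht := (sum_le_sum fun _ _ => by gcongr).trans (h.P c hc c' hc' hd ht)

end Families

section Blocking

variable {V : Type*} [DecidableEq V] {r ℓ : ℕ} {H : Finset (Finset V)}
  {𝒟 𝒯 : Finset (Finset (Finset V))} {M A : Finset (Finset V)} {σ q : ℝ}

theorem Valid.exists_of_blocks {𝒞 : Finset (Finset (Finset V))} (hV : Valid r H 𝒞 M A)
    {e c : Finset V} (he : e ∈ A) (hc : c ∈ A) (h : Blocks 𝒞 M e c) :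
    ∃ C ∈ 𝒞, e ∈ C ∧ c ∈ C ∧ e ≠ c ∧ C \ {e, c} ⊆ M ∧ C ⊆ insert c (insert e M) := by
  obtain ⟨C, hC, hsub⟩ := h
  have h1 : c ∈ C := by
    by_contra hcC
    exact hV.avail e he C hC ((subset_insert_iff_of_notMem hcC).1 hsub)
  have h2 : e ∈ C := by
    by_contra heC
    rw [insert_comm] at hsub
    exact hV.avail c hc C hC ((subset_insert_iff_of_notMem heC).1 hsub)
  refine ⟨C, hC, h2, h1, ?_, ?_, hsub⟩
  · rintro rfl
    rw [insert_idem] at hsub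
    exact hV.avail e he C hC hsub
  · intro x hx
    have := hsub (Finset.mem_sdiff.1 hx).1
    simp only [Finset.mem_sdiff, mem_insert, mem_singleton] at hx
    simp only [mem_insert] at this
    tauto

theorem Valid.notMem {𝒞 : Finset (Finset (Finset V))} (hV : Valid r H 𝒞 M A)
    (hr : ∀ e ∈ H, e.card = r) (hr0 : 0 < r) {e : Finset V} (he : e ∈ A) : e ∉ M := by
  intro heM
  have := hV.disj e heM e he
  rw [disjoint_self_iff_empty] at this
  have h2 := hr e (hV.subA he)
  rw [this, card_empty] at h2
  omega

theorem card_blocked_at_le (hV : Valid r H (𝒟 ∪ 𝒯) M A) (hB : Bounded H 𝒟 𝒯 M q σ)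
    (hq : 0 ≤ q) {c : Finset V} (hc : c ∈ A) (v : V) :
    ((A.filter fun e => v ∈ e ∧ Blocks (𝒟 ∪ 𝒯) M e c).card : ℝ) ≤ σ := by
  refine le_trans ?_ (hB.T c (hV.subA hc) v)
  have : ∀ e ∈ A.filter fun e => v ∈ e ∧ Blocks (𝒟 ∪ 𝒯) M e c, ∃ C ∈ 𝒟 ∪ 𝒯,
      e ∈ C ∧ c ∈ C ∧ e ≠ c ∧ C \ {e, c} ⊆ M ∧ C ⊆ insert c (insert e M) := fun e he =>
    hV.exists_of_blocks (mem_filter.1 he).1 hc (mem_filter.1 he).2.2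
  choose! φ hφ using this
  rw [← nsmul_one, ← sum_const]
  refine sum_le_sum_of_injOn _ _ _ _ (fun e => (φ e, e)) (fun _ _ => by positivity) ?_ ?_ ?_
  · intro e he
    obtain ⟨h1, h2, h3, h4, h5, h6⟩ := hφ e he
    rw [mem_filter] at he
    exact mem_filter.2 ⟨mem_product.2 ⟨h1, hV.subA he.1⟩, h3, h2, h4, he.2.1⟩
  · intro e _ e' _ h
    exact (Prod.ext_iff.1 h).2
  · intro e he
    obtain ⟨h1, h2, h3, h4, h5, h6⟩ := hφ e he
    have : wT c (φ e, e) \ M = ∅ := by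
      rw [sdiff_eq_empty_iff_subset, wT, pair_comm]
      exact h5
    rw [this]; simp

theorem card_common_blockers_le (hV : Valid r H (𝒟 ∪ 𝒯) M A) (hB : Bounded H 𝒟 𝒯 M q σ)
    (hM : ∀ e ∈ A, e ∉ M) (hq : 0 ≤ q) {c c' : Finset V} (hc : c ∈ A) (hc' : c' ∈ A)
    (hne : c ≠ c') (hd : Disjoint c c') (ht : ({c, c'} : Finset (Finset V)) ∉ 𝒯) :
    ((A.filter fun e => Blocks (𝒟 ∪ 𝒯) M e c ∧ Blocks (𝒟 ∪ 𝒯) M e c').card : ℝ) ≤ σ := by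
  refine le_trans ?_ (hB.P c (hV.subA hc) c' (hV.subA hc') hd ht)
  have h1 : ∀ e ∈ A.filter fun e => Blocks (𝒟 ∪ 𝒯) M e c ∧ Blocks (𝒟 ∪ 𝒯) M e c', ∃ C ∈ 𝒟 ∪ 𝒯,
      e ∈ C ∧ c ∈ C ∧ e ≠ c ∧ C \ {e, c} ⊆ M ∧ C ⊆ insert c (insert e M) := fun e he =>
    hV.exists_of_blocks (mem_filter.1 he).1 hc (mem_filter.1 he).2.1
  have h2 : ∀ e ∈ A.filter fun e => Blocks (𝒟 ∪ 𝒯) M e c ∧ Blocks (𝒟 ∪ 𝒯) M e c', ∃ C ∈ 𝒟 ∪ 𝒯,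
      e ∈ C ∧ c' ∈ C ∧ e ≠ c' ∧ C \ {e, c'} ⊆ M ∧ C ⊆ insert c' (insert e M) := fun e he =>
    hV.exists_of_blocks (mem_filter.1 he).1 hc' (mem_filter.1 he).2.2
  choose! φ hφ using h1
  choose! ψ hψ using h2
  rw [← nsmul_one, ← sum_const]
  refine sum_le_sum_of_injOn _ _ _ _ (fun e => (φ e, ψ e, e)) (fun _ _ => by positivity) ?_ ?_ ?_
  · intro e he
    obtain ⟨a1, a2, a3, a4, a5, a6⟩ := hφ e he
    obtain ⟨b1, b2, b3, b4, b5, b6⟩ := hψ e he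
    rw [mem_filter] at he
    refine mem_filter.2 ⟨mem_product.2 ⟨a1, mem_product.2 ⟨b1, hV.subA he.1⟩⟩,
      a3, fun h => ?_, b3, fun h => ?_, a2, b2⟩
    · have := b6 h
      simp only [mem_insert, hne, a4.symm, hM c hc, or_self] at this
    · have := a6 h
      simp only [mem_insert, hne.symm, b4.symm, hM c' hc', or_self] at this
  · intro e _ e' _ h
    simp only [Prod.mk.injEq] at h
    exact h.2.2
  · intro e he
    obtain ⟨a1, a2, a3, a4, a5, a6⟩ := hφ e he
    obtain ⟨b1, b2, b3, b4, b5, b6⟩ := hψ e he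
    have : wP c c' (φ e, ψ e, e) \ M = ∅ := by
      rw [sdiff_eq_empty_iff_subset, wP]
      intro x hx
      simp only [Finset.mem_sdiff, mem_union, mem_insert, mem_singleton] at hx
      rcases hx.1 with h | h
      · have := a6 h
        simp only [mem_insert] at this; tauto
      · have := b6 h
        simp only [mem_insert] at this; tauto
    rw [this]; simp

theorem card_excl_at_le (hS : Sparse r ℓ H 𝒟 𝒯 σ) (hV : Valid r H (𝒟 ∪ 𝒯) M A)
    (hB : Bounded H 𝒟 𝒯 M q σ) (hq : 0 ≤ q) {c : Finset V} (hc : c ∈ A) {v : V} (hv : v ∉ c) :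
    ((A.filter fun e => v ∈ e ∧ Excl (𝒟 ∪ 𝒯) M e c).card : ℝ) ≤ (r + 1) * σ := by
  have hsub : (A.filter fun e => v ∈ e ∧ Excl (𝒟 ∪ 𝒯) M e c) ⊆
      (c.biUnion fun w => H.filter fun e => v ∈ e ∧ w ∈ e) ∪
        A.filter fun e => v ∈ e ∧ Blocks (𝒟 ∪ 𝒯) M e c := by
    intro e he
    obtain ⟨h1, h2, h3⟩ := mem_filter.1 he
    rcases h3 with h3 | h3
    · obtain ⟨w, hw, hw'⟩ := not_disjoint_iff.1 h3
      exact mem_union_left _ (mem_biUnion.2 ⟨w, hw', mem_filter.2 ⟨hV.subA h1, h2, hw⟩⟩)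
    · exact mem_union_right _ (mem_filter.2 ⟨h1, h2, h3⟩)
  have h1 := (card_le_card hsub).trans ((card_union_le _ _).trans
    (Nat.add_le_add_right card_biUnion_le _))
  have h2 : (((A.filter fun e => v ∈ e ∧ Excl (𝒟 ∪ 𝒯) M e c).card : ℕ) : ℝ) ≤
      ∑ w ∈ c, ((H.filter fun e => v ∈ e ∧ w ∈ e).card : ℝ) +
        ((A.filter fun e => v ∈ e ∧ Blocks (𝒟 ∪ 𝒯) M e c).card : ℝ) := by exact_mod_cast h1
  have h3 : ∑ w ∈ c, ((H.filter fun e => v ∈ e ∧ w ∈ e).card : ℝ) ≤ r * σ := by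
    rw [← hS.card_edge c (hV.subA hc), ← nsmul_eq_mul]
    exact sum_le_card_nsmul _ _ _ fun w hw => hS.codeg v w fun h => hv (h ▸ hw)
  linarith [card_blocked_at_le hV hB hq hc v]

theorem card_common_excl_le (hS : Sparse r ℓ H 𝒟 𝒯 σ) (hV : Valid r H (𝒟 ∪ 𝒯) M A)
    (hB : Bounded H 𝒟 𝒯 M q σ) (hr : 0 < r) (hq : 0 ≤ q) {c c' : Finset V} (hc : c ∈ A)
    (hc' : c' ∈ A) (hd : Disjoint c c') (ht : ({c, c'} : Finset (Finset V)) ∉ 𝒯) :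
    ((A.filter fun e => Excl (𝒟 ∪ 𝒯) M e c ∧ Excl (𝒟 ∪ 𝒯) M e c').card : ℝ) ≤
      (r + 1) ^ 2 * σ := by
  have hM := fun e he => hV.notMem hS.card_edge hr (e := e) he
  have hne : c ≠ c' := by
    rintro rfl
    rw [disjoint_self_iff_empty] at hd
    have := hS.card_edge c (hV.subA hc)
    rw [hd, card_empty] at this; omega
  have hsub : (A.filter fun e => Excl (𝒟 ∪ 𝒯) M e c ∧ Excl (𝒟 ∪ 𝒯) M e c') ⊆
      (c.biUnion fun v => A.filter fun e => v ∈ e ∧ Excl (𝒟 ∪ 𝒯) M e c') ∪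
      ((c'.biUnion fun v => A.filter fun e => v ∈ e ∧ Blocks (𝒟 ∪ 𝒯) M e c) ∪
        A.filter fun e => Blocks (𝒟 ∪ 𝒯) M e c ∧ Blocks (𝒟 ∪ 𝒯) M e c') := by
    intro e he
    obtain ⟨h1, h2, h3⟩ := mem_filter.1 he
    rcases h2 with h2 | h2
    · obtain ⟨w, hw, hw'⟩ := not_disjoint_iff.1 h2
      exact mem_union_left _ (mem_biUnion.2 ⟨w, hw', mem_filter.2 ⟨h1, hw, h3⟩⟩)
    · rcases h3 with h3 | h3
      · obtain ⟨w, hw, hw'⟩ := not_disjoint_iff.1 h3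
        exact mem_union_right _ (mem_union_left _
          (mem_biUnion.2 ⟨w, hw', mem_filter.2 ⟨h1, hw, h2⟩⟩))
      · exact mem_union_right _ (mem_union_right _ (mem_filter.2 ⟨h1, h2, h3⟩))
  have h1 := (card_le_card hsub).trans ((card_union_le _ _).trans (add_le_add card_biUnion_le
    ((card_union_le _ _).trans (Nat.add_le_add_right card_biUnion_le _))))
  have h2 : ((A.filter fun e => Excl (𝒟 ∪ 𝒯) M e c ∧ Excl (𝒟 ∪ 𝒯) M e c').card : ℝ) ≤
      ∑ v ∈ c, ((A.filter fun e => v ∈ e ∧ Excl (𝒟 ∪ 𝒯) M e c').card : ℝ) +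
      (∑ v ∈ c', ((A.filter fun e => v ∈ e ∧ Blocks (𝒟 ∪ 𝒯) M e c).card : ℝ) +
        ((A.filter fun e => Blocks (𝒟 ∪ 𝒯) M e c ∧ Blocks (𝒟 ∪ 𝒯) M e c').card : ℝ)) := by
    exact_mod_cast h1
  have h3 : ∑ v ∈ c, ((A.filter fun e => v ∈ e ∧ Excl (𝒟 ∪ 𝒯) M e c').card : ℝ) ≤
      r * ((r + 1) * σ) := by
    rw [← nsmul_eq_mul]; nth_rw 1 [← hS.card_edge c (hV.subA hc)]
    exact sum_le_card_nsmul _ _ _ fun w hw => card_excl_at_le hS hV hB hq hc'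
      (disjoint_left.1 hd hw)
  have h4 : ∑ v ∈ c', ((A.filter fun e => v ∈ e ∧ Blocks (𝒟 ∪ 𝒯) M e c).card : ℝ) ≤ r * σ := by
    rw [← hS.card_edge c' (hV.subA hc'), ← nsmul_eq_mul]
    exact sum_le_card_nsmul _ _ _ fun w _ => card_blocked_at_le hV hB hq hc w
  have h5 := card_common_blockers_le hV hB hM hq hc hc' hne hd ht
  nlinarith

theorem card_blockers_le (hS : Sparse r ℓ H 𝒟 𝒯 σ) (hV : Valid r H (𝒟 ∪ 𝒯) M A) {y g : ℝ}
    (hr : 0 < r) (hy : 0 < y) {c : Finset V} (hc : c ∈ A) (hg : danger 𝒟 M A y c ≤ g) :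
    ((blockers (𝒟 ∪ 𝒯) M A c).card : ℝ) ≤ g / y + σ := by
  have hM := fun e he => hV.notMem hS.card_edge hr (e := e) he
  have hex : ∀ e ∈ blockers (𝒟 ∪ 𝒯) M A c, ∃ C ∈ 𝒟 ∪ 𝒯,
      e ∈ C ∧ c ∈ C ∧ e ≠ c ∧ C \ {e, c} ⊆ M ∧ C ⊆ insert c (insert e M) := fun e he =>
    hV.exists_of_blocks (mem_filter.1 he).1 hc (mem_filter.1 he).2.2
  choose! φ hφ using hex
  rw [← card_filter_add_card_filter_not (s := blockers (𝒟 ∪ 𝒯) M A c) (fun e => φ e ∈ 𝒟)]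
  push_cast
  refine add_le_add ?_ ?_
  · rw [le_div_iff₀ hy, ← nsmul_eq_mul, ← sum_const]
    refine le_trans ?_ hg
    have hsd : ∀ e ∈ (blockers (𝒟 ∪ 𝒯) M A c).filter (fun e => φ e ∈ 𝒟),
        (φ e).erase c \ M = {e} := by
      intro e he
      obtain ⟨he, -⟩ := mem_filter.1 he
      obtain ⟨h1, h2, h3, h4, h5, h6⟩ := hφ e he
      have := hM e (mem_filter.1 he).1
      ext x
      simp only [Finset.mem_sdiff, mem_erase, mem_singleton]
      constructor
      · rintro ⟨⟨hx1, hx2⟩, hx3⟩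
        have := h6 hx2
        simp only [mem_insert] at this; tauto
      · rintro rfl
        exact ⟨⟨h4, h2⟩, this⟩
    refine sum_le_sum_of_injOn _ _ _ _ φ (fun _ _ => by positivity) ?_ ?_ ?_
    · intro e he
      obtain ⟨he, he'⟩ := mem_filter.1 he
      obtain ⟨h1, h2, h3, h4, h5, h6⟩ := hφ e he
      refine mem_filter.2 ⟨he', h3, fun x hx => ?_⟩
      have := h6 (mem_of_mem_erase hx)
      simp only [mem_insert, (mem_erase.1 hx).1, false_or] at this
      rcases this with rfl | h
      · exact mem_union_right _ (mem_filter.1 he).1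
      · exact mem_union_left _ h
    · intro e he e' he' h
      have := hsd e he
      rw [h, hsd e' he'] at this
      exact (singleton_injective this).symm
    · intro e he
      rw [hsd e he]; simp
  · refine le_trans ?_ (hS.twins c (hV.subA hc))
    norm_cast
    refine card_le_card fun e he => ?_
    obtain ⟨he, he'⟩ := mem_filter.1 he
    obtain ⟨h1, h2, h3, h4, h5, h6⟩ := hφ e he
    have hT : φ e ∈ 𝒯 := (mem_union.1 h1).resolve_left he'
    refine mem_filter.2 ⟨hV.subA (mem_filter.1 he).1, ?_⟩
    have : ({c, e} : Finset (Finset V)) = φ e := by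
      refine eq_of_subset_of_card_le ?_ ?_
      · intro x hx
        simp only [mem_insert, mem_singleton] at hx
        rcases hx with rfl | rfl
        exacts [h3, h2]
      · rw [hS.card_twin _ hT, card_pair h4.symm]
    rwa [this]

end Blocking

/-- The numerical relations between the tracked degree `D` with error `err`, their values `D'` and
`err'` after one more edge has been chosen, and the increment parameters. -/
structure DegreeScale (r s L : ℕ) (D D' err err' a σ c η g : ℝ) : Prop where
  D_pos : 0 < D
  err_nonneg : 0 ≤ err
  err_le : err ≤ err'
  a_pos : 0 < a
  σ_one : 1 ≤ σ
  shift_nonneg : 0 ≤ D + err - (D' + err')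
  shift_le : D + err - (D' + err') ≤ a * (s * D - L * err)
  le_shift : a * (s * D + (L - 1) * err) ≤ D - err - (D' - err')
  shift_le_g : D - err - (D' - err') ≤ g
  σ_le_g : (r + 1) * σ ≤ g
  c_nonneg : 0 ≤ c
  c_le : 2 * (c * g) ≤ η
  η_le_err : η * (s * D) ≤ err
  η_le : η * L ≤ 1
  σ_le_err : r ^ 2 * σ ≤ err
  a_le_err : 2 * (a * D) ≤ err
  err_le_D : 2 * ((L + r) * err) ≤ D
  L_ge : 4 * s + 4 * r + 10 ≤ L

section DegreeDrift

variable {V : Type*} [DecidableEq V] {r ℓ s κ L : ℕ} {H : Finset (Finset V)}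
  {𝒟 𝒯 : Finset (Finset (Finset V))} {M A : Finset (Finset V)} {U : Finset V}
  {D D' err err' a σ q c η g : ℝ}

theorem deg_remaining_add (𝒞 : Finset (Finset (Finset V))) (e : Finset V) (v : V) :
    deg (remaining 𝒞 M A e) v + (A.filter fun f => v ∈ f ∧ Excl 𝒞 M f e).card = deg A v := by
  unfold deg remaining
  rw [filter_filter, ← card_filter_add_card_filter_not (s := A.filter fun f => v ∈ f)
    (fun f => Excl 𝒞 M f e), filter_filter, filter_filter, add_comm]
  congr 2
  ext f
  simp only [mem_filter]
  have : Excl 𝒞 M e f ↔ Excl 𝒞 M f e := ⟨Excl.symm, Excl.symm⟩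
  rw [this]; tauto

theorem deg_erase_add {f : Finset V} (hf : f ∈ A) (v : V) :
    deg (A.erase f) v + (if v ∈ f then 1 else 0) = deg A v := by
  unfold deg
  rw [filter_erase]
  split_ifs with h
  · exact card_erase_add_one (mem_filter.2 ⟨hf, h⟩)
  · have : f ∉ A.filter fun e => v ∈ e := fun h' => h (mem_filter.1 h').2
    rw [erase_eq_of_notMem this, add_zero]

theorem deg_loss_eq (𝒞 : Finset (Finset (Finset V))) (v : V) (K : ℝ) :
    ∑ e ∈ A with v ∉ e, ((A.filter fun f => v ∈ f ∧ Excl 𝒞 M f e).card : ℝ) +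
      ∑ f ∈ A, (K - (blockers 𝒞 M A f).card) * (if v ∈ f then 1 else 0) =
    ∑ f ∈ A with v ∈ f, (((A.filter fun e => ¬ Disjoint e f).card : ℝ) - deg A v + K) := by
  have h1 : ∑ e ∈ A with v ∉ e, ((A.filter fun f => v ∈ f ∧ Excl 𝒞 M f e).card : ℝ) =
      ∑ f ∈ A with v ∈ f, ((A.filter fun e => v ∉ e ∧ Excl 𝒞 M e f).card : ℝ) := by
    have h2 : ∀ e f, Excl 𝒞 M e f ↔ Excl 𝒞 M f e := fun e f => ⟨Excl.symm, Excl.symm⟩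
    simp only [card_filter, Nat.cast_sum, sum_filter]
    have h3 : ∀ e ∈ A, (if v ∉ e then ∑ f ∈ A, (((if v ∈ f ∧ Excl 𝒞 M f e then 1 else 0 : ℕ)) : ℝ)
        else 0) = ∑ f ∈ A, if v ∉ e ∧ v ∈ f ∧ Excl 𝒞 M f e then 1 else 0 := by
      intro e _
      by_cases h : v ∈ e <;> simp [h]
    have h4 : ∀ f ∈ A, (if v ∈ f then ∑ e ∈ A, (((if v ∉ e ∧ Excl 𝒞 M e f then 1 else 0 : ℕ)) : ℝ)
        else 0) = ∑ e ∈ A, if v ∉ e ∧ v ∈ f ∧ Excl 𝒞 M f e then 1 else 0 := by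
      intro f _
      by_cases h : v ∈ f
      · simp only [h, if_true, true_and]
        refine sum_congr rfl fun e _ => ?_
        simp only [h2 e f]; push_cast; rfl
      · simp [h]
    rw [sum_congr rfl h3, sum_congr rfl h4, sum_comm]
  rw [h1]
  simp only [mul_ite, mul_one, mul_zero]
  rw [← sum_filter, ← sum_add_distrib]
  refine sum_congr rfl fun f hf => ?_
  obtain ⟨hf, hv⟩ := mem_filter.1 hf
  have h5 : (A.filter fun e => v ∉ e ∧ Excl 𝒞 M e f).card + deg A v =
      (A.filter fun e => ¬ Disjoint e f).card + (blockers 𝒞 M A f).card := by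
    unfold deg blockers
    rw [← card_union_of_disjoint, ← card_union_of_disjoint]
    · congr 1
      ext e
      simp only [mem_union, mem_filter]
      have : v ∈ e → ¬ Disjoint e f := fun h => not_disjoint_iff.2 ⟨v, h, hv⟩
      unfold Excl; tauto
    · refine disjoint_left.2 fun e h h' => (mem_filter.1 h).2 (mem_filter.1 h').2.1
    · refine disjoint_left.2 fun e h h' => (mem_filter.1 h).2.1 (mem_filter.1 h').2
  have h6 : ((A.filter fun e => v ∉ e ∧ Excl 𝒞 M e f).card : ℝ) + deg A v =
      (A.filter fun e => ¬ Disjoint e f).card + (blockers 𝒞 M A f).card := by exact_mod_cast h5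
  linarith

theorem deg_loss_bounds (hS : Sparse r ℓ H 𝒟 𝒯 σ) (hV : Valid r H (𝒟 ∪ 𝒯) M A)
    (hAU : ∀ e ∈ A, e ⊆ U) (hdeg : ∀ v ∈ U, D - err ≤ deg A v ∧ (deg A v : ℝ) ≤ D + err)
    (hσ : 0 ≤ σ) (hσ' : r ^ 2 * σ ≤ err) (hs : s + 1 = r + κ) (v : V) :
    deg A v * (s * D - r * err) ≤
      ∑ f ∈ A with v ∈ f, (((A.filter fun e => ¬ Disjoint e f).card : ℝ) - deg A v + κ * D) ∧
    ∑ f ∈ A with v ∈ f, (((A.filter fun e => ¬ Disjoint e f).card : ℝ) - deg A v + κ * D) ≤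
      deg A v * (s * D + (r - 1) * err) := by
  have hs' : (s : ℝ) + 1 = r + κ := by exact_mod_cast hs
  have hsD : s * D + D = r * D + κ * D := by linear_combination D * hs'
  have hcod : ∀ u v : V, u ≠ v → ((A.filter fun e => u ∈ e ∧ v ∈ e).card : ℝ) ≤ σ := fun u v h =>
    le_trans (by exact_mod_cast card_le_card (filter_subset_filter _ hV.subA)) (hS.codeg u v h)
  constructor
  · refine le_trans (le_of_eq (nsmul_eq_mul _ _).symm)
      (card_nsmul_le_sum (A.filter fun e => v ∈ e) _ _ fun f hf => ?_)
    obtain ⟨hf, hv⟩ := mem_filter.1 hf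
    have := le_card_not_disjoint_of_mem (hS.card_edge f (hV.subA hf)) hσ hcod
      (fun w hw => (hdeg w (hAU f hf hw)).1) hv
    nlinarith
  · refine le_trans (sum_le_card_nsmul (A.filter fun e => v ∈ e) _ _ fun f hf => ?_)
      (le_of_eq (nsmul_eq_mul _ _))
    obtain ⟨hf, hv⟩ := mem_filter.1 hf
    have := card_not_disjoint_le_of_mem (hS.card_edge f (hV.subA hf))
      (fun w hw => (hdeg w (hAU f hf hw)).2) hv
    nlinarith

theorem card_mul_eq_sum_deg (hA : ∀ e ∈ A, e.card = r) (hAU : ∀ e ∈ A, e ⊆ U) :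
    (A.card * r : ℝ) = ∑ v ∈ U, (deg A v : ℝ) := by
  have : ∑ v ∈ U, deg A v = ∑ e ∈ A, e.card := by
    simp only [deg, card_filter]
    rw [sum_comm]
    refine sum_congr rfl fun e he => ?_
    rw [← card_filter, filter_mem_eq_inter, inter_eq_right.2 (hAU e he)]
  rw [sum_congr rfl hA, sum_const, smul_eq_mul] at this
  exact_mod_cast this.symm

theorem card_available_bounds (hr : 0 < r) (hA : ∀ e ∈ A, e.card = r) (hAU : ∀ e ∈ A, e ⊆ U)
    (hdeg : ∀ v ∈ U, D - err ≤ deg A v ∧ (deg A v : ℝ) ≤ D + err) (ha : a * U.card = r) :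
    D - err ≤ a * A.card ∧ a * A.card ≤ D + err := by
  have h := card_mul_eq_sum_deg hA hAU
  have h1 := card_nsmul_le_sum U (fun v => (deg A v : ℝ)) _ fun v hv => (hdeg v hv).1
  have h2 := sum_le_card_nsmul U (fun v => (deg A v : ℝ)) _ fun v hv => (hdeg v hv).2
  rw [← h, nsmul_eq_mul] at h1 h2
  have hr' : (0 : ℝ) < r := by exact_mod_cast hr
  have hU : (0 : ℝ) < U.card := by
    rcases (Nat.cast_nonneg U.card : (0 : ℝ) ≤ U.card).lt_or_eq with h | h
    · exact h
    · rw [← h, mul_zero] at ha; linarith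
  rw [← ha] at h1 h2
  constructor
  · refine le_of_mul_le_mul_left (le_trans h1 (le_of_eq ?_)) hU; ring
  · refine le_of_mul_le_mul_left (le_trans (le_of_eq ?_) h2) hU; ring

theorem drift_upper {s r L D err η : ℝ} (hs : 1 ≤ s) (hr : 1 ≤ r) (hD : 0 < D) (herr : 0 ≤ err)
    (hη : 0 ≤ η) (hηs : η * (s * D) ≤ err) (hηL : η * L ≤ 1)
    (hL : 4 * s + 4 * r + 10 ≤ L) :
    (1 + η) * ((s * D - L * err) * (D + err)) ≤ (1 - η) * ((D - err) * (s * D - r * err)) := by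
  have e1 : (s * D - L * err) * (D + err) ≤ s * D * D - (L - s) * (err * D) := by
    nlinarith [mul_nonneg (by linarith : 0 ≤ L) (mul_nonneg herr herr)]
  have e2 : s * D * D - (s + r) * (err * D) ≤ (D - err) * (s * D - r * err) := by
    nlinarith [mul_nonneg (by linarith : 0 ≤ r) (mul_nonneg herr herr)]
  have hη1 : η ≤ 1 := by nlinarith
  have f1 := mul_le_mul_of_nonneg_left e1 (by linarith : 0 ≤ 1 + η)
  have f2 := mul_le_mul_of_nonneg_left e2 (by linarith : 0 ≤ 1 - η)
  have hED : 0 ≤ err * D := mul_nonneg herr hD.le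
  have e3 : η * (s * D * D) ≤ err * D := by nlinarith
  have e4 : 0 ≤ η * ((L - s) * (err * D)) := mul_nonneg hη (mul_nonneg (by linarith) hED)
  have e5 : 0 ≤ η * ((s + r) * (err * D)) := mul_nonneg hη (mul_nonneg (by linarith) hED)
  have e6 : (2 * s + r + 2) * (err * D) ≤ L * (err * D) :=
    mul_le_mul_of_nonneg_right (by linarith) hED
  nlinarith

theorem drift_lower {s r L D err η : ℝ} (hs : 1 ≤ s) (hr : 1 ≤ r) (hD : 0 < D) (herr : 0 ≤ err)
    (hη : 0 ≤ η) (hηs : η * (s * D) ≤ err) (hηL : η * L ≤ 1)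
    (hL : 4 * s + 4 * r + 10 ≤ L) (herrD : 2 * ((L + r) * err) ≤ D) :
    (1 + η) * ((D + err) * (s * D + (r - 1) * err)) ≤
      (1 - η) * ((s * D + (L - 1) * err) * (D - 2 * err)) := by
  have hED : 0 ≤ err * D := mul_nonneg herr hD.le
  have g1 : L * err * err ≤ err * D := by nlinarith [mul_nonneg (by linarith : 0 ≤ r) herr]
  have g2 : r * err * err ≤ err * D := by nlinarith [mul_nonneg (by linarith : 0 ≤ L) herr]
  have e1 : (D + err) * (s * D + (r - 1) * err) ≤ s * D * D + (s + r) * (err * D) := by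
    nlinarith [mul_nonneg herr herr]
  have e2 : s * D * D + (L - 3 - 2 * s) * (err * D) ≤
      (s * D + (L - 1) * err) * (D - 2 * err) := by
    nlinarith [mul_nonneg herr herr]
  have hη1 : η ≤ 1 := by nlinarith
  have f1 := mul_le_mul_of_nonneg_left e1 (by linarith : 0 ≤ 1 + η)
  have f2 := mul_le_mul_of_nonneg_left e2 (by linarith : 0 ≤ 1 - η)
  have e3 : η * (s * D * D) ≤ err * D := by nlinarith
  have e4 : η * ((L - 3 - 2 * s) * (err * D)) ≤ err * D := by
    have : η * (L - 3 - 2 * s) ≤ 1 := by nlinarith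
    nlinarith
  have e5 : η * ((s + r) * (err * D)) ≤ err * D := by
    have : η * (s + r) ≤ 1 := by nlinarith
    nlinarith
  have e6 : (3 * s + r + 10) * (err * D) ≤ L * (err * D) :=
    mul_le_mul_of_nonneg_right (by linarith) hED
  nlinarith

theorem degree_drift_upper (hr : 0 < r) (hs0 : 0 < s) (hs : s + 1 = r + κ)
    (hS : Sparse r ℓ H 𝒟 𝒯 σ) (hV : Valid r H (𝒟 ∪ 𝒯) M A) (hB : Bounded H 𝒟 𝒯 M q σ)
    (hq : 0 ≤ q) (hAU : ∀ e ∈ A, e ⊆ U)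
    (hdeg : ∀ v ∈ U, D - err ≤ deg A v ∧ (deg A v : ℝ) ≤ D + err) (ha : a * U.card = r)
    (hN : DegreeScale r s L D D' err err' a σ c η g)
    (hw : ∀ f ∈ A, ((blockers (𝒟 ∪ 𝒯) M A f).card : ℝ) ≤ κ * D) {v : V} (hv : v ∈ U) :
    ∑ e ∈ A with v ∉ e, (Real.exp (c * (deg (remaining (𝒟 ∪ 𝒯) M A e) v - (D' + err'))) -
        Real.exp (c * (deg A v - (D + err)))) +
      ∑ f ∈ A, (κ * D - (blockers (𝒟 ∪ 𝒯) M A f).card) *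
        (Real.exp (c * (deg (A.erase f) v - (D + err))) -
          Real.exp (c * (deg A v - (D + err)))) ≤ 0 := by
  have hηn : 0 ≤ η := le_trans (mul_nonneg zero_le_two (mul_nonneg hN.c_nonneg
    (le_trans (by have := hN.σ_one; positivity) hN.σ_le_g))) hN.c_le
  have hs1 : (1 : ℝ) ≤ s := by exact_mod_cast hs0
  have hr1 : (1 : ℝ) ≤ r := by exact_mod_cast hr
  have hL : (4 * s + 4 * r + 10 : ℝ) ≤ L := by exact_mod_cast hN.L_ge
  have hη1 : η ≤ 1 := by nlinarith [hN.η_le]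
  have hg1 : 1 ≤ g := le_trans (by nlinarith [hN.σ_one]) hN.σ_le_g
  have hb : D + err - (D' + err') ≤ g := by linarith [hN.shift_le_g, hN.err_le]
  refine sum_exp_sub_le_zero (A.filter fun e => v ∉ e) A _
    (fun _ => D + err - (D' + err'))
    (fun e => ((A.filter fun f => v ∈ f ∧ Excl (𝒟 ∪ 𝒯) M f e).card : ℝ))
    (fun _ => 0) (fun f => if v ∈ f then 1 else 0) _ _ hN.c_nonneg hN.c_le hη1
    (fun f hf => sub_nonneg.2 (hw f hf)) (fun _ _ => ⟨hN.shift_nonneg, hb⟩) ?_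
    (fun _ _ => ⟨le_rfl, by linarith⟩) ?_ ?_ ?_ ?_
  · intro e he
    exact ⟨Nat.cast_nonneg _, (card_excl_at_le hS hV hB hq (mem_filter.1 he).1
      (mem_filter.1 he).2).trans hN.σ_le_g⟩
  · intro f _
    split_ifs <;> constructor <;> linarith
  · intro e _
    have : (deg (remaining (𝒟 ∪ 𝒯) M A e) v : ℝ) +
      (A.filter fun f => v ∈ f ∧ Excl (𝒟 ∪ 𝒯) M f e).card = deg A v := by
        exact_mod_cast deg_remaining_add (𝒟 ∪ 𝒯) e v
    linarith
  · intro f hf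
    have : (deg (A.erase f) v : ℝ) + (if v ∈ f then 1 else 0) = deg A v := by
      exact_mod_cast deg_erase_add hf v
    linarith
  · rw [deg_loss_eq]
    have h1 := (deg_loss_bounds hS hV hAU hdeg (by linarith [hN.σ_one]) hN.σ_le_err hs v).1
    have h2 := (card_available_bounds hr (fun e he => hS.card_edge e (hV.subA he)) hAU hdeg ha).2
    have h3 := drift_upper hs1 hr1 hN.D_pos hN.err_nonneg hηn hN.η_le_err hN.η_le hL
    simp only [mul_zero, sum_const_zero, add_zero, sum_const, nsmul_eq_mul]
    have h4 : ((A.filter fun e => v ∉ e).card : ℝ) ≤ A.card := by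
      exact_mod_cast card_le_card (filter_subset _ _)
    have hE : 0 ≤ s * D - L * err := by
      by_contra h
      nlinarith [hN.shift_le, hN.shift_nonneg, hN.a_pos]
    have hE2 : 0 ≤ s * D - r * err := by nlinarith [hN.err_nonneg]
    calc (1 + η) * (((A.filter fun e => v ∉ e).card : ℝ) * (D + err - (D' + err')))
        ≤ (1 + η) * (A.card * (a * (s * D - L * err))) := by
          gcongr
          · exact hN.shift_nonneg
          · exact hN.shift_le
      _ = (1 + η) * ((s * D - L * err) * (a * A.card)) := by ring
      _ ≤ (1 + η) * ((s * D - L * err) * (D + err)) := by gcongr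
      _ ≤ _ := h3
      _ ≤ (1 - η) * (deg A v * (s * D - r * err)) := by
          have := (hdeg v hv).1
          have : 0 ≤ 1 - η := by linarith
          gcongr
      _ ≤ _ := by
          have : 0 ≤ 1 - η := by linarith
          gcongr

theorem degree_drift_lower (hr : 0 < r) (hs0 : 0 < s) (hs : s + 1 = r + κ)
    (hS : Sparse r ℓ H 𝒟 𝒯 σ) (hV : Valid r H (𝒟 ∪ 𝒯) M A) (hB : Bounded H 𝒟 𝒯 M q σ)
    (hq : 0 ≤ q) (hAU : ∀ e ∈ A, e ⊆ U)
    (hdeg : ∀ v ∈ U, D - err ≤ deg A v ∧ (deg A v : ℝ) ≤ D + err) (ha : a * U.card = r)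
    (hN : DegreeScale r s L D D' err err' a σ c η g)
    (hw : ∀ f ∈ A, ((blockers (𝒟 ∪ 𝒯) M A f).card : ℝ) ≤ κ * D) {v : V} (hv : v ∈ U) :
    ∑ e ∈ A with v ∉ e, (Real.exp (c * (D' - err' - deg (remaining (𝒟 ∪ 𝒯) M A e) v)) -
        Real.exp (c * (D - err - deg A v))) +
      ∑ f ∈ A, (κ * D - (blockers (𝒟 ∪ 𝒯) M A f).card) *
        (Real.exp (c * (D - err - deg (A.erase f) v)) -
          Real.exp (c * (D - err - deg A v))) ≤ 0 := by
  have hηn : 0 ≤ η := le_trans (mul_nonneg zero_le_two (mul_nonneg hN.c_nonneg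
    (le_trans (by have := hN.σ_one; positivity) hN.σ_le_g))) hN.c_le
  have hs1 : (1 : ℝ) ≤ s := by exact_mod_cast hs0
  have hr1 : (1 : ℝ) ≤ r := by exact_mod_cast hr
  have hL : (4 * s + 4 * r + 10 : ℝ) ≤ L := by exact_mod_cast hN.L_ge
  have hη1 : η ≤ 1 := by nlinarith [hN.η_le]
  have hg1 : 1 ≤ g := le_trans (by nlinarith [hN.σ_one]) hN.σ_le_g
  have hb : 0 ≤ D - err - (D' - err') := by linarith [hN.shift_nonneg, hN.err_le]
  refine sum_exp_sub_le_zero (A.filter fun e => v ∉ e) A _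
    (fun e => ((A.filter fun f => v ∈ f ∧ Excl (𝒟 ∪ 𝒯) M f e).card : ℝ))
    (fun _ => D - err - (D' - err')) (fun f => if v ∈ f then 1 else 0)
    (fun _ => 0) _ _ hN.c_nonneg hN.c_le hη1
    (fun f hf => sub_nonneg.2 (hw f hf)) ?_ (fun _ _ => ⟨hb, hN.shift_le_g⟩) ?_
    (fun _ _ => ⟨le_rfl, by linarith⟩) ?_ ?_ ?_
  · intro e he
    exact ⟨Nat.cast_nonneg _, (card_excl_at_le hS hV hB hq (mem_filter.1 he).1
      (mem_filter.1 he).2).trans hN.σ_le_g⟩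
  · intro f _
    split_ifs <;> constructor <;> linarith
  · intro e _
    have : (deg (remaining (𝒟 ∪ 𝒯) M A e) v : ℝ) +
      (A.filter fun f => v ∈ f ∧ Excl (𝒟 ∪ 𝒯) M f e).card = deg A v := by
        exact_mod_cast deg_remaining_add (𝒟 ∪ 𝒯) e v
    linarith
  · intro f hf
    have : (deg (A.erase f) v : ℝ) + (if v ∈ f then 1 else 0) = deg A v := by
      exact_mod_cast deg_erase_add hf v
    linarith
  · rw [deg_loss_eq]
    have h1 := (deg_loss_bounds hS hV hAU hdeg (by linarith [hN.σ_one]) hN.σ_le_err hs v).2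
    have h2 := (card_available_bounds hr (fun e he => hS.card_edge e (hV.subA he)) hAU hdeg ha).1
    have h3 := drift_lower hs1 hr1 hN.D_pos hN.err_nonneg hηn hN.η_le_err hN.η_le hL hN.err_le_D
    simp only [mul_zero, sum_const_zero, add_zero, sum_const, nsmul_eq_mul]
    have h4 : ((A.filter fun e => v ∉ e).card : ℝ) + deg A v = A.card := by
      rw [deg, add_comm]
      exact_mod_cast card_filter_add_card_filter_not (s := A) (fun e => v ∈ e)
    have herr := hN.err_nonneg
    have hD := hN.D_pos
    have herrD : err ≤ D := by nlinarith [hN.err_le_D]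
    have h5 : D - 2 * err ≤ a * (A.filter fun e => v ∉ e).card := by
      have h6 : a * deg A v ≤ a * (2 * D) := by
        have := (hdeg v hv).2
        have := hN.a_pos
        gcongr; linarith
      have := hN.a_le_err
      have : a * (A.filter fun e => v ∉ e).card = a * A.card - a * deg A v := by
        rw [← h4]; ring
      linarith
    have h7 : 0 ≤ 1 - η := by linarith
    have h8 : (0 : ℝ) ≤ s * D + (L - 1) * err := by
      have : (0 : ℝ) ≤ L - 1 := by linarith
      positivity
    have h9 : (0 : ℝ) ≤ s * D + (r - 1) * err := by
      have : (0 : ℝ) ≤ r - 1 := by linarith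
      positivity
    calc _ ≤ (1 + η) * (deg A v * (s * D + (r - 1) * err)) := by gcongr
      _ ≤ (1 + η) * ((D + err) * (s * D + (r - 1) * err)) := by
          have := (hdeg v hv).2
          gcongr
      _ ≤ _ := h3
      _ ≤ (1 - η) * ((s * D + (L - 1) * err) * (a * (A.filter fun e => v ∉ e).card)) := by gcongr
      _ = (1 - η) * ((A.filter fun e => v ∉ e).card * (a * (s * D + (L - 1) * err))) := by ring
      _ ≤ _ := by
          have := hN.le_shift
          gcongr

end DegreeDrift

/-- The numerical relations needed for tracking `danger`, where the weight `y` is replaced by `y'`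
after one more edge has been chosen. -/
structure DangerScale (r s ℓ g₀ : ℕ) (D err a y y' σ ι c η g : ℝ) : Prop where
  D_pos : 0 < D
  y_pos : 0 < y
  y_mul : y * D = 2
  y_le : y ≤ y'
  a_nonneg : 0 ≤ a
  ι_nonneg : 0 ≤ ι
  σ_nonneg : 0 ≤ σ
  pow_le : ∀ m ≤ ℓ, y' ^ m - y ^ m ≤ y ^ m * (m * (s * (1 + ι) * a))
  a_le : ℓ * (s * (1 + ι) * a) ≤ ι
  gain_le : 2 * g₀ * (ℓ * (s * (1 + ι) * a)) + (1 + ι) * (y * σ) ≤ g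
  loss_le : (r + 1) * (y * σ) ≤ g
  c_nonneg : 0 ≤ c
  c_le : 2 * (c * g) ≤ η
  η_le_one : η ≤ 1
  drift : (1 + η) * (s * (1 + ι) * (D + err) + (1 + ι) * (D / 2)) ≤
    (1 - η) * ((s + 1) * D - r * err - r ^ 2 * σ - 1 - (ℓ + 1) * ((r + 1) ^ 2 * σ))

section DangerDrift

variable {V : Type*} [DecidableEq V] {r ℓ s κ g₀ : ℕ} {H : Finset (Finset V)}
  {𝒟 𝒯 : Finset (Finset (Finset V))} {M A : Finset (Finset V)} {U : Finset V}
  {D err a y y' σ ι c η g : ℝ} {f : Finset V}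

theorem subset_of_mem_live {C : Finset (Finset V)} (hC : C ∈ live 𝒟 M A f) :
    C.erase f \ M ⊆ A := by
  intro x hx
  obtain ⟨h1, h2⟩ := Finset.mem_sdiff.1 hx
  exact (mem_union.1 ((mem_filter.1 hC).2.2 h1)).resolve_left h2

theorem sum_live_at_le (hV : Valid r H (𝒟 ∪ 𝒯) M A) (hB : Bounded H 𝒟 𝒯 M y σ) (hy : 0 ≤ y)
    (hf : f ∈ A) (v : V) :
    ∑ C ∈ live 𝒟 M A f, ∑ _c ∈ C.erase f \ M with v ∈ _c, y ^ (C.erase f \ M).card ≤ y * σ := by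
  rw [sum_sigma']
  refine le_trans ?_ (mul_le_mul_of_nonneg_left (hB.T f (hV.subA hf) v) hy)
  rw [mul_sum]
  refine sum_le_sum_of_injOn _ _ _ _ (fun x => (x.1, x.2)) (fun _ _ => by positivity) ?_ ?_ ?_
  · rintro ⟨C, c⟩ hx
    obtain ⟨h1, h2⟩ := mem_sigma.1 hx
    obtain ⟨h2, h3⟩ := mem_filter.1 h2
    have h4 := subset_of_mem_live h1 h2
    obtain ⟨h5, h6⟩ := mem_erase.1 (Finset.mem_sdiff.1 h2).1
    obtain ⟨h7, h8⟩ := mem_filter.1 h1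
    exact mem_filter.2 ⟨mem_product.2 ⟨mem_union_left _ h7, hV.subA h4⟩, h8.1, h6, h5, h3⟩
  · rintro ⟨C, c⟩ - ⟨C', c'⟩ - h
    simp only [Prod.mk.injEq] at h
    obtain ⟨rfl, rfl⟩ := h
    rfl
  · rintro ⟨C, c⟩ hx
    obtain ⟨h1, h2⟩ := mem_sigma.1 hx
    obtain ⟨h2, h3⟩ := mem_filter.1 h2
    have : wT f (C, c) \ M = (C.erase f \ M).erase c := by
      ext x; simp only [wT, Finset.mem_sdiff, mem_insert, mem_singleton, mem_erase]; tauto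
    dsimp only
    rw [this, ← pow_succ', card_erase_add_one h2]

theorem sum_live_blocked_le (hV : Valid r H (𝒟 ∪ 𝒯) M A) (hB : Bounded H 𝒟 𝒯 M y σ) (hy : 0 ≤ y)
    (hM : ∀ e ∈ A, e ∉ M) (hf : f ∈ A) {e : Finset V} (he : e ∈ A) (hne : e ≠ f)
    (h : ¬ Excl (𝒟 ∪ 𝒯) M e f) :
    ∑ C ∈ live 𝒟 M A f with e ∉ C, ∑ _c ∈ C.erase f \ M with Blocks (𝒟 ∪ 𝒯) M e _c,
      y ^ (C.erase f \ M).card ≤ y * σ := by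
  have hd : Disjoint e f := by
    by_contra h'; exact h (Or.inl h')
  have ht : ({e, f} : Finset (Finset V)) ∉ 𝒯 := fun h' => h <| Or.inr
    ⟨_, mem_union_right _ h', by rw [pair_comm]; exact insert_subset_insert _ (by simp)⟩
  rw [sum_sigma']
  refine le_trans ?_ (mul_le_mul_of_nonneg_left
    (hB.P e (hV.subA he) f (hV.subA hf) hd ht) hy)
  rw [mul_sum]
  have hex : ∀ c, c ∈ A ∧ Blocks (𝒟 ∪ 𝒯) M e c → ∃ C ∈ 𝒟 ∪ 𝒯,
      e ∈ C ∧ c ∈ C ∧ e ≠ c ∧ C \ {e, c} ⊆ M ∧ C ⊆ insert c (insert e M) := fun c hc =>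
    hV.exists_of_blocks he hc.1 hc.2
  choose! φ hφ using hex
  refine sum_le_sum_of_injOn _ _ _ _ (fun x => (φ x.2, x.1, x.2))
    (fun _ _ => by positivity) ?_ ?_ ?_
  · rintro ⟨C, c⟩ hx
    obtain ⟨h1, h2⟩ := mem_sigma.1 hx
    obtain ⟨h2, h3⟩ := mem_filter.1 h2
    obtain ⟨h1, h9⟩ := mem_filter.1 h1
    have h4 := subset_of_mem_live h1 h2
    obtain ⟨h5, h6⟩ := mem_erase.1 (Finset.mem_sdiff.1 h2).1
    obtain ⟨h7, h8⟩ := mem_filter.1 h1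
    obtain ⟨a1, a2, a3, a4, a5, a6⟩ := hφ c ⟨h4, h3⟩
    refine mem_filter.2 ⟨mem_product.2 ⟨a1, mem_product.2 ⟨mem_union_left _ h7, hV.subA h4⟩⟩,
      a2, h9, h8.1, fun h' => ?_, a3, h6⟩
    have := a6 h'
    simp only [mem_insert, hM f hf, hne.symm, or_false] at this
    exact h5 this.symm
  · rintro ⟨C, c⟩ - ⟨C', c'⟩ - h
    simp only [Prod.mk.injEq] at h
    obtain ⟨-, rfl, rfl⟩ := h
    rfl
  · rintro ⟨C, c⟩ hx
    obtain ⟨h1, h2⟩ := mem_sigma.1 hx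
    obtain ⟨h2, h3⟩ := mem_filter.1 h2
    obtain ⟨h1, h9⟩ := mem_filter.1 h1
    obtain ⟨a1, a2, a3, a4, a5, a6⟩ := hφ c ⟨subset_of_mem_live h1 h2, h3⟩
    have : wP e f (φ c, C, c) \ M = (C.erase f \ M).erase c := by
      ext x
      simp only [wP, Finset.mem_sdiff, mem_insert, mem_singleton, mem_erase, mem_union]
      have := @a6 x
      simp only [mem_insert] at this
      have h10 : x = e → x ∉ C := fun h => h ▸ h9
      tauto
    dsimp only
    rw [this, ← pow_succ', card_erase_add_one h2]

theorem sum_live_mem_le (hV : Valid r H (𝒟 ∪ 𝒯) M A) (hB : Bounded H 𝒟 𝒯 M y σ) (hy : 0 ≤ y)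
    (hf : f ∈ A) {e : Finset V} (he : e ∈ A) (h : ¬ Excl (𝒟 ∪ 𝒯) M e f) :
    ∑ C ∈ live 𝒟 M A f with e ∈ C.erase f \ M, y ^ ((C.erase f \ M).card - 1) ≤ y * σ := by
  refine le_trans ?_ (mul_le_mul_of_nonneg_left (hB.R f (hV.subA hf) e (hV.subA he)) hy)
  rw [mul_sum]
  have hex : ∀ C ∈ (live 𝒟 M A f).filter fun C => e ∈ C.erase f \ M,
      ∃ h ∈ C.erase f \ M, h ≠ e := by
    intro C hC
    by_contra! hcon
    obtain ⟨h1, h2⟩ := mem_filter.1 hC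
    refine h (Or.inr ⟨C, mem_union_left _ (mem_filter.1 h1).1, fun x hx => ?_⟩)
    simp only [mem_insert]
    by_contra! hx'
    exact hx'.2.1 (hcon x (Finset.mem_sdiff.2 ⟨mem_erase.2 ⟨hx'.1, hx⟩, hx'.2.2⟩))
  choose! φ hφ using hex
  refine sum_le_sum_of_injOn _ _ _ _ (fun C => (C, φ C)) (fun _ _ => by positivity) ?_ ?_ ?_
  · intro C hC
    obtain ⟨h1, h2⟩ := hφ C hC
    obtain ⟨h3, h4⟩ := mem_filter.1 hC
    have h5 := subset_of_mem_live h3 h1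
    obtain ⟨h7, h8⟩ := mem_filter.1 h3
    have h9 := mem_erase.1 (Finset.mem_sdiff.1 h1).1
    have h10 := mem_erase.1 (Finset.mem_sdiff.1 h4).1
    exact mem_filter.2 ⟨mem_product.2 ⟨mem_union_left _ h7, hV.subA h5⟩, h8.1, h10.2, h9.2,
      h10.1.symm, h9.1, h2⟩
  · intro C _ C' _ h
    exact (Prod.ext_iff.1 h).1
  · intro C hC
    obtain ⟨h1, h2⟩ := hφ C hC
    obtain ⟨h3, h4⟩ := mem_filter.1 hC
    have : wR f e (C, φ C) \ M = ((C.erase f \ M).erase e).erase (φ C) := by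
      ext x; simp only [wR, Finset.mem_sdiff, mem_insert, mem_singleton, mem_erase]; tauto
    rw [this, ← pow_succ', card_erase_add_one (mem_erase.2 ⟨h2, h1⟩), card_erase_of_mem h4]

/-- The conflicts at `f` that are no longer live once `e` has been chosen. -/
def killed (𝒟 𝒞 : Finset (Finset (Finset V))) (M A : Finset (Finset V)) (f e : Finset V) :
    Finset (Finset (Finset V)) :=
  (live 𝒟 M A f).filter fun C => ∃ x ∈ C.erase f \ M, x ≠ e ∧ Excl 𝒞 M e x

theorem sum_killed_le (hS : Sparse r ℓ H 𝒟 𝒯 σ) (hV : Valid r H (𝒟 ∪ 𝒯) M A)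
    (hB : Bounded H 𝒟 𝒯 M y σ) (hy : 0 ≤ y) (hr : 0 < r)
    (hf : f ∈ A) {e : Finset V} (he : e ∈ A) (h : ¬ Excl (𝒟 ∪ 𝒯) M e f) :
    ∑ C ∈ killed 𝒟 (𝒟 ∪ 𝒯) M A f e, y ^ (C.erase f \ M).card ≤ (r + 1) * (y * σ) := by
  have hM := fun e he => hV.notMem hS.card_edge hr (e := e) he
  have hre := hS.card_edge e (hV.subA he)
  have hene : e.Nonempty := card_pos.1 (by omega)
  have hne : e ≠ f := by
    rintro rfl
    exact h (Or.inl fun h' => hene.ne_empty ((disjoint_self_iff_empty e).1 h'))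
  have key : ∑ C ∈ killed 𝒟 (𝒟 ∪ 𝒯) M A f e, y ^ (C.erase f \ M).card ≤
      ∑ C ∈ live 𝒟 M A f, (∑ v ∈ e, ∑ _c ∈ C.erase f \ M with v ∈ _c, y ^ (C.erase f \ M).card +
        if e ∉ C then ∑ _c ∈ C.erase f \ M with Blocks (𝒟 ∪ 𝒯) M e _c, y ^ (C.erase f \ M).card
          else 0) := by
    rw [killed, sum_filter]
    refine sum_le_sum fun C hC => ?_
    have n1 : ∀ v, 0 ≤ ∑ _c ∈ C.erase f \ M with v ∈ _c, y ^ (C.erase f \ M).card := fun v =>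
      sum_nonneg fun _ _ => by positivity
    have n2 : 0 ≤ if e ∉ C then ∑ _c ∈ C.erase f \ M with Blocks (𝒟 ∪ 𝒯) M e _c,
        y ^ (C.erase f \ M).card else 0 := by
      by_cases h : e ∈ C
      · rw [if_neg (not_not.2 h)]
      · rw [if_pos h]
        exact sum_nonneg fun _ _ => by positivity
    have n3 : 0 ≤ ∑ v ∈ e, ∑ _c ∈ C.erase f \ M with v ∈ _c, y ^ (C.erase f \ M).card :=
      sum_nonneg fun v _ => n1 v
    have inter : ∀ v ∈ e, ∀ x ∈ C.erase f \ M, v ∈ x → y ^ (C.erase f \ M).card ≤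
        ∑ v ∈ e, ∑ _c ∈ C.erase f \ M with v ∈ _c, y ^ (C.erase f \ M).card := by
      intro v hv x hx hvx
      refine le_trans ?_ (single_le_sum (f := fun v => ∑ _c ∈ C.erase f \ M with v ∈ _c,
        y ^ (C.erase f \ M).card) (fun v _ => n1 v) hv)
      exact single_le_sum (f := fun _ => y ^ (C.erase f \ M).card) (fun _ _ => by positivity)
        (mem_filter.2 ⟨hx, hvx⟩)
    by_cases h2 : e ∈ C
    · rw [if_neg (not_not.2 h2), add_zero]
      split_ifs with h1
      · obtain ⟨v, hv⟩ := hene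
        exact inter v hv e (Finset.mem_sdiff.2 ⟨mem_erase.2 ⟨hne, h2⟩, hM e he⟩) hv
      · exact n3
    · rw [if_pos h2] at n2 ⊢
      split_ifs with h1
      · obtain ⟨x, hx, hxe, hex⟩ := h1
        rcases hex with hex | hex
        · obtain ⟨v, hv, hvx⟩ := not_disjoint_iff.1 hex
          linarith [inter v hv x hx hvx]
        · refine le_trans ?_ (le_add_of_nonneg_left n3)
          exact single_le_sum (f := fun _ => y ^ (C.erase f \ M).card) (fun _ _ => by positivity)
            (mem_filter.2 ⟨hx, hex⟩)
      · linarith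
  refine key.trans ?_
  rw [sum_add_distrib, ← sum_filter, sum_comm]
  have h1 := sum_le_card_nsmul e _ _ fun v _ => sum_live_at_le hV hB hy hf v
  have h2 := sum_live_blocked_le hV hB hy hM hf he hne h
  rw [hre, nsmul_eq_mul] at h1
  linarith

theorem danger_add_le (hy : 0 < y) (hyy : y ≤ y') {e : Finset V} (he : e ∈ A) :
    danger 𝒟 (insert e M) (remaining (𝒟 ∪ 𝒯) M A e) y' f ≤ danger 𝒟 M A y f +
      (∑ C ∈ live 𝒟 M A f, ((y' ^ (C.erase f \ M).card - y ^ (C.erase f \ M).card) +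
        if e ∈ C.erase f \ M then y' ^ ((C.erase f \ M).card - 1) else 0) -
      ∑ C ∈ killed 𝒟 (𝒟 ∪ 𝒯) M A f e, y ^ (C.erase f \ M).card) := by
  have hremA : remaining (𝒟 ∪ 𝒯) M A e ⊆ A := filter_subset _ _
  have hsub : live 𝒟 (insert e M) (remaining (𝒟 ∪ 𝒯) M A e) f ⊆ live 𝒟 M A f := by
    intro C hC
    obtain ⟨h1, h2, h3⟩ := mem_filter.1 hC
    refine mem_filter.2 ⟨h1, h2, fun x hx => ?_⟩
    have := h3 hx
    simp only [mem_union, mem_insert] at this ⊢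
    rcases this with (rfl | h) | h
    exacts [Or.inr he, Or.inl h, Or.inr (hremA h)]
  rw [killed, sum_filter, danger, danger, ← add_sub_assoc, ← sum_add_distrib, ← sum_sub_distrib]
  refine le_trans (sum_le_sum fun C hC => ?_) (sum_le_sum_of_subset_of_nonneg hsub fun C hC _ => ?_)
  · have hlive := hsub hC
    have hnk : ¬ ∃ x ∈ C.erase f \ M, x ≠ e ∧ Excl (𝒟 ∪ 𝒯) M e x := by
      rintro ⟨x, hx, hxe, hex⟩
      have h3 := (mem_filter.1 hC).2.2 (Finset.mem_sdiff.1 hx).1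
      simp only [mem_union, mem_insert, hxe, false_or, (Finset.mem_sdiff.1 hx).2] at h3
      exact (mem_filter.1 h3).2 hex
    rw [if_neg hnk, sub_zero]
    have hs : C.erase f \ insert e M = (C.erase f \ M).erase e := by
      ext x; simp only [Finset.mem_sdiff, mem_insert, mem_erase]; tauto
    rw [hs]
    have hp : y ^ (C.erase f \ M).card ≤ y' ^ (C.erase f \ M).card := by gcongr
    split_ifs with h
    · rw [card_erase_of_mem h]
      have : 0 ≤ y' ^ (C.erase f \ M).card := pow_nonneg (hy.le.trans hyy) _
      linarith
    · rw [erase_eq_of_notMem h]; linarith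
  · have hp : y ^ (C.erase f \ M).card ≤ y' ^ (C.erase f \ M).card := by gcongr
    have h1 : 0 ≤ y ^ (C.erase f \ M).card := by positivity
    have h2 : 0 ≤ y' ^ ((C.erase f \ M).card - 1) := pow_nonneg (hy.le.trans hyy) _
    split_ifs <;> linarith

theorem danger_erase_le (hy : 0 ≤ y) {x : Finset V} (hx : x ∉ M) :
    danger 𝒟 M (A.erase x) y f ≤ danger 𝒟 M A y f + (0 -
      ∑ C ∈ live 𝒟 M A f with x ∈ C.erase f \ M, y ^ (C.erase f \ M).card) := by
  rw [zero_sub, ← sub_eq_add_neg, sum_filter, danger, danger, ← sum_sub_distrib]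
  have hsub : live 𝒟 M (A.erase x) f ⊆ live 𝒟 M A f := by
    intro C hC
    obtain ⟨h1, h2, h3⟩ := mem_filter.1 hC
    exact mem_filter.2 ⟨h1, h2, h3.trans (union_subset_union_right (erase_subset _ _))⟩
  refine le_trans (sum_le_sum fun C hC => ?_) (sum_le_sum_of_subset_of_nonneg hsub fun C hC _ => ?_)
  · have : x ∉ C.erase f \ M := by
      intro h
      have := (mem_filter.1 hC).2.2 (Finset.mem_sdiff.1 h).1
      simp [hx] at this
    rw [if_neg this, sub_zero]
  · have h1 : 0 ≤ y ^ (C.erase f \ M).card := by positivity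
    split_ifs <;> linarith

end DangerDrift

section LossCount

variable {V : Type*} [DecidableEq V] {r ℓ s κ : ℕ} {H : Finset (Finset V)}
  {𝒟 𝒯 : Finset (Finset (Finset V))} {M A : Finset (Finset V)} {U : Finset V}
  {D err q σ : ℝ} {f : Finset V}

theorem card_excl_erase_ge (hr : 0 < r)
    (hS : Sparse r ℓ H 𝒟 𝒯 σ) (hV : Valid r H (𝒟 ∪ 𝒯) M A) (hσ : 0 ≤ σ)
    (hAU : ∀ e ∈ A, e ⊆ U) (hdeg : ∀ v ∈ U, D - err ≤ deg A v)
    {c : Finset V} (hc : c ∈ A) :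
    r * D - r * err - r ^ 2 * σ - 1 + (blockers (𝒟 ∪ 𝒯) M A c).card ≤
      ((A.filter fun e => c ≠ e ∧ Excl (𝒟 ∪ 𝒯) M e c).card : ℝ) := by
  have hcard := hS.card_edge c (hV.subA hc)
  obtain ⟨v, hv⟩ : c.Nonempty := card_pos.1 (by omega)
  have hcod : ∀ u v : V, u ≠ v → ((A.filter fun e => u ∈ e ∧ v ∈ e).card : ℝ) ≤ σ := fun u v h =>
    le_trans (by exact_mod_cast card_le_card (filter_subset_filter _ hV.subA)) (hS.codeg u v h)
  have h1 := le_card_not_disjoint_of_mem hcard hσ hcod (fun v hv => hdeg v (hAU c hc hv)) hv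
  have h2 := hdeg v (hAU c hc hv)
  have h3 : (A.filter fun e => ¬ Disjoint e c).card + (blockers (𝒟 ∪ 𝒯) M A c).card ≤
      (A.filter fun e => c ≠ e ∧ Excl (𝒟 ∪ 𝒯) M e c).card + 1 := by
    rw [← card_union_of_disjoint]
    · refine (card_le_card (t := insert c (A.filter fun e => c ≠ e ∧ Excl (𝒟 ∪ 𝒯) M e c))
        fun e he => ?_).trans (card_insert_le _ _)
      by_cases hec : e = c
      · exact hec ▸ mem_insert_self _ _
      · refine mem_insert_of_mem ?_
        rcases mem_union.1 he with he | he
        · exact mem_filter.2 ⟨(mem_filter.1 he).1, Ne.symm hec, Or.inl (mem_filter.1 he).2⟩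
        · exact mem_filter.2 ⟨(mem_filter.1 he).1, Ne.symm hec, Or.inr (mem_filter.1 he).2.2⟩
    · exact Finset.disjoint_left.2 fun e he he' =>
        (mem_filter.1 he).2 (mem_filter.1 he').2.1
  have h4 : ((A.filter fun e => ¬ Disjoint e c).card : ℝ) + (blockers (𝒟 ∪ 𝒯) M A c).card ≤
      (A.filter fun e => c ≠ e ∧ Excl (𝒟 ∪ 𝒯) M e c).card + 1 := by exact_mod_cast h3
  linarith

theorem loss_count (hr : 0 < r) (hs : s + 1 = r + κ)
    (hS : Sparse r ℓ H 𝒟 𝒯 σ) (hV : Valid r H (𝒟 ∪ 𝒯) M A) (hB : Bounded H 𝒟 𝒯 M q σ)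
    (hq : 0 ≤ q) (hσ : 0 ≤ σ) (hAU : ∀ e ∈ A, e ⊆ U) (hdeg : ∀ v ∈ U, D - err ≤ deg A v)
    (hf : f ∈ A) {T : Finset (Finset V)} (hTA : T ⊆ A) (hT : T.card ≤ ℓ)
    (hTf : ∀ c ∈ T, Disjoint c f ∧ ({c, f} : Finset (Finset V)) ∉ 𝒯)
    (hTT : ∀ c ∈ T, ∀ c' ∈ T, c ≠ c' → Disjoint c c' ∧ ({c, c'} : Finset (Finset V)) ∉ 𝒯) :
    T.card * ((s + 1) * D - r * err - r ^ 2 * σ - 1 - (ℓ + 1) * ((r + 1) ^ 2 * σ)) ≤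
      ((A.filter fun e => ¬ Excl (𝒟 ∪ 𝒯) M e f ∧
        ∃ c ∈ T, c ≠ e ∧ Excl (𝒟 ∪ 𝒯) M e c).card : ℝ) +
      ∑ c ∈ T, (κ * D - (blockers (𝒟 ∪ 𝒯) M A c).card) := by
  have hpt : ∀ e ∈ A, (T.filter fun c => c ≠ e ∧ Excl (𝒟 ∪ 𝒯) M e c).card ≤
      (if ¬ Excl (𝒟 ∪ 𝒯) M e f ∧ ∃ c ∈ T, c ≠ e ∧ Excl (𝒟 ∪ 𝒯) M e c then 1 else 0) +
      (T.offDiag.filter fun p => Excl (𝒟 ∪ 𝒯) M e p.1 ∧ Excl (𝒟 ∪ 𝒯) M e p.2).card +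
      (T.filter fun c => Excl (𝒟 ∪ 𝒯) M e c ∧ Excl (𝒟 ∪ 𝒯) M e f).card := by
    intro e _
    by_cases hef : Excl (𝒟 ∪ 𝒯) M e f
    · refine (card_le_card fun c hc => ?_).trans (Nat.le_add_left _ _)
      obtain ⟨h1, h2⟩ := mem_filter.1 hc
      exact mem_filter.2 ⟨h1, h2.2, hef⟩
    · set K := T.filter fun c => c ≠ e ∧ Excl (𝒟 ∪ 𝒯) M e c with hK
      rcases K.eq_empty_or_nonempty with h0 | ⟨c, hc⟩
      · rw [h0, card_empty]; exact Nat.zero_le _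
      · have hif : ¬ Excl (𝒟 ∪ 𝒯) M e f ∧ ∃ c ∈ T, c ≠ e ∧ Excl (𝒟 ∪ 𝒯) M e c :=
          ⟨hef, c, (mem_filter.1 hc).1, (mem_filter.1 hc).2⟩
        rw [if_pos hif]
        have h1 : K.offDiag.card ≤ (T.offDiag.filter fun p =>
            Excl (𝒟 ∪ 𝒯) M e p.1 ∧ Excl (𝒟 ∪ 𝒯) M e p.2).card := by
          refine card_le_card fun p hp => ?_
          obtain ⟨a1, a2, a3⟩ := mem_offDiag.1 hp
          exact mem_filter.2 ⟨mem_offDiag.2 ⟨(mem_filter.1 a1).1, (mem_filter.1 a2).1, a3⟩,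
            (mem_filter.1 a1).2.2, (mem_filter.1 a2).2.2⟩
        rw [offDiag_card] at h1
        have h2 : K.card ≤ K.card * K.card - K.card + 1 := by
          rcases K.card with _ | k
          · simp
          · have : (k + 1) * (k + 1) - (k + 1) = k * k + k := by
              rw [show (k + 1) * (k + 1) = k * k + k + (k + 1) by ring, Nat.add_sub_cancel]
            rw [this]
            nlinarith
        omega
  have hsum := sum_le_sum hpt
  have swap : ∀ {ι : Type _} (B : Finset ι) (p : Finset V → ι → Prop)
      [∀ e, DecidablePred (p e)] [∀ i, DecidablePred fun e => p e i],
      ∑ e ∈ A, (B.filter (p e)).card = ∑ i ∈ B, (A.filter fun e => p e i).card := by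
    intro ι B p _ _
    simp only [card_filter]
    rw [sum_comm]
  rw [sum_add_distrib, sum_add_distrib, ← card_filter,
    swap T (fun e c => c ≠ e ∧ Excl (𝒟 ∪ 𝒯) M e c),
    swap T.offDiag (fun e p => Excl (𝒟 ∪ 𝒯) M e p.1 ∧ Excl (𝒟 ∪ 𝒯) M e p.2),
    swap T (fun e c => Excl (𝒟 ∪ 𝒯) M e c ∧ Excl (𝒟 ∪ 𝒯) M e f)] at hsum
  have hsum' : (∑ c ∈ T, ((A.filter fun e => c ≠ e ∧ Excl (𝒟 ∪ 𝒯) M e c).card : ℝ)) ≤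
      ((A.filter fun e => ¬ Excl (𝒟 ∪ 𝒯) M e f ∧
        ∃ c ∈ T, c ≠ e ∧ Excl (𝒟 ∪ 𝒯) M e c).card : ℝ) +
      ∑ p ∈ T.offDiag, ((A.filter fun e => Excl (𝒟 ∪ 𝒯) M e p.1 ∧
        Excl (𝒟 ∪ 𝒯) M e p.2).card : ℝ) +
      ∑ c ∈ T, ((A.filter fun e => Excl (𝒟 ∪ 𝒯) M e c ∧ Excl (𝒟 ∪ 𝒯) M e f).card : ℝ) := by
    exact_mod_cast hsum
  have g1 := sum_le_card_nsmul T.offDiag (fun p => ((A.filter fun e =>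
    Excl (𝒟 ∪ 𝒯) M e p.1 ∧ Excl (𝒟 ∪ 𝒯) M e p.2).card : ℝ)) ((r + 1) ^ 2 * σ) fun p hp => by
      obtain ⟨a1, a2, a3⟩ := mem_offDiag.1 hp
      exact card_common_excl_le hS hV hB hr hq (hTA a1) (hTA a2) (hTT _ a1 _ a2 a3).1
        (hTT _ a1 _ a2 a3).2
  have g2 := sum_le_card_nsmul T (fun c => ((A.filter fun e =>
    Excl (𝒟 ∪ 𝒯) M e c ∧ Excl (𝒟 ∪ 𝒯) M e f).card : ℝ)) ((r + 1) ^ 2 * σ) fun c hc =>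
      card_common_excl_le hS hV hB hr hq (hTA hc) hf (hTf c hc).1 (hTf c hc).2
  have g3 := card_nsmul_le_sum T (fun c => ((A.filter fun e =>
      c ≠ e ∧ Excl (𝒟 ∪ 𝒯) M e c).card : ℝ) + (κ * D - (blockers (𝒟 ∪ 𝒯) M A c).card))
      ((s + 1) * D - r * err - r ^ 2 * σ - 1) fun c hc => by
    have h1 := card_excl_erase_ge hr hS hV hσ hAU hdeg (hTA hc)
    have hs' : (s : ℝ) + 1 = r + κ := by exact_mod_cast hs
    rw [hs']
    linarith
  rw [sum_add_distrib, nsmul_eq_mul] at g3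
  rw [nsmul_eq_mul] at g1 g2
  have g4 : (T.offDiag.card : ℝ) ≤ T.card * ℓ := by
    rw [offDiag_card]
    have : T.card * T.card - T.card ≤ T.card * ℓ :=
      (Nat.sub_le _ _).trans (Nat.mul_le_mul_left _ hT)
    exact_mod_cast this
  have hK : 0 ≤ ((r : ℝ) + 1) ^ 2 * σ := by positivity
  have g5 := mul_le_mul_of_nonneg_right g4 hK
  linarith

variable {g₀ : ℕ} {a y y' ι c η g : ℝ}

theorem danger_drift (hr : 0 < r) (hs : s + 1 = r + κ)
    (hS : Sparse r ℓ H 𝒟 𝒯 σ) (hV : Valid r H (𝒟 ∪ 𝒯) M A) (hB : Bounded H 𝒟 𝒯 M y σ)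
    (hAU : ∀ e ∈ A, e ⊆ U)
    (hdeg : ∀ v ∈ U, D - err ≤ deg A v ∧ (deg A v : ℝ) ≤ D + err) (ha : a * U.card = r)
    (hN : DangerScale r s ℓ g₀ D err a y y' σ ι c η g)
    (hw : ∀ f ∈ A, ((blockers (𝒟 ∪ 𝒯) M A f).card : ℝ) ≤ κ * D)
    (hf : f ∈ A) (hg : danger 𝒟 M A y f ≤ 2 * g₀) :
    ∑ e ∈ A with ¬ Excl (𝒟 ∪ 𝒯) M e f,
      (Real.exp (c * (danger 𝒟 (insert e M) (remaining (𝒟 ∪ 𝒯) M A e) y' f - 2 * g₀)) -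
        Real.exp (c * (danger 𝒟 M A y f - 2 * g₀))) +
      ∑ x ∈ A.erase f, (κ * D - (blockers (𝒟 ∪ 𝒯) M A x).card) *
        (Real.exp (c * (danger 𝒟 M (A.erase x) y f - 2 * g₀)) -
          Real.exp (c * (danger 𝒟 M A y f - 2 * g₀))) ≤ 0 := by
  have hM := fun e he => hV.notMem hS.card_edge hr (e := e) he
  have hy := hN.y_pos
  have hy' : 0 < y' := hy.trans_le hN.y_le
  have hσ := hN.σ_nonneg
  have hyσ : 0 ≤ y * σ := by positivity
  have hι := hN.ι_nonneg
  have hgn : 0 ≤ g := le_trans (by positivity) hN.loss_le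
  have hk : 0 ≤ (s : ℝ) * (1 + ι) * a := by have := hN.a_nonneg; positivity
  have hm : ∀ C ∈ live 𝒟 M A f, (C.erase f \ M).card ≤ ℓ := fun C hC =>
    (card_le_card (sdiff_subset.trans (erase_subset _ _))).trans
      (hS.card_le C (mem_union_left _ (mem_filter.1 hC).1))
  have hpow : ∀ m ≤ ℓ, y' ^ m ≤ (1 + ι) * y ^ m := by
    intro m hm
    have h1 := hN.pow_le m hm
    have h2 : (m : ℝ) * (s * (1 + ι) * a) ≤ ι := le_trans (by gcongr) hN.a_le
    have h3 : 0 ≤ y ^ m := by positivity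
    nlinarith [mul_le_mul_of_nonneg_left h2 h3]
  refine sum_exp_sub_le_zero (A.filter fun e => ¬ Excl (𝒟 ∪ 𝒯) M e f) (A.erase f) _
    (fun e => ∑ C ∈ live 𝒟 M A f, ((y' ^ (C.erase f \ M).card - y ^ (C.erase f \ M).card) +
        if e ∈ C.erase f \ M then y' ^ ((C.erase f \ M).card - 1) else 0))
    (fun e => ∑ C ∈ killed 𝒟 (𝒟 ∪ 𝒯) M A f e, y ^ (C.erase f \ M).card)
    (fun _ => 0)
    (fun x => ∑ C ∈ live 𝒟 M A f with x ∈ C.erase f \ M, y ^ (C.erase f \ M).card)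
    _ _ hN.c_nonneg hN.c_le hN.η_le_one
    (fun x hx => sub_nonneg.2 (hw x (mem_of_mem_erase hx))) ?_ ?_ (fun _ _ => ⟨le_rfl, hgn⟩) ?_ ?_
    ?_ ?_
  · intro e he
    obtain ⟨heA, hef⟩ := mem_filter.1 he
    refine ⟨sum_nonneg fun C hC => ?_, ?_⟩
    · have h1 : y ^ (C.erase f \ M).card ≤ y' ^ (C.erase f \ M).card :=
        pow_le_pow_left₀ hy.le hN.y_le _
      split_ifs
      · have : 0 ≤ y' ^ ((C.erase f \ M).card - 1) := by positivity
        linarith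
      · linarith
    · rw [sum_add_distrib, ← sum_filter]
      have h1 : ∑ C ∈ live 𝒟 M A f, (y' ^ (C.erase f \ M).card - y ^ (C.erase f \ M).card) ≤
          danger 𝒟 M A y f * (ℓ * (s * (1 + ι) * a)) := by
        rw [danger, sum_mul]
        refine sum_le_sum fun C hC => (hN.pow_le _ (hm C hC)).trans ?_
        have := hm C hC
        gcongr
      have h2 : ∑ C ∈ live 𝒟 M A f with e ∈ C.erase f \ M, y' ^ ((C.erase f \ M).card - 1) ≤
          (1 + ι) * (y * σ) := by
        refine le_trans ?_ (mul_le_mul_of_nonneg_left (sum_live_mem_le hV hB hy.le hf heA hef)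
          (by linarith))
        rw [mul_sum]
        exact sum_le_sum fun C hC => hpow _ ((Nat.sub_le _ _).trans (hm C (mem_filter.1 hC).1))
      have h3 : danger 𝒟 M A y f * (ℓ * (s * (1 + ι) * a)) ≤ 2 * g₀ * (ℓ * (s * (1 + ι) * a)) := by
        gcongr
      linarith [hN.gain_le]
  · intro e he
    obtain ⟨heA, hef⟩ := mem_filter.1 he
    exact ⟨sum_nonneg fun _ _ => by positivity,
      (sum_killed_le hS hV hB hy.le hr hf heA hef).trans hN.loss_le⟩
  · intro x hx
    refine ⟨sum_nonneg fun _ _ => by positivity, ?_⟩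
    have hcard := hS.card_edge x (hV.subA (mem_of_mem_erase hx))
    obtain ⟨v, hv⟩ : x.Nonempty := card_pos.1 (by omega)
    have h1 : ∑ C ∈ live 𝒟 M A f with x ∈ C.erase f \ M, y ^ (C.erase f \ M).card ≤ y * σ := by
      refine le_trans ?_ (sum_live_at_le hV hB hy.le hf v)
      rw [sum_filter]
      refine sum_le_sum fun C _ => ?_
      split_ifs with h
      · exact single_le_sum (f := fun _ => y ^ (C.erase f \ M).card) (fun _ _ => by positivity)
          (mem_filter.2 ⟨h, hv⟩)
      · exact sum_nonneg fun _ _ => by positivity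
    refine h1.trans (le_trans ?_ hN.loss_le)
    nlinarith [(Nat.cast_nonneg r : (0 : ℝ) ≤ r)]
  · intro e he
    linarith [danger_add_le (𝒟 := 𝒟) (𝒯 := 𝒯) (M := M) (A := A) (f := f) hy hN.y_le
      (mem_filter.1 he).1]
  · intro x hx
    linarith [danger_erase_le (𝒟 := 𝒟) (A := A) (f := f) hy.le (hM x (mem_of_mem_erase hx))]
  · have hdeg' := card_available_bounds hr (fun e he => hS.card_edge e (hV.subA he)) hAU hdeg ha
    set G := s * (1 + ι) * (D + err) + (1 + ι) * (D / 2) with hG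
    set Λ := (s + 1) * D - r * err - r ^ 2 * σ - 1 - (ℓ + 1) * ((r + 1) ^ 2 * σ) with hΛ
    have gain : ∑ e ∈ A with ¬ Excl (𝒟 ∪ 𝒯) M e f, ∑ C ∈ live 𝒟 M A f,
        ((y' ^ (C.erase f \ M).card - y ^ (C.erase f \ M).card) +
          if e ∈ C.erase f \ M then y' ^ ((C.erase f \ M).card - 1) else 0) ≤
        ∑ C ∈ live 𝒟 M A f, y ^ (C.erase f \ M).card * ((C.erase f \ M).card * G) := by
      refine (sum_le_sum_of_subset_of_nonneg (filter_subset _ _) fun e _ _ =>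
        sum_nonneg fun C _ => ?_).trans ?_
      · have h1 : y ^ (C.erase f \ M).card ≤ y' ^ (C.erase f \ M).card :=
          pow_le_pow_left₀ hy.le hN.y_le _
        split_ifs
        · have : 0 ≤ y' ^ ((C.erase f \ M).card - 1) := by positivity
          linarith
        · linarith
      rw [sum_comm]
      refine sum_le_sum fun C hC => ?_
      rw [sum_add_distrib, sum_const, nsmul_eq_mul, sum_ite_mem,
        inter_eq_right.2 (subset_of_mem_live hC), sum_const, nsmul_eq_mul]
      have h1 := hN.pow_le _ (hm C hC)
      have h2 := hpow _ ((Nat.sub_le _ 1).trans (hm C hC))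
      generalize (C.erase f \ M).card = m at h1 h2 ⊢
      have hym : 0 ≤ y ^ m := by positivity
      have h3 : (m : ℝ) * y' ^ (m - 1) ≤ y ^ m * (m * ((1 + ι) * (D / 2))) := by
        rcases m with _ | m
        · simp
        · rw [Nat.add_sub_cancel] at h2 ⊢
          have : y ^ (m + 1) * ((m + 1 : ℕ) * ((1 + ι) * (D / 2))) =
              (m + 1 : ℕ) * ((1 + ι) * y ^ m) := by
            have := hN.y_mul
            rw [pow_succ]
            linear_combination (y ^ m * ((m + 1 : ℕ) * ((1 + ι) / 2))) * this
          rw [this]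
          gcongr
      have h4 : (A.card : ℝ) * (y' ^ m - y ^ m) ≤ y ^ m * (m * (s * (1 + ι) * (D + err))) := by
        calc (A.card : ℝ) * (y' ^ m - y ^ m) ≤ A.card * (y ^ m * (m * (s * (1 + ι) * a))) := by
              gcongr
          _ = y ^ m * (m * (s * (1 + ι) * (a * A.card))) := by ring
          _ ≤ _ := by
              have := hdeg'.2
              gcongr
      rw [hG, mul_add, mul_add]
      linarith
    have loss : ∑ C ∈ live 𝒟 M A f, y ^ (C.erase f \ M).card * ((C.erase f \ M).card * Λ) ≤
        ∑ e ∈ A with ¬ Excl (𝒟 ∪ 𝒯) M e f,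
          ∑ C ∈ killed 𝒟 (𝒟 ∪ 𝒯) M A f e, y ^ (C.erase f \ M).card +
        ∑ x ∈ A.erase f, (κ * D - (blockers (𝒟 ∪ 𝒯) M A x).card) *
          ∑ C ∈ live 𝒟 M A f with x ∈ C.erase f \ M, y ^ (C.erase f \ M).card := by
      have e1 : ∑ e ∈ A with ¬ Excl (𝒟 ∪ 𝒯) M e f,
          ∑ C ∈ killed 𝒟 (𝒟 ∪ 𝒯) M A f e, y ^ (C.erase f \ M).card =
          ∑ C ∈ live 𝒟 M A f, y ^ (C.erase f \ M).card *
            ((A.filter fun e => ¬ Excl (𝒟 ∪ 𝒯) M e f ∧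
              ∃ c ∈ C.erase f \ M, c ≠ e ∧ Excl (𝒟 ∪ 𝒯) M e c).card : ℝ) := by
        simp only [killed, sum_filter (s := live 𝒟 M A f)]
        rw [sum_comm]
        refine sum_congr rfl fun C _ => ?_
        rw [← sum_filter, filter_filter, sum_const, nsmul_eq_mul, mul_comm]
      have e2 : ∑ x ∈ A.erase f, (κ * D - (blockers (𝒟 ∪ 𝒯) M A x).card) *
          ∑ C ∈ live 𝒟 M A f with x ∈ C.erase f \ M, y ^ (C.erase f \ M).card =
          ∑ C ∈ live 𝒟 M A f, y ^ (C.erase f \ M).card *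
            ∑ x ∈ C.erase f \ M, (κ * D - (blockers (𝒟 ∪ 𝒯) M A x).card) := by
        simp only [sum_filter (s := live 𝒟 M A f), mul_sum]
        rw [sum_comm]
        refine sum_congr rfl fun C hC => ?_
        simp only [mul_ite, mul_zero]
        have hsub : C.erase f \ M ⊆ A.erase f := fun x hx =>
          mem_erase.2 ⟨(mem_erase.1 (Finset.mem_sdiff.1 hx).1).1, subset_of_mem_live hC hx⟩
        rw [sum_ite_mem, inter_eq_right.2 hsub]
        exact sum_congr rfl fun x _ => mul_comm _ _
      rw [e1, e2, ← sum_add_distrib]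
      refine sum_le_sum fun C hC => ?_
      rw [← mul_add]
      obtain ⟨hC1, hC2, -⟩ := mem_filter.1 hC
      have hmem : ∀ x ∈ C.erase f \ M, x ∈ C ∧ x ≠ f := fun x hx =>
        (mem_erase.1 (Finset.mem_sdiff.1 hx).1).symm
      refine mul_le_mul_of_nonneg_left ?_ (by positivity)
      exact loss_count hr hs hS hV hB hy.le hσ hAU (fun v hv => (hdeg v hv).1) hf
        (subset_of_mem_live hC) (hm C hC)
        (fun x hx => ⟨hS.pairwise C hC1 x (hmem x hx).1 f hC2 (hmem x hx).2,
          hS.twinfree C hC1 x (hmem x hx).1 f hC2⟩)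
        fun x hx x' hx' hne => ⟨hS.pairwise C hC1 x (hmem x hx).1 x' (hmem x' hx').1 hne,
          hS.twinfree C hC1 x (hmem x hx).1 x' (hmem x' hx').1⟩
    have hη0 : 0 ≤ η := le_trans (mul_nonneg zero_le_two (mul_nonneg hN.c_nonneg hgn)) hN.c_le
    simp only [mul_zero, sum_const_zero, add_zero]
    calc _ ≤ (1 + η) * ∑ C ∈ live 𝒟 M A f, y ^ (C.erase f \ M).card * ((C.erase f \ M).card * G) := by
          gcongr
      _ = ∑ C ∈ live 𝒟 M A f, y ^ (C.erase f \ M).card * ((C.erase f \ M).card * ((1 + η) * G)) := by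
          rw [mul_sum]
          exact sum_congr rfl fun _ _ => by ring
      _ ≤ ∑ C ∈ live 𝒟 M A f, y ^ (C.erase f \ M).card * ((C.erase f \ M).card * ((1 - η) * Λ)) := by
          have := hN.drift
          gcongr
      _ = (1 - η) * ∑ C ∈ live 𝒟 M A f, y ^ (C.erase f \ M).card * ((C.erase f \ M).card * Λ) := by
          rw [mul_sum]
          exact sum_congr rfl fun _ _ => by ring
      _ ≤ _ := by
          have : 0 ≤ 1 - η := by linarith [hN.η_le_one]
          gcongr

end LossCount

/-- The quantities steering the construction: expected degrees `D`, their errors `err`, the weights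
`y` and `p` (all depending on the number of chosen edges) and the parameters of the potential. -/
structure Params where
  (D err y p : ℕ → ℝ)
  (cX cG σ : ℝ)
  (k g₀ : ℕ)

/-- All numerical relations needed for choosing one more edge after `t` edges. -/
structure Scale (r s ℓ L : ℕ) (P : Params) (n ι ηX gX ηG gG : ℝ) (t : ℕ) : Prop where
  pos : r * t < n
  degree : DegreeScale r s L (P.D t) (P.D (t + 1)) (P.err t) (P.err (t + 1)) (r / (n - r * t))
    P.σ P.cX ηX gX
  danger : DangerScale r s ℓ P.g₀ (P.D t) (P.err t) (r / (n - r * t)) (P.y t) (P.y (t + 1))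
    P.σ ι P.cG ηG gG
  cX_pos : 0 < P.cX
  cG_pos : 0 < P.cG
  p_pos : 0 < P.p (t + 1)
  p_le_one : P.p t ≤ 1
  y_le_p : P.y t ≤ P.p t
  p_step : P.p (t + 1) * (P.D t - P.err t) + r / (n - r * t) ≤ P.p t * (P.D t - P.err t)

section Potential

variable {V : Type*} [DecidableEq V]

/-- The pairs of disjoint edges that are not in `𝒯`. -/
def nontwins (H : Finset (Finset V)) (𝒯 : Finset (Finset (Finset V))) :
    Finset (Finset V × Finset V) :=
  (H ×ˢ H).filter fun q => Disjoint q.1 q.2 ∧ ({q.1, q.2} : Finset (Finset V)) ∉ 𝒯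

/-- The total `k`-th moment of the weighted configuration counts. -/
noncomputable def totalMoment [Fintype V] (H : Finset (Finset V))
    (𝒟 𝒯 : Finset (Finset (Finset V))) (p : ℝ) (k : ℕ) (M : Finset (Finset V)) : ℝ :=
  ∑ q ∈ H ×ˢ univ, moment (famT (𝒟 ∪ 𝒯) H q.1 q.2) (wT q.1) p M k ∅ +
  ∑ q ∈ H ×ˢ H, moment (famR (𝒟 ∪ 𝒯) H q.1 q.2) (wR q.1 q.2) p M k ∅ +
  ∑ q ∈ nontwins H 𝒯, moment (famP (𝒟 ∪ 𝒯) H q.1 q.2) (wP q.1 q.2) p M k ∅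

/-- The exponential penalty for the deviation of the degrees. -/
noncomputable def degPot (A : Finset (Finset V)) (D err c : ℝ) (v : V) : ℝ :=
  Real.exp (c * (deg A v - (D + err))) + Real.exp (c * (D - err - deg A v))

/-- The exponential penalty for large danger. -/
noncomputable def dangerPot (𝒟 : Finset (Finset (Finset V))) (M A : Finset (Finset V))
    (y c : ℝ) (g₀ : ℕ) (f : Finset V) : ℝ :=
  Real.exp (c * (danger 𝒟 M A y f - 2 * g₀))

/-- The vertices not covered by `M`. -/
def uncovered [Fintype V] (M : Finset (Finset V)) : Finset V := univ.filter fun v => ∀ e ∈ M, v ∉ e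

/-- The potential that is kept from increasing. -/
noncomputable def potential [Fintype V] (H : Finset (Finset V)) (𝒟 𝒯 : Finset (Finset (Finset V)))
    (P : Params) (M A : Finset (Finset V)) : ℝ :=
  ∑ v ∈ uncovered M, degPot A (P.D M.card) (P.err M.card) P.cX v +
  ∑ f ∈ A, dangerPot 𝒟 M A (P.y M.card) P.cG P.g₀ f +
  totalMoment H 𝒟 𝒯 (P.p M.card) P.k M / P.σ ^ P.k

theorem degPot_nonneg (A : Finset (Finset V)) (D err c : ℝ) (v : V) : 0 ≤ degPot A D err c v :=
  add_nonneg (Real.exp_pos _).le (Real.exp_pos _).le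

theorem totalMoment_nonneg [Fintype V] (H : Finset (Finset V))
    (𝒟 𝒯 : Finset (Finset (Finset V))) {p : ℝ} (hp : 0 ≤ p) (k : ℕ) (M : Finset (Finset V)) :
    0 ≤ totalMoment H 𝒟 𝒯 p k M :=
  add_nonneg (add_nonneg (sum_nonneg fun _ _ => moment_nonneg _ _ hp _ _ _)
    (sum_nonneg fun _ _ => moment_nonneg _ _ hp _ _ _))
    (sum_nonneg fun _ _ => moment_nonneg _ _ hp _ _ _)

theorem sum_totalMoment_insert_le [Fintype V] (H : Finset (Finset V))
    (𝒟 𝒯 : Finset (Finset (Finset V))) {p p' : ℝ} (k : ℕ) (M A : Finset (Finset V))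
    (hp' : 0 < p') (hA : 0 < A.card) (h : p' + 1 / A.card ≤ p) :
    ∑ e ∈ A, totalMoment H 𝒟 𝒯 p' k (insert e M) ≤ A.card * totalMoment H 𝒟 𝒯 p k M := by
  simp only [totalMoment]
  rw [sum_add_distrib, sum_add_distrib, mul_add, mul_add, sum_comm, mul_sum,
    sum_comm (s := A) (t := H ×ˢ H), mul_sum, sum_comm (s := A) (t := nontwins H 𝒯), mul_sum]
  exact add_le_add (add_le_add (sum_le_sum fun q _ => sum_moment_insert_le _ _ A M hp' hA h k ∅)
    (sum_le_sum fun q _ => sum_moment_insert_le _ _ A M hp' hA h k ∅))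
    (sum_le_sum fun q _ => sum_moment_insert_le _ _ A M hp' hA h k ∅)

theorem sum_le_of_moment_le {α ι : Type*} [DecidableEq α] (F : Finset ι) (W : ι → Finset α)
    {p σ : ℝ} (hp : 0 ≤ p) (hp1 : p ≤ 1) (M : Finset α) {k : ℕ} (hk : k ≠ 0) (hσ : 0 ≤ σ)
    (h : moment F W p M k ∅ ≤ σ ^ k) : ∑ i ∈ F, p ^ (W i \ M).card ≤ σ := by
  have h1 := (mul_pow_le_moment F W hp hp1 M k ∅).trans h
  rw [empty_sdiff, card_empty, pow_zero, one_mul] at h1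
  exact (pow_le_pow_iff_left₀ (sum_nonneg fun _ _ => by positivity) hσ hk).1 h1

theorem Bounded.of_totalMoment [Fintype V] {H : Finset (Finset V)}
    {𝒟 𝒯 : Finset (Finset (Finset V))} {p σ : ℝ} (hp : 0 ≤ p) (hp1 : p ≤ 1) {k : ℕ} (hk : k ≠ 0)
    (hσ : 0 ≤ σ) {M : Finset (Finset V)} (h : totalMoment H 𝒟 𝒯 p k M ≤ σ ^ k) :
    Bounded H 𝒟 𝒯 M p σ := by
  have n1 : 0 ≤ ∑ q ∈ H ×ˢ univ, moment (famT (𝒟 ∪ 𝒯) H q.1 q.2) (wT q.1) p M k ∅ :=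
    sum_nonneg fun _ _ => moment_nonneg _ _ hp _ _ _
  have n2 : 0 ≤ ∑ q ∈ H ×ˢ H, moment (famR (𝒟 ∪ 𝒯) H q.1 q.2) (wR q.1 q.2) p M k ∅ :=
    sum_nonneg fun _ _ => moment_nonneg _ _ hp _ _ _
  have n3 : 0 ≤ ∑ q ∈ nontwins H 𝒯, moment (famP (𝒟 ∪ 𝒯) H q.1 q.2) (wP q.1 q.2) p M k ∅ :=
    sum_nonneg fun _ _ => moment_nonneg _ _ hp _ _ _
  rw [totalMoment] at h
  constructor
  · intro e he v
    refine sum_le_of_moment_le _ _ hp hp1 M hk hσ (le_trans ?_ h)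
    have := single_le_sum (f := fun q : Finset V × V => moment (famT (𝒟 ∪ 𝒯) H q.1 q.2) (wT q.1)
      p M k ∅) (fun _ _ => moment_nonneg _ _ hp _ _ _) (show (e, v) ∈ H ×ˢ univ from
      mem_product.2 ⟨he, mem_univ v⟩)
    dsimp only at this
    linarith
  · intro f hf g hg
    refine sum_le_of_moment_le _ _ hp hp1 M hk hσ (le_trans ?_ h)
    have := single_le_sum (f := fun q : Finset V × Finset V =>
      moment (famR (𝒟 ∪ 𝒯) H q.1 q.2) (wR q.1 q.2)
      p M k ∅) (fun _ _ => moment_nonneg _ _ hp _ _ _) (show (f, g) ∈ H ×ˢ H from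
      mem_product.2 ⟨hf, hg⟩)
    dsimp only at this
    linarith
  · intro c hc c' hc' hd ht
    refine sum_le_of_moment_le _ _ hp hp1 M hk hσ (le_trans ?_ h)
    have := single_le_sum (f := fun q : Finset V × Finset V =>
      moment (famP (𝒟 ∪ 𝒯) H q.1 q.2) (wP q.1 q.2)
      p M k ∅) (fun _ _ => moment_nonneg _ _ hp _ _ _)
      (show (c, c') ∈ nontwins H 𝒯 from mem_filter.2 ⟨mem_product.2 ⟨hc, hc'⟩, hd, ht⟩)
    dsimp only at this
    linarith

theorem Valid.add {r : ℕ} {H M A : Finset (Finset V)}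
    {𝒞 : Finset (Finset (Finset V))} (hV : Valid r H 𝒞 M A) {e : Finset V}
    (he : e ∈ A) : Valid r H 𝒞 (insert e M) (remaining 𝒞 M A e) where
  subM := insert_subset (hV.subA he) hV.subM
  subA := (filter_subset _ _).trans hV.subA
  matching := by
    intro a ha b hb hne
    rcases mem_insert.1 ha with rfl | ha' <;> rcases mem_insert.1 hb with rfl | hb'
    · exact absurd rfl hne
    · exact (hV.disj b hb' _ he).symm
    · exact hV.disj a ha' _ he
    · exact hV.matching a ha' b hb' hne
  disj := by
    intro a ha b hb
    obtain ⟨h1, h2⟩ := mem_filter.1 hb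
    rcases mem_insert.1 ha with rfl | ha
    · by_contra h; exact h2 (Or.inl h)
    · exact hV.disj a ha b h1
  free := hV.avail e he
  avail := by
    intro a ha C hC hsub
    exact (mem_filter.1 ha).2 (Or.inr ⟨C, hC, hsub⟩)

theorem Valid.erase {r : ℕ} {H M A : Finset (Finset V)}
    {𝒞 : Finset (Finset (Finset V))} (hV : Valid r H 𝒞 M A) (x : Finset V) :
    Valid r H 𝒞 M (A.erase x) where
  subM := hV.subM
  subA := (erase_subset _ _).trans hV.subA
  matching := hV.matching
  disj := fun e he a ha => hV.disj e he a (mem_of_mem_erase ha)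
  free := hV.free
  avail := fun a ha => hV.avail a (mem_of_mem_erase ha)

end Potential

section Step

variable {V : Type*} [DecidableEq V] [Fintype V] {r ℓ s L : ℕ} {H : Finset (Finset V)}
  {𝒟 𝒯 : Finset (Finset (Finset V))} {M A : Finset (Finset V)} {P : Params}
  {ι ηX gX ηG gG : ℝ}

theorem Valid.subset_uncovered {𝒞 : Finset (Finset (Finset V))} (hV : Valid r H 𝒞 M A)
    {e : Finset V} (he : e ∈ A) : e ⊆ uncovered M := fun _ hv =>
  mem_filter.2 ⟨mem_univ _, fun m hm hvm =>
    Finset.disjoint_left.1 (hV.disj m hm e he) hvm hv⟩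

theorem Valid.card_uncovered {𝒞 : Finset (Finset (Finset V))} (hV : Valid r H 𝒞 M A)
    (hH : ∀ e ∈ H, e.card = r) : (uncovered M).card + r * M.card = Fintype.card V := by
  have h1 : (M.biUnion id).card = r * M.card := by
    rw [card_biUnion (t := id) fun e he f hf hne => hV.matching e he f hf hne,
      sum_congr rfl (g := fun _ => r) (show ∀ e ∈ M, (id e).card = r from
        fun e he => hH e (hV.subM he)), sum_const, smul_eq_mul, mul_comm]
  have h2 : uncovered M = (M.biUnion id)ᶜ := by
    ext v
    simp [uncovered]
  rw [h2, ← h1, add_comm, card_add_card_compl]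

theorem sum_degPot_drift (hr : 0 < r) (hs0 : 0 < s) (hs : s = r + P.g₀)
    (hS : Sparse r ℓ H 𝒟 𝒯 P.σ) (hV : Valid r H (𝒟 ∪ 𝒯) M A)
    (hB : Bounded H 𝒟 𝒯 M (P.y M.card) P.σ)
    (hN : Scale r s ℓ L P (Fintype.card V) ι ηX gX ηG gG M.card)
    (hdeg : ∀ v ∈ uncovered M, P.D M.card - P.err M.card ≤ deg A v ∧
      (deg A v : ℝ) ≤ P.D M.card + P.err M.card)
    (ha : (r : ℝ) / (Fintype.card V - r * M.card) * (uncovered M).card = r)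
    (hw : ∀ f ∈ A, ((blockers (𝒟 ∪ 𝒯) M A f).card : ℝ) ≤ (P.g₀ + 1 : ℕ) * P.D M.card) :
    ∑ e ∈ A, (∑ v ∈ uncovered (insert e M), degPot (remaining (𝒟 ∪ 𝒯) M A e) (P.D (M.card + 1))
        (P.err (M.card + 1)) P.cX v -
        ∑ v ∈ uncovered M, degPot A (P.D M.card) (P.err M.card) P.cX v) +
      ∑ x ∈ A, ((P.g₀ + 1 : ℕ) * P.D M.card - (blockers (𝒟 ∪ 𝒯) M A x).card) *
        (∑ v ∈ uncovered M, degPot (A.erase x) (P.D M.card) (P.err M.card) P.cX v -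
        ∑ v ∈ uncovered M, degPot A (P.D M.card) (P.err M.card) P.cX v) ≤ 0 := by
  have h1 : ∀ e ∈ A, ∑ v ∈ uncovered (insert e M), degPot (remaining (𝒟 ∪ 𝒯) M A e)
      (P.D (M.card + 1)) (P.err (M.card + 1)) P.cX v -
        ∑ v ∈ uncovered M, degPot A (P.D M.card) (P.err M.card) P.cX v ≤
      ∑ v ∈ uncovered M, if v ∉ e then degPot (remaining (𝒟 ∪ 𝒯) M A e)
        (P.D (M.card + 1)) (P.err (M.card + 1)) P.cX v -
        degPot A (P.D M.card) (P.err M.card) P.cX v else 0 := by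
    intro e he
    have h2 : uncovered (insert e M) = (uncovered M).filter fun v => v ∉ e := by
      ext v
      simp only [uncovered, mem_filter, mem_univ, true_and, mem_insert, forall_eq_or_imp]
      tauto
    rw [h2, ← sum_filter, sum_sub_distrib]
    have := sum_le_sum_of_subset_of_nonneg (filter_subset (fun v => v ∉ e) (uncovered M))
      (f := fun v => degPot A (P.D M.card) (P.err M.card) P.cX v)
      fun v _ _ => degPot_nonneg _ _ _ _ v
    linarith
  refine (add_le_add_left (sum_le_sum h1) _).trans ?_
  simp only [← sum_sub_distrib, mul_sum]
  rw [sum_comm, sum_comm (s := A) (t := uncovered M), ← sum_add_distrib]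
  refine sum_nonpos fun v hv => ?_
  have hy := hN.danger.y_pos.le
  have hAU : ∀ e ∈ A, e ⊆ uncovered M := fun e he => hV.subset_uncovered he
  have hs' : s + 1 = r + (P.g₀ + 1) := by omega
  have up := degree_drift_upper hr hs0 hs' hS hV hB hy hAU hdeg ha hN.degree hw hv
  have low := degree_drift_lower hr hs0 hs' hS hV hB hy hAU hdeg ha hN.degree hw hv
  have e1 := add_nonpos up low
  refine le_of_eq_of_le ?_ e1
  rw [← sum_filter]
  simp only [degPot]
  rw [add_add_add_comm, ← sum_add_distrib, ← sum_add_distrib]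
  congr 1
  · exact sum_congr rfl fun _ _ => by ring
  · exact sum_congr rfl fun _ _ => by ring

theorem sum_dangerPot_drift (hr : 0 < r) (hs : s = r + P.g₀)
    (hS : Sparse r ℓ H 𝒟 𝒯 P.σ) (hV : Valid r H (𝒟 ∪ 𝒯) M A)
    (hB : Bounded H 𝒟 𝒯 M (P.y M.card) P.σ)
    (hN : Scale r s ℓ L P (Fintype.card V) ι ηX gX ηG gG M.card)
    (hdeg : ∀ v ∈ uncovered M, P.D M.card - P.err M.card ≤ deg A v ∧
      (deg A v : ℝ) ≤ P.D M.card + P.err M.card)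
    (ha : (r : ℝ) / (Fintype.card V - r * M.card) * (uncovered M).card = r)
    (hw : ∀ f ∈ A, ((blockers (𝒟 ∪ 𝒯) M A f).card : ℝ) ≤ (P.g₀ + 1 : ℕ) * P.D M.card)
    (hg : ∀ f ∈ A, danger 𝒟 M A (P.y M.card) f ≤ 2 * P.g₀) :
    ∑ e ∈ A, (∑ f ∈ remaining (𝒟 ∪ 𝒯) M A e, dangerPot 𝒟 (insert e M)
        (remaining (𝒟 ∪ 𝒯) M A e) (P.y (M.card + 1)) P.cG P.g₀ f -
        ∑ f ∈ A, dangerPot 𝒟 M A (P.y M.card) P.cG P.g₀ f) +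
      ∑ x ∈ A, ((P.g₀ + 1 : ℕ) * P.D M.card - (blockers (𝒟 ∪ 𝒯) M A x).card) *
        (∑ f ∈ A.erase x, dangerPot 𝒟 M (A.erase x) (P.y M.card) P.cG P.g₀ f -
        ∑ f ∈ A, dangerPot 𝒟 M A (P.y M.card) P.cG P.g₀ f) ≤ 0 := by
  have hpos : ∀ f, 0 ≤ dangerPot 𝒟 M A (P.y M.card) P.cG P.g₀ f := fun f => (Real.exp_pos _).le
  have h1 : ∀ e ∈ A, ∑ f ∈ remaining (𝒟 ∪ 𝒯) M A e, dangerPot 𝒟 (insert e M)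
        (remaining (𝒟 ∪ 𝒯) M A e) (P.y (M.card + 1)) P.cG P.g₀ f -
        ∑ f ∈ A, dangerPot 𝒟 M A (P.y M.card) P.cG P.g₀ f ≤
      ∑ f ∈ A, if ¬ Excl (𝒟 ∪ 𝒯) M e f then dangerPot 𝒟 (insert e M)
        (remaining (𝒟 ∪ 𝒯) M A e) (P.y (M.card + 1)) P.cG P.g₀ f -
          dangerPot 𝒟 M A (P.y M.card) P.cG P.g₀ f else 0 := by
    intro e he
    rw [← sum_filter, sum_sub_distrib]
    have := sum_le_sum_of_subset_of_nonneg (filter_subset (fun f => ¬ Excl (𝒟 ∪ 𝒯) M e f) A)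
      (f := fun f => dangerPot 𝒟 M A (P.y M.card) P.cG P.g₀ f) fun f _ _ => hpos f
    rw [remaining]
    linarith
  have h2 : ∀ x ∈ A, ((P.g₀ + 1 : ℕ) * P.D M.card - (blockers (𝒟 ∪ 𝒯) M A x).card) *
        (∑ f ∈ A.erase x, dangerPot 𝒟 M (A.erase x) (P.y M.card) P.cG P.g₀ f -
        ∑ f ∈ A, dangerPot 𝒟 M A (P.y M.card) P.cG P.g₀ f) ≤
      ∑ f ∈ A, if f ≠ x then ((P.g₀ + 1 : ℕ) * P.D M.card - (blockers (𝒟 ∪ 𝒯) M A x).card) *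
        (dangerPot 𝒟 M (A.erase x) (P.y M.card) P.cG P.g₀ f -
          dangerPot 𝒟 M A (P.y M.card) P.cG P.g₀ f) else 0 := by
    intro x hx
    rw [← sum_filter, ← mul_sum]
    refine mul_le_mul_of_nonneg_left ?_ (sub_nonneg.2 (hw x hx))
    rw [filter_ne', sum_sub_distrib]
    have := sum_le_sum_of_subset_of_nonneg (erase_subset x A)
      (f := fun f => dangerPot 𝒟 M A (P.y M.card) P.cG P.g₀ f) fun f _ _ => hpos f
    linarith
  refine (add_le_add (sum_le_sum h1) (sum_le_sum h2)).trans ?_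
  refine (le_of_eq (congrArg₂ (· + ·) sum_comm sum_comm)).trans ?_
  rw [← sum_add_distrib]
  refine sum_nonpos fun f hf => ?_
  have hAU : ∀ e ∈ A, e ⊆ uncovered M := fun e he => hV.subset_uncovered he
  have hs' : s + 1 = r + (P.g₀ + 1) := by omega
  have key := danger_drift hr hs' hS hV hB hAU hdeg ha hN.danger hw hf (hg f hf)
  rw [← sum_filter, ← sum_filter, filter_ne]
  exact key

theorem exists_step (hr : 0 < r) (hs : s = r + P.g₀) (hk : P.k ≠ 0)
    (hS : Sparse r ℓ H 𝒟 𝒯 P.σ) (hV : Valid r H (𝒟 ∪ 𝒯) M A)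
    (hN : Scale r s ℓ L P (Fintype.card V) ι ηX gX ηG gG M.card)
    (hΦ : potential H 𝒟 𝒯 P M A ≤ 1) :
    ∃ M' A', Valid r H (𝒟 ∪ 𝒯) M' A' ∧ potential H 𝒟 𝒯 P M' A' ≤ 1 ∧ A'.card < A.card := by
  have hM := fun e he => hV.notMem hS.card_edge hr (e := e) he
  have hσ : 0 ≤ P.σ := zero_le_one.trans hN.degree.σ_one
  have hσk : 0 < P.σ ^ P.k := pow_pos (zero_lt_one.trans_le hN.degree.σ_one) _
  have hy := hN.danger.y_pos
  have hp : 0 ≤ P.p M.card := hy.le.trans hN.y_le_p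
  have hU := hV.card_uncovered hS.card_edge
  have hU' : ((uncovered M).card : ℝ) = Fintype.card V - r * M.card := by
    rw [← hU]; push_cast; ring
  have hUpos : (0 : ℝ) < Fintype.card V - r * M.card := sub_pos.2 hN.pos
  have ha : (r : ℝ) / (Fintype.card V - r * M.card) * (uncovered M).card = r := by
    rw [hU']; field_simp
  have n1 : ∀ v ∈ uncovered M, 0 ≤ degPot A (P.D M.card) (P.err M.card) P.cX v :=
    fun v _ => degPot_nonneg _ _ _ _ v
  have n2 : ∀ f ∈ A, 0 ≤ dangerPot 𝒟 M A (P.y M.card) P.cG P.g₀ f := fun f _ => (Real.exp_pos _).le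
  have n3 := totalMoment_nonneg H 𝒟 𝒯 hp P.k M
  have n3' : 0 ≤ totalMoment H 𝒟 𝒯 (P.p M.card) P.k M / P.σ ^ P.k := by positivity
  have hΦ' := hΦ
  rw [potential] at hΦ'
  have exp_bound : ∀ {c z : ℝ}, 0 < c → Real.exp (c * z) ≤ 1 → z ≤ 0 := by
    intro c z hc h
    by_contra! hz
    linarith [Real.exp_le_one_iff.1 h, mul_pos hc hz]
  have hdeg : ∀ v ∈ uncovered M, P.D M.card - P.err M.card ≤ deg A v ∧
      (deg A v : ℝ) ≤ P.D M.card + P.err M.card := by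
    intro v hv
    have h1 := single_le_sum n1 hv
    have h2 := sum_nonneg n2
    have h3 : degPot A (P.D M.card) (P.err M.card) P.cX v ≤ 1 := by linarith
    rw [degPot] at h3
    have h4 := exp_bound hN.cX_pos (le_trans (le_add_of_nonneg_right (Real.exp_pos _).le) h3)
    have h5 := exp_bound hN.cX_pos (le_trans (le_add_of_nonneg_left (Real.exp_pos _).le) h3)
    constructor <;> linarith
  have hg : ∀ f ∈ A, danger 𝒟 M A (P.y M.card) f ≤ 2 * P.g₀ := by
    intro f hf
    have h1 := single_le_sum n2 hf
    have h2 := sum_nonneg n1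
    have h3 : dangerPot 𝒟 M A (P.y M.card) P.cG P.g₀ f ≤ 1 := by linarith
    linarith [exp_bound hN.cG_pos h3]
  have hBp : Bounded H 𝒟 𝒯 M (P.p M.card) P.σ := by
    refine Bounded.of_totalMoment hp hN.p_le_one hk hσ ?_
    have h1 := sum_nonneg n1
    have h2 := sum_nonneg n2
    exact (div_le_one hσk).1 (by linarith)
  have hB := hBp.mono hy.le hN.y_le_p
  have herr : P.σ ≤ P.D M.card ∧ 0 < P.D M.card - P.err M.card := by
    have h1 := hN.degree.σ_le_err
    have h2 := hN.degree.err_le_D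
    have h3 : (1 : ℝ) ≤ r := by exact_mod_cast hr
    have h4 := hN.degree.err_nonneg
    have h5 := hN.degree.D_pos
    have h6 : 0 ≤ (L : ℝ) * P.err M.card := by positivity
    have h7 : P.σ ≤ (r : ℝ) ^ 2 * P.σ := le_mul_of_one_le_left hσ (one_le_pow₀ h3)
    have h8 : P.err M.card ≤ r * P.err M.card := le_mul_of_one_le_left h4 h3
    rw [add_mul] at h2
    constructor <;> linarith
  have hw : ∀ f ∈ A, ((blockers (𝒟 ∪ 𝒯) M A f).card : ℝ) ≤ (P.g₀ + 1 : ℕ) * P.D M.card := by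
    intro f hf
    have h1 := card_blockers_le hS hV hr hy hf (hg f hf)
    have h2 : (2 * P.g₀ : ℝ) / P.y M.card = P.g₀ * P.D M.card := by
      rw [div_eq_iff hy.ne', mul_assoc, mul_comm (P.D _), hN.danger.y_mul, mul_comm]
    rw [h2] at h1
    push_cast
    linarith [herr.1]
  have hcA : 0 < A.card ∧ P.p (M.card + 1) + 1 / A.card ≤ P.p M.card := by
    have h1 := (card_available_bounds hr (fun e he => hS.card_edge e (hV.subA he))
      (fun e he => hV.subset_uncovered he) hdeg ha).1
    have hA : A.card ≠ 0 := by
      intro h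
      rw [h] at h1
      simp only [Nat.cast_zero, mul_zero] at h1
      linarith [herr.2]
    have hA' : (0 : ℝ) < A.card := by exact_mod_cast Nat.pos_of_ne_zero hA
    refine ⟨Nat.pos_of_ne_zero hA, ?_⟩
    have h2 := hN.p_step
    have h3 : 1 / (A.card : ℝ) ≤
        r / (Fintype.card V - r * M.card) / (P.D M.card - P.err M.card) := by
      rw [div_le_div_iff₀ hA' herr.2, one_mul]
      exact h1
    have h4 : r / (Fintype.card V - r * M.card) / (P.D M.card - P.err M.card) ≤
        P.p M.card - P.p (M.card + 1) := by
      rw [div_le_iff₀ herr.2]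
      linarith
    linarith
  by_contra! hcon
  have hadd : ∀ e ∈ A, potential H 𝒟 𝒯 P M A <
      potential H 𝒟 𝒯 P (insert e M) (remaining (𝒟 ∪ 𝒯) M A e) := by
    intro e he
    by_contra! h
    refine absurd (hcon _ _ (hV.add he) (h.trans hΦ)) (not_le.2 (card_lt_card ?_))
    refine (ssubset_iff_of_subset (filter_subset _ _)).2 ⟨e, he, fun h' => ?_⟩
    refine (mem_filter.1 h').2 (Or.inl fun hd => ?_)
    have h1 := hS.card_edge e (hV.subA he)
    rw [disjoint_self_iff_empty] at hd
    rw [hd, card_empty] at h1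
    omega
  have herase : ∀ x ∈ A, potential H 𝒟 𝒯 P M A ≤ potential H 𝒟 𝒯 P M (A.erase x) := by
    intro x hx
    by_contra! h
    exact absurd (hcon _ _ (hV.erase x) (h.le.trans hΦ)) (not_le.2 (card_erase_lt_of_mem hx))
  have hs0 : 0 < s := by omega
  have d1 := sum_degPot_drift hr hs0 hs hS hV hB hN hdeg ha hw
  have d2 := sum_dangerPot_drift hr hs hS hV hB hN hdeg ha hw hg
  have d3 := div_le_div_of_nonneg_right
    (sum_totalMoment_insert_le H 𝒟 𝒯 P.k M A hN.p_pos hcA.1 hcA.2) hσk.le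
  rw [sum_div, mul_div_assoc] at d3
  have pos : 0 < ∑ e ∈ A, (potential H 𝒟 𝒯 P (insert e M) (remaining (𝒟 ∪ 𝒯) M A e) -
      potential H 𝒟 𝒯 P M A) :=
    sum_pos (fun e he => sub_pos.2 (hadd e he)) (card_pos.1 hcA.1)
  have nonneg : 0 ≤ ∑ x ∈ A, ((P.g₀ + 1 : ℕ) * P.D M.card - (blockers (𝒟 ∪ 𝒯) M A x).card) *
      (potential H 𝒟 𝒯 P M (A.erase x) - potential H 𝒟 𝒯 P M A) :=
    sum_nonneg fun x hx => mul_nonneg (sub_nonneg.2 (hw x hx)) (sub_nonneg.2 (herase x hx))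
  have e1 : ∑ e ∈ A, (potential H 𝒟 𝒯 P (insert e M) (remaining (𝒟 ∪ 𝒯) M A e) -
      potential H 𝒟 𝒯 P M A) =
      ∑ e ∈ A, (∑ v ∈ uncovered (insert e M), degPot (remaining (𝒟 ∪ 𝒯) M A e) (P.D (M.card + 1))
        (P.err (M.card + 1)) P.cX v -
        ∑ v ∈ uncovered M, degPot A (P.D M.card) (P.err M.card) P.cX v) +
      ∑ e ∈ A, (∑ f ∈ remaining (𝒟 ∪ 𝒯) M A e, dangerPot 𝒟 (insert e M)
        (remaining (𝒟 ∪ 𝒯) M A e) (P.y (M.card + 1)) P.cG P.g₀ f -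
        ∑ f ∈ A, dangerPot 𝒟 M A (P.y M.card) P.cG P.g₀ f) +
      (∑ e ∈ A, totalMoment H 𝒟 𝒯 (P.p (M.card + 1)) P.k (insert e M) / P.σ ^ P.k -
        A.card * (totalMoment H 𝒟 𝒯 (P.p M.card) P.k M / P.σ ^ P.k)) := by
    rw [← nsmul_eq_mul, ← sum_const, ← sum_sub_distrib, ← sum_add_distrib, ← sum_add_distrib]
    refine sum_congr rfl fun e he => ?_
    rw [potential, potential, card_insert_of_notMem (hM e he)]
    ring
  have e2 : ∑ x ∈ A, ((P.g₀ + 1 : ℕ) * P.D M.card - (blockers (𝒟 ∪ 𝒯) M A x).card) *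
      (potential H 𝒟 𝒯 P M (A.erase x) - potential H 𝒟 𝒯 P M A) =
      ∑ x ∈ A, ((P.g₀ + 1 : ℕ) * P.D M.card - (blockers (𝒟 ∪ 𝒯) M A x).card) *
        (∑ v ∈ uncovered M, degPot (A.erase x) (P.D M.card) (P.err M.card) P.cX v -
        ∑ v ∈ uncovered M, degPot A (P.D M.card) (P.err M.card) P.cX v) +
      ∑ x ∈ A, ((P.g₀ + 1 : ℕ) * P.D M.card - (blockers (𝒟 ∪ 𝒯) M A x).card) *
        (∑ f ∈ A.erase x, dangerPot 𝒟 M (A.erase x) (P.y M.card) P.cG P.g₀ f -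
        ∑ f ∈ A, dangerPot 𝒟 M A (P.y M.card) P.cG P.g₀ f) := by
    rw [← sum_add_distrib]
    refine sum_congr rfl fun x _ => ?_
    rw [potential, potential]
    ring
  linarith

/-- A small potential at the start guarantees a conflict-free matching leaving few vertices
uncovered. -/
theorem exists_matching_of_potential (hr : 0 < r) (hs : s = r + P.g₀) (hk : P.k ≠ 0)
    (hS : Sparse r ℓ H 𝒟 𝒯 P.σ) {θ : ℝ}
    (hN : ∀ t : ℕ, θ < Fintype.card V - r * t →
      Scale r s ℓ L P (Fintype.card V) ι ηX gX ηG gG t)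
    (hV : Valid r H (𝒟 ∪ 𝒯) M A) (hΦ : potential H 𝒟 𝒯 P M A ≤ 1) :
    ∃ M' A', Valid r H (𝒟 ∪ 𝒯) M' A' ∧ ((uncovered M').card : ℝ) ≤ θ := by
  induction hm : A.card using Nat.strong_induction_on generalizing M A with
  | _ m ih =>
    by_cases h : ((uncovered M).card : ℝ) ≤ θ
    · exact ⟨M, A, hV, h⟩
    · have hU : ((uncovered M).card : ℝ) = Fintype.card V - r * M.card := by
        rw [← hV.card_uncovered hS.card_edge]; push_cast; ring
      obtain ⟨M', A', hV', hΦ', hlt⟩ :=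
        exists_step hr hs hk hS hV (hN M.card (by rw [← hU]; exact not_le.1 h)) hΦ
      exact ih _ (hm ▸ hlt) hV' hΦ' rfl

end Step

section Static

theorem sum_filter_le_sum_filter {ι : Type*} {s : Finset ι} {p q : ι → Prop} [DecidablePred p]
    [DecidablePred q] {f g : ι → ℝ} (h : ∀ i ∈ s, p i → q i ∧ f i ≤ g i)
    (hg : ∀ i ∈ s, q i → 0 ≤ g i) : ∑ i ∈ s with p i, f i ≤ ∑ i ∈ s with q i, g i := by
  refine (sum_le_sum (g := g) fun i hi => ?_).trans
    (sum_le_sum_of_subset_of_nonneg (fun i hi => ?_) fun i hi _ => ?_)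
  · exact (h i (mem_filter.1 hi).1 (mem_filter.1 hi).2).2
  · exact mem_filter.2 ⟨(mem_filter.1 hi).1, (h i (mem_filter.1 hi).1 (mem_filter.1 hi).2).1⟩
  · exact hg i (mem_filter.1 hi).1 (mem_filter.1 hi).2

/-- `C₁` and `C₂` are conflicts through `c` and `c'`, respectively, meeting outside `I`. -/
def Linked {α : Type*} (c c' : α) (I C₁ C₂ : Finset α) : Prop :=
  c ∈ C₁ ∧ c ∉ C₂ ∧ c' ∈ C₂ ∧ c' ∉ C₁ ∧ ∃ h ∈ C₁, h ∈ C₂ ∧ h ∉ I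

theorem Linked.symm {α : Type*} {c c' : α} {I C₁ C₂ : Finset α} (h : Linked c c' I C₁ C₂) :
    Linked c' c I C₂ C₁ := by
  obtain ⟨h1, h2, h3, h4, x, h5, h6, h7⟩ := h
  exact ⟨h3, h4, h1, h2, x, h6, h5, h7⟩

variable {α : Type*} [DecidableEq α] {𝒞 : Finset (Finset α)} {π Λ ν ν' : ℝ} {ℓ : ℕ}

theorem sum_pow_sdiff_le_of_two_le_inter (hν : ∀ S : Finset α, 2 ≤ S.card →
    ∑ C ∈ 𝒞 with S ⊂ C, π ^ (C \ S).card ≤ ν) (hπ : 0 ≤ π) (hν0 : 0 ≤ ν) (B : Finset α) :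
    ∑ C ∈ 𝒞 with 2 ≤ (C ∩ B).card ∧ ¬ C ⊆ B, π ^ (C \ B).card ≤ 2 ^ B.card * ν := by
  rw [← sum_fiberwise_of_maps_to (t := B.powerset) (g := fun C => C ∩ B)
    fun C _ => mem_powerset.2 inter_subset_right]
  have h2 : ((2 : ℝ) ^ B.card) = (B.powerset.card : ℝ) := by rw [card_powerset]; norm_num
  rw [h2, ← nsmul_eq_mul]
  refine sum_le_card_nsmul _ _ _ fun S _ => ?_
  by_cases hS : 2 ≤ S.card
  · refine le_trans ?_ (hν S hS)
    rw [filter_filter]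
    refine sum_filter_le_sum_filter ?_ fun _ _ _ => by positivity
    rintro C _ ⟨⟨_, h2⟩, rfl⟩
    refine ⟨⟨inter_subset_left, fun h => h2 fun x hx => (mem_inter.1 (h hx)).2⟩, ?_⟩
    rw [sdiff_inter_self_left]
  · rw [filter_filter, filter_false_of_mem, sum_empty]
    · exact hν0
    · rintro C _ ⟨⟨h1, _⟩, h2⟩
      rw [h2] at h1
      exact hS h1

theorem sum_pow_sdiff_le_of_mem (hν : ∀ S : Finset α, 2 ≤ S.card →
    ∑ C ∈ 𝒞 with S ⊂ C, π ^ (C \ S).card ≤ ν) (hπ : 0 ≤ π) (hν0 : 0 ≤ ν) {c : α}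
    (hΛ : ∑ C ∈ 𝒞 with c ∈ C, π ^ (C.erase c).card ≤ Λ) (I : Finset α) :
    ∑ C ∈ 𝒞 with c ∈ C, π ^ (C \ insert c I).card ≤
      Λ + 2 ^ (insert c I).card * ν + 2 ^ (insert c I).card := by
  set B := insert c I
  have hB : ∑ C ∈ 𝒞 with C ⊆ B, (1 : ℝ) ≤ 2 ^ B.card := by
    rw [sum_const, nsmul_eq_mul, mul_one]
    have h2 : ((2 : ℝ) ^ B.card) = (B.powerset.card : ℝ) := by rw [card_powerset]; norm_num
    rw [h2, Nat.cast_le]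
    exact card_le_card fun C hC => mem_powerset.2 (mem_filter.1 hC).2
  refine le_trans ?_ (add_le_add (add_le_add hΛ
    (sum_pow_sdiff_le_of_two_le_inter hν hπ hν0 B)) hB)
  simp only [sum_filter]
  rw [← sum_add_distrib, ← sum_add_distrib]
  refine sum_le_sum fun C _ => ?_
  have n1 : 0 ≤ π ^ (C.erase c).card := by positivity
  have n2 : 0 ≤ π ^ (C \ B).card := by positivity
  by_cases hc : c ∈ C
  · by_cases hCB : C ⊆ B
    · rw [sdiff_eq_empty_iff_subset.2 hCB]
      simp only [hc, hCB, if_true, not_true_eq_false, and_false, if_false, card_empty, pow_zero]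
      linarith
    · by_cases h2 : 2 ≤ (C ∩ B).card
      · simp only [hc, hCB, h2, if_true, not_false_eq_true, and_self, if_false]
        linarith
      · have : C \ B = C.erase c := by
          have h3 : C ∩ B = {c} := by
            refine (eq_of_subset_of_card_le (singleton_subset_iff.2 ?_) ?_).symm
            · exact mem_inter.2 ⟨hc, mem_insert_self _ _⟩
            · rw [card_singleton]; omega
          rw [← sdiff_inter_self_left, h3, sdiff_singleton_eq_erase]
        rw [this]
        simp [hc, hCB, h2]
  · simp only [hc, if_false]
    split_ifs <;> positivity

instance (c c' : α) (I C₁ C₂ : Finset α) : Decidable (Linked c c' I C₁ C₂) := by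
  unfold Linked; infer_instance

theorem sum_linked_of_not_subset (hν : ∀ S : Finset α, 2 ≤ S.card →
    ∑ C ∈ 𝒞 with S ⊂ C, π ^ (C \ S).card ≤ ν) (hπ : 0 ≤ π) (hν0 : 0 ≤ ν) {c : α} (c' : α)
    (hΛ : ∑ C ∈ 𝒞 with c ∈ C, π ^ (C.erase c).card ≤ Λ) (hℓ : ∀ C ∈ 𝒞, C.card ≤ ℓ)
    {I : Finset α} (hI : I.card ≤ 2 * ℓ) :
    ∑ C₁ ∈ 𝒞, ∑ C₂ ∈ 𝒞 with Linked c c' I C₁ C₂ ∧ ¬ C₂ ⊆ insert c' (C₁ ∪ I),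
      π ^ ((C₁ ∪ C₂) \ insert c (insert c' I)).card ≤
    (Λ + 2 ^ (3 * ℓ + 1) * ν + 2 ^ (3 * ℓ + 1)) * (2 ^ (3 * ℓ + 1) * ν) := by
  have hpow : ∀ m ≤ 3 * ℓ + 1, (2 : ℝ) ^ m ≤ 2 ^ (3 * ℓ + 1) := fun m hm =>
    pow_le_pow_right₀ one_le_two hm
  have h1 : ∑ C ∈ 𝒞 with c ∈ C, π ^ (C \ insert c I).card ≤
      Λ + 2 ^ (3 * ℓ + 1) * ν + 2 ^ (3 * ℓ + 1) := by
    refine (sum_pow_sdiff_le_of_mem hν hπ hν0 hΛ I).trans ?_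
    have := hpow (insert c I).card ((card_insert_le _ _).trans (by omega))
    gcongr
  refine le_trans ?_ (mul_le_mul_of_nonneg_right h1 (by positivity))
  rw [sum_filter, sum_mul]
  refine sum_le_sum fun C₁ hC₁ => ?_
  split_ifs with hc
  · have h2 := sum_pow_sdiff_le_of_two_le_inter hν hπ hν0 (insert c' (C₁ ∪ I))
    have h3 := hpow (insert c' (C₁ ∪ I)).card ((card_insert_le _ _).trans (by
      have := card_union_le C₁ I
      have := hℓ C₁ hC₁
      omega))
    refine le_trans ?_ (mul_le_mul_of_nonneg_left (h2.trans
      (mul_le_mul_of_nonneg_right h3 hν0)) (by positivity))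
    rw [mul_sum]
    refine sum_filter_le_sum_filter ?_ fun _ _ _ => by positivity
    rintro C₂ _ ⟨⟨_, hcC, hc', hc'C, x, hx1, hx2, hx3⟩, hns⟩
    refine ⟨⟨?_, hns⟩, ?_⟩
    · refine one_lt_card.2 ⟨c', ?_, x, ?_, ?_⟩
      · simp [hc']
      · simp [hx1, hx2]
      · rintro rfl; exact hc'C hx1
    · rw [← pow_add, ← card_union_of_disjoint]
      · refine le_of_eq (congrArg (fun s : Finset α => π ^ s.card) ?_)
        ext z
        simp only [Finset.mem_sdiff, mem_union, mem_insert]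
        grind
      · rw [Finset.disjoint_left]
        intro z
        simp only [Finset.mem_sdiff, mem_union, mem_insert]
        tauto
  · rw [zero_mul]
    refine le_of_eq (sum_eq_zero fun C₂ hC₂ => ?_)
    exact absurd (mem_filter.1 hC₂).2.1.1 hc

theorem sum_linked_of_inter (hν : ∀ S : Finset α, 2 ≤ S.card →
    ∑ C ∈ 𝒞 with S ⊂ C, π ^ (C \ S).card ≤ ν) (hπ : 0 ≤ π) (hπ1 : π ≤ 1) (hν0 : 0 ≤ ν) {c : α}
    (c' : α) (hℓ : ∀ C ∈ 𝒞, C.card ≤ ℓ) {I : Finset α} (hI : I.card ≤ 2 * ℓ) (hcI : c ∉ I) :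
    ∑ C₁ ∈ 𝒞, ∑ C₂ ∈ 𝒞 with Linked c c' I C₁ C₂ ∧ C₂ ⊆ insert c' (C₁ ∪ I) ∧
      (C₁ ∩ I).Nonempty, π ^ ((C₁ ∪ C₂) \ insert c (insert c' I)).card ≤
    2 ^ (3 * ℓ + 1) * (2 ^ (3 * ℓ + 1) * ν) := by
  have hpow : ∀ m ≤ 3 * ℓ + 1, (2 : ℝ) ^ m ≤ 2 ^ (3 * ℓ + 1) := fun m hm =>
    pow_le_pow_right₀ one_le_two hm
  have h1 := (sum_pow_sdiff_le_of_two_le_inter hν hπ hν0 (insert c I)).trans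
    (mul_le_mul_of_nonneg_right (hpow (insert c I).card ((card_insert_le _ _).trans (by omega)))
    hν0)
  refine le_trans ?_ (mul_le_mul_of_nonneg_left h1 (by positivity))
  rw [sum_filter, mul_sum]
  refine sum_le_sum fun C₁ hC₁ => ?_
  split_ifs with hc
  · have h3 := hpow (insert c' (C₁ ∪ I)).card ((card_insert_le _ _).trans (by
      have := card_union_le C₁ I
      have := hℓ C₁ hC₁
      omega))
    have h2 : ((2 : ℝ) ^ (insert c' (C₁ ∪ I)).card) =
        ((insert c' (C₁ ∪ I)).powerset.card : ℝ) := by rw [card_powerset]; norm_num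
    rw [h2] at h3
    refine le_trans ?_ (mul_le_mul_of_nonneg_right h3 (by positivity))
    rw [← nsmul_eq_mul]
    refine (sum_le_card_nsmul _ _ (π ^ (C₁ \ insert c I).card) fun C₂ hC₂ => ?_).trans
      (nsmul_le_nsmul_left (by positivity) (card_le_card fun C₂ hC₂ =>
        mem_powerset.2 (mem_filter.1 hC₂).2.2.1))
    obtain ⟨_, ⟨_, hcC, hc', hc'C, x, hx1, hx2, hx3⟩, hs, _⟩ := mem_filter.1 hC₂
    refine pow_le_pow_of_le_one hπ hπ1 (card_le_card fun z hz => ?_)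
    simp only [Finset.mem_sdiff, mem_union, mem_insert] at hz ⊢
    grind
  · rw [mul_zero]
    refine le_of_eq (sum_eq_zero fun C₂ hC₂ => ?_)
    obtain ⟨_, ⟨hcC, hc2, hc', hc'C, x, hx1, hx2, hx3⟩, hs, z, hz⟩ := mem_filter.1 hC₂
    obtain ⟨hz1, hz2⟩ := mem_inter.1 hz
    refine absurd ⟨one_lt_card.2 ⟨c, ?_, z, ?_, ?_⟩, fun h => ?_⟩ hc
    · simp [hcC]
    · simp [hz1, hz2]
    · rintro rfl; exact hcI hz2
    · rcases mem_insert.1 (h hx1) with rfl | h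
      · exact hc2 hx2
      · exact hx3 h

theorem sum_linked_of_erase_eq (hπ : 0 ≤ π) {c c' : α} {I : Finset α}
    (h4 : ∑ C ∈ 𝒞 with c ∈ C ∧ c' ∉ C ∧ insert c' (C.erase c) ∈ 𝒞, π ^ (C.erase c).card ≤ ν') :
    ∑ C₁ ∈ 𝒞, ∑ C₂ ∈ 𝒞 with Linked c c' I C₁ C₂ ∧ C₁.erase c = C₂.erase c' ∧ Disjoint C₁ I,
      π ^ ((C₁ ∪ C₂) \ insert c (insert c' I)).card ≤ ν' := by
  refine le_trans ?_ h4
  rw [sum_filter]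
  refine sum_le_sum fun C₁ hC₁ => ?_
  have key : ∀ C₂, Linked c c' I C₁ C₂ ∧ C₁.erase c = C₂.erase c' ∧ Disjoint C₁ I →
      C₂ = insert c' (C₁.erase c) := by
    rintro C₂ ⟨⟨_, _, h, _⟩, h', _⟩
    rw [h', insert_erase h]
  have hsub : (𝒞.filter fun C₂ => Linked c c' I C₁ C₂ ∧ C₁.erase c = C₂.erase c' ∧
      Disjoint C₁ I) ⊆ {insert c' (C₁.erase c)} := fun C₂ hC₂ =>
    mem_singleton.2 (key C₂ (mem_filter.1 hC₂).2)
  rcases subset_singleton_iff.1 hsub with h | h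
  · rw [h, sum_empty]; split_ifs <;> positivity
  · have hm : insert c' (C₁.erase c) ∈ 𝒞.filter fun C₂ => Linked c c' I C₁ C₂ ∧
      C₁.erase c = C₂.erase c' ∧ Disjoint C₁ I := by rw [h]; exact mem_singleton_self _
    obtain ⟨m1, ⟨m2, m3, m4, m5, _⟩, m6, m7⟩ := mem_filter.1 hm
    rw [h, sum_singleton, if_pos ⟨m2, m5, m1⟩]
    refine le_of_eq (congrArg (fun s : Finset α => π ^ s.card) ?_)
    ext z
    have : z ∈ C₁ → z ∉ I := fun h => Finset.disjoint_left.1 m7 h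
    simp only [Finset.mem_sdiff, mem_union, mem_insert, mem_erase]
    grind

theorem sum_linked_le (hν : ∀ S : Finset α, 2 ≤ S.card →
    ∑ C ∈ 𝒞 with S ⊂ C, π ^ (C \ S).card ≤ ν) (hπ : 0 ≤ π) (hπ1 : π ≤ 1) (hν0 : 0 ≤ ν)
    (hν1 : ν ≤ 1) (hΛ1 : 1 ≤ Λ) {c c' : α}
    (hΛ : ∑ C ∈ 𝒞 with c ∈ C, π ^ (C.erase c).card ≤ Λ)
    (hΛ' : ∑ C ∈ 𝒞 with c' ∈ C, π ^ (C.erase c').card ≤ Λ)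
    (h4 : ∑ C ∈ 𝒞 with c ∈ C ∧ c' ∉ C ∧ insert c' (C.erase c) ∈ 𝒞, π ^ (C.erase c).card ≤ ν')
    (hℓ : ∀ C ∈ 𝒞, C.card ≤ ℓ) {I : Finset α} (hI : I.card ≤ 2 * ℓ) (hcI : c ∉ I)
    (hcI' : c' ∉ I) :
    ∑ C₁ ∈ 𝒞, ∑ C₂ ∈ 𝒞 with Linked c c' I C₁ C₂,
      π ^ ((C₁ ∪ C₂) \ insert c (insert c' I)).card ≤
    8 * (2 ^ (3 * ℓ + 1)) ^ 2 * Λ * ν + ν' := by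
  have t1 := sum_linked_of_not_subset hν hπ hν0 c' hΛ hℓ hI
  have t1' := sum_linked_of_not_subset hν hπ hν0 c hΛ' hℓ hI
  have t2 := sum_linked_of_inter hν hπ hπ1 hν0 c' hℓ hI hcI
  have t2' := sum_linked_of_inter hν hπ hπ1 hν0 c hℓ hI hcI'
  have t3 := sum_linked_of_erase_eq hπ (I := I) h4
  simp only [sum_filter] at t1' t2' t1 t2 t3 ⊢
  rw [sum_comm] at t1' t2'
  have hK : (1 : ℝ) ≤ 2 ^ (3 * ℓ + 1) := one_le_pow₀ one_le_two
  set K : ℝ := 2 ^ (3 * ℓ + 1)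
  have hbound : (Λ + K * ν + K) * (K * ν) + (Λ + K * ν + K) * (K * ν) + K * (K * ν) + K * (K * ν)
      ≤ 8 * K ^ 2 * Λ * ν := by
    have e1 : Λ + K * ν + K ≤ 3 * (K * Λ) := by
      have : Λ ≤ K * Λ := le_mul_of_one_le_left (by linarith) hK
      have : K ≤ K * Λ := le_mul_of_one_le_right (by linarith) hΛ1
      have : K * ν ≤ K := mul_le_of_le_one_right (by linarith) hν1
      linarith
    have e2 : (Λ + K * ν + K) * (K * ν) ≤ 3 * (K * Λ) * (K * ν) :=
      mul_le_mul_of_nonneg_right e1 (by positivity)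
    have e3 : K * (K * ν) ≤ K * (K * ν) * Λ := le_mul_of_one_le_right (by positivity) hΛ1
    nlinarith
  refine le_trans ?_ (add_le_add_left hbound ν')
  refine le_trans ?_ (add_le_add (add_le_add (add_le_add (add_le_add t1 t1') t2) t2') t3)
  simp only [← sum_add_distrib]
  refine sum_le_sum fun C₁ hC₁ => sum_le_sum fun C₂ hC₂ => ?_
  have hcomm : (C₂ ∪ C₁) \ insert c' (insert c I) = (C₁ ∪ C₂) \ insert c (insert c' I) := by
    rw [union_comm, Finset.insert_comm]
  rw [hcomm]
  set u := π ^ ((C₁ ∪ C₂) \ insert c (insert c' I)).card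
  have hu : 0 ≤ u := by positivity
  have nn : ∀ p : Prop, ∀ [Decidable p], 0 ≤ if p then u else 0 := fun p _ => by
    split_ifs <;> positivity
  have one : ∀ p : Prop, ∀ [Decidable p], p → u ≤ if p then u else 0 := fun p _ hp => by
    rw [if_pos hp]
  have n1 := nn (Linked c c' I C₁ C₂ ∧ ¬ C₂ ⊆ insert c' (C₁ ∪ I))
  have n1' := nn (Linked c' c I C₂ C₁ ∧ ¬ C₁ ⊆ insert c (C₂ ∪ I))
  have n2 := nn (Linked c c' I C₁ C₂ ∧ C₂ ⊆ insert c' (C₁ ∪ I) ∧ (C₁ ∩ I).Nonempty)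
  have n2' := nn (Linked c' c I C₂ C₁ ∧ C₁ ⊆ insert c (C₂ ∪ I) ∧ (C₂ ∩ I).Nonempty)
  have n3 := nn (Linked c c' I C₁ C₂ ∧ C₁.erase c = C₂.erase c' ∧ Disjoint C₁ I)
  by_cases hL : Linked c c' I C₁ C₂
  · rw [if_pos hL]
    by_cases h1 : C₂ ⊆ insert c' (C₁ ∪ I)
    · by_cases h1' : C₁ ⊆ insert c (C₂ ∪ I)
      · by_cases h2 : (C₁ ∩ I).Nonempty
        · have := one _ (And.intro hL (And.intro h1 h2))
          linarith
        · by_cases h2' : (C₂ ∩ I).Nonempty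
          · have := one _ (And.intro hL.symm (And.intro h1' h2'))
            linarith
          · rw [not_nonempty_iff_eq_empty, ← disjoint_iff_inter_eq_empty] at h2 h2'
            have h3 : C₁.erase c = C₂.erase c' := by
              obtain ⟨a1, a2, a3, a4, _⟩ := hL
              ext z
              have b1 := @h1 z
              have b2 := @h1' z
              have b3 : z ∈ C₁ → z ∉ I := fun h => Finset.disjoint_left.1 h2 h
              have b4 : z ∈ C₂ → z ∉ I := fun h => Finset.disjoint_left.1 h2' h
              simp only [mem_insert, mem_union, mem_erase] at b1 b2 ⊢
              grind
            have := one _ (And.intro hL (And.intro h3 h2))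
            linarith
      · have := one _ (And.intro hL.symm h1')
        linarith
    · have := one _ (And.intro hL h1)
      linarith
  · rw [if_neg hL]
    linarith
end Static

/-- The weighted counts of conflicts that control all configurations. -/
structure Spread {V : Type*} [DecidableEq V] (ℓ : ℕ) (H : Finset (Finset V))
    (𝒞 𝒯 : Finset (Finset (Finset V))) (π Λ ν ν' : ℝ) : Prop where
  pos : 0 < π
  le_one : π ≤ 1
  one_le : 1 ≤ Λ
  ν_nonneg : 0 ≤ ν
  ν_le_one : ν ≤ 1
  ν'_nonneg : 0 ≤ ν'
  card_le : ∀ C ∈ 𝒞, C.card ≤ ℓ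
  deg : ∀ v : V, π * (H.filter fun f => v ∈ f).card ≤ Λ
  through : ∀ c ∈ H, ∑ C ∈ 𝒞 with c ∈ C, π ^ (C.erase c).card ≤ Λ
  above : ∀ S : Finset (Finset V), 2 ≤ S.card → ∑ C ∈ 𝒞 with S ⊂ C, π ^ (C \ S).card ≤ ν
  pairs : ∀ e ∈ H, ∀ v : V,
    π * (H.filter fun f => ({e, f} : Finset (Finset V)) ∈ 𝒞 ∧ f ≠ e ∧ v ∈ f).card ≤ ν'
  common : ∀ c ∈ H, ∀ c' ∈ H, Disjoint c c' → ({c, c'} : Finset (Finset V)) ∉ 𝒯 →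
    ∑ C ∈ 𝒞 with c ∈ C ∧ c' ∉ C ∧ insert c' (C.erase c) ∈ 𝒞, π ^ (C.erase c).card ≤ ν'

section Families

variable {V : Type*} [DecidableEq V] {ℓ : ℕ} {H : Finset (Finset V)}
  {𝒞 𝒯 : Finset (Finset (Finset V))} {π Λ ν ν' : ℝ}

theorem pow_card_sdiff_eq_mul {α : Type*} [DecidableEq α] (π : ℝ) {C B : Finset α} {g : α}
    (hg : g ∈ C) (hB : g ∉ B) : π ^ (C \ B).card = π * π ^ (C \ insert g B).card := by
  have : C \ B = insert g (C \ insert g B) := by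
    ext z
    simp only [Finset.mem_sdiff, mem_insert]
    grind
  rw [this, card_insert_of_notMem (by simp), pow_succ']

theorem Spread.sum_extra_le (hs : Spread ℓ H 𝒞 𝒯 π Λ ν ν') {B : Finset (Finset V)}
    (hB : 2 ≤ B.card) : ∑ q ∈ 𝒞 ×ˢ H with B ⊆ q.1 ∧ q.2 ∈ q.1 ∧ q.2 ∉ B,
      π * π ^ (q.1 \ insert q.2 B).card ≤ ℓ * ν := by
  refine le_trans ?_ (mul_le_mul_of_nonneg_left (hs.above B hB) (Nat.cast_nonneg ℓ))
  rw [sum_filter, sum_product, sum_filter, mul_sum]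
  refine sum_le_sum fun C hC => ?_
  dsimp only
  rw [← sum_filter]
  have hπ := hs.pos
  refine (sum_le_card_nsmul _ _ (if B ⊂ C then π ^ (C \ B).card else 0) fun g hg => ?_).trans ?_
  · obtain ⟨_, h1, h2, h3⟩ := mem_filter.1 hg
    rw [if_pos ⟨h1, fun h => h3 (h h2)⟩, pow_card_sdiff_eq_mul π h2 h3]
  · rw [nsmul_eq_mul]
    refine mul_le_mul_of_nonneg_right ?_ (by split_ifs <;> positivity)
    have h : (H.filter fun g => B ⊆ C ∧ g ∈ C ∧ g ∉ B) ⊆ C := fun g hg => (mem_filter.1 hg).2.2.1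
    exact_mod_cast (card_le_card h).trans (hs.card_le C hC)

theorem Spread.sum_famT_le (hs : Spread ℓ H 𝒞 𝒯 π Λ ν ν') {e : Finset V} (he : e ∈ H) (v : V)
    (I : Finset (Finset V)) : π * ∑ q ∈ famT 𝒞 H e v with I ⊆ wT e q, π ^ (wT e q \ I).card ≤
      ℓ * ν + Λ * ν + ν' := by
  have hπ := hs.pos
  have hν := hs.ν_nonneg
  have hν' := hs.ν'_nonneg
  have hΛ := hs.one_le
  rw [mul_sum, famT, filter_filter]
  rcases I.eq_empty_or_nonempty with rfl | ⟨i, hi⟩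
  · refine le_trans ?_ (show Λ * ν + ν' ≤ _ by
      have : 0 ≤ (ℓ : ℝ) * ν := by positivity
      linarith)
    simp only [empty_subset, and_true, sdiff_empty]
    rw [sum_filter, sum_product_right]
    refine le_trans ?_ (add_le_add (mul_le_mul_of_nonneg_right (hs.deg v) hν) (hs.pairs e he v))
    rw [mul_comm π, mul_comm π, mul_assoc, ← nsmul_eq_mul, ← nsmul_eq_mul, ← sum_const, ← sum_const,
      sum_filter, sum_filter, ← sum_add_distrib]
    refine sum_le_sum fun g _ => ?_
    dsimp only
    by_cases hg : v ∈ g ∧ g ≠ e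
    · have h2 : ({e, g} : Finset (Finset V)).card = 2 := card_pair hg.2.symm
      have h3 := mul_le_mul_of_nonneg_left (hs.above {e, g} h2.ge) hπ.le
      have h4 : ∑ C ∈ 𝒞, (if C = {e, g} then π else 0) =
          if ({e, g} : Finset (Finset V)) ∈ 𝒞 then π else 0 := by rw [sum_ite_eq']
      rw [mul_sum, sum_filter] at h3
      have h5 : (if ({e, g} : Finset (Finset V)) ∈ 𝒞 ∧ g ≠ e ∧ v ∈ g then π else 0) =
        if ({e, g} : Finset (Finset V)) ∈ 𝒞 then π else 0 := by simp [hg.1, hg.2]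
      rw [if_pos hg.1, h5, ← h4]
      refine le_trans ?_ (add_le_add_left h3 _)
      rw [← sum_add_distrib]
      refine sum_le_sum fun C _ => ?_
      have n1 : 0 ≤ π * π ^ (C \ {e, g}).card := by positivity
      by_cases hC : C = {e, g}
      · rw [if_pos hC, hC, wT]
        simp only [sdiff_self, bot_eq_empty, card_empty, pow_zero, mul_one]
        split_ifs <;> linarith
      · rw [if_neg hC, add_zero]
        by_cases hc : e ∈ C ∧ g ∈ C ∧ g ≠ e ∧ v ∈ g
        · rw [if_pos hc, if_pos, wT]
          refine Finset.ssubset_iff_subset_ne.2 ⟨fun z hz => ?_, Ne.symm hC⟩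
          rcases mem_insert.1 hz with rfl | hz
          · exact hc.1
          · rw [mem_singleton.1 hz]; exact hc.2.1
        · rw [if_neg hc]
          split_ifs <;> first | exact n1 | exact le_rfl
    · rw [sum_eq_zero fun C _ => if_neg fun h => hg ⟨h.2.2.2, h.2.2.1⟩]
      split_ifs <;> positivity
  · refine le_trans ?_ (show (ℓ : ℝ) * ν ≤ _ by
      have : 0 ≤ Λ * ν := by positivity
      linarith)
    by_cases heI : e ∈ I
    · rw [filter_false_of_mem, sum_empty]
      · positivity
      · rintro q _ ⟨_, h⟩
        have := h heI
        simp [wT] at this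
    · refine le_trans ?_ (hs.sum_extra_le (B := insert e I) ?_)
      · refine sum_filter_le_sum_filter ?_ fun _ _ _ => by positivity
        rintro q _ ⟨⟨h1, h2, h3, h4⟩, h5⟩
        have h6 : q.2 ∉ I := fun h => by simpa [wT] using h5 h
        refine ⟨⟨insert_subset h1 (h5.trans sdiff_subset), h2, ?_⟩, le_of_eq ?_⟩
        · simp [h3, h6]
        · congr 3
          ext z
          simp only [wT, Finset.mem_sdiff, mem_insert, mem_singleton]
          tauto
      · rw [card_insert_of_notMem heI]
        have := card_pos.2 ⟨i, hi⟩
        omega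

theorem Spread.sum_famR_le (hs : Spread ℓ H 𝒞 𝒯 π Λ ν ν') (f g : Finset V)
    (I : Finset (Finset V)) : π * ∑ q ∈ famR 𝒞 H f g with I ⊆ wR f g q,
      π ^ (wR f g q \ I).card ≤ ℓ * ν := by
  have hπ := hs.pos
  have hν := hs.ν_nonneg
  rw [mul_sum, famR, filter_filter]
  by_cases hfg : f = g
  · rw [filter_false_of_mem, sum_empty]
    · positivity
    · rintro q _ ⟨⟨_, _, _, h, _⟩, _⟩
      exact h hfg
  · refine le_trans ?_ (hs.sum_extra_le (B := insert f (insert g I)) ?_)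
    · refine sum_filter_le_sum_filter ?_ fun _ _ _ => by positivity
      rintro q _ ⟨⟨h1, h2, h3, _, h4, h4'⟩, h5⟩
      have h6 : q.2 ∉ I := fun h => by simpa [wR] using h5 h
      refine ⟨⟨insert_subset h1 (insert_subset h2 (h5.trans sdiff_subset)), h3, ?_⟩, le_of_eq ?_⟩
      · simp [h4, h4', h6]
      · congr 3
        ext z
        simp only [wR, Finset.mem_sdiff, mem_insert, mem_singleton]
        tauto
    · refine one_lt_card.2 ⟨f, by simp, g, by simp, hfg⟩

theorem Spread.sum_famP_le (hs : Spread ℓ H 𝒞 𝒯 π Λ ν ν') {c c' : Finset V} (hc : c ∈ H)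
    (hc' : c' ∈ H) (hd : Disjoint c c') (hT : ({c, c'} : Finset (Finset V)) ∉ 𝒯)
    (I : Finset (Finset V)) : π * ∑ q ∈ famP 𝒞 H c c' with I ⊆ wP c c' q,
      π ^ (wP c c' q \ I).card ≤ ℓ * (8 * (2 ^ (3 * ℓ + 1)) ^ 2 * Λ * ν + ν') := by
  have hπ := hs.pos
  have hν := hs.ν_nonneg
  have hν' := hs.ν'_nonneg
  have hΛ := hs.one_le
  rw [mul_sum, famP, filter_filter]
  by_cases hI : I.card ≤ 2 * ℓ ∧ c ∉ I ∧ c' ∉ I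
  · have key := sum_linked_le hs.above hπ.le hs.le_one hν hs.ν_le_one hΛ (hs.through c hc)
      (hs.through c' hc') (hs.common c hc c' hc' hd hT) hs.card_le hI.1 hI.2.1 hI.2.2
    refine le_trans ?_ (mul_le_mul_of_nonneg_left key (Nat.cast_nonneg ℓ))
    rw [sum_filter, sum_product, mul_sum]
    refine sum_le_sum fun C₁ hC₁ => ?_
    rw [sum_product, sum_filter, mul_sum]
    refine sum_le_sum fun C₂ hC₂ => ?_
    dsimp only
    rw [← sum_filter]
    refine (sum_le_card_nsmul _ _ (if Linked c c' I C₁ C₂ then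
      π ^ ((C₁ ∪ C₂) \ insert c (insert c' I)).card else 0) fun h hh => ?_).trans ?_
    · obtain ⟨_, ⟨h1, h2, h3, h4, h5, h6⟩, h7⟩ := mem_filter.1 hh
      have h8 : h ∉ I := fun h => by simpa [wP] using h7 h
      have h9 : h ∉ insert c (insert c' I) := by
        simp only [mem_insert, not_or]
        exact ⟨fun h' => h2 (h' ▸ h6), fun h' => h4 (h' ▸ h5), h8⟩
      rw [if_pos ⟨h1, h2, h3, h4, h, h5, h6, h8⟩,
        pow_card_sdiff_eq_mul π (mem_union_left _ h5) h9]
      refine le_of_eq ?_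
      congr 3
      ext z
      simp only [wP, Finset.mem_sdiff, mem_insert, mem_singleton]
      tauto
    · rw [nsmul_eq_mul]
      refine mul_le_mul_of_nonneg_right ?_ (by split_ifs <;> positivity)
      refine Nat.cast_le.2 ((card_le_card fun g hg => ?_).trans (hs.card_le C₁ hC₁))
      exact (mem_filter.1 hg).2.1.2.2.2.2.1
  · rw [filter_false_of_mem, sum_empty]
    · positivity
    · rintro q hq ⟨_, h⟩
      refine hI ⟨?_, fun h' => ?_, fun h' => ?_⟩
      · have h1 := hs.card_le q.1 (mem_product.1 hq).1
        have h2 := hs.card_le q.2.1 (mem_product.1 (mem_product.1 hq).2).1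
        have h3 := (card_le_card (h.trans sdiff_subset)).trans (card_union_le _ _)
        omega
      · simpa [wP] using h h'
      · simpa [wP] using h h'

end Families

/-- The hypotheses on the hypergraph `H` and its conflicts `𝒞`, with relative error `ζ`. -/
structure System {V : Type*} [DecidableEq V] (r ℓ : ℕ) (H : Finset (Finset V))
    (𝒞 : Finset (Finset (Finset V))) (d ζ : ℝ) : Prop where
  card_edge : ∀ e ∈ H, e.card = r
  deg_ge : ∀ v : V, (1 - ζ) * d ≤ (H.filter fun e => v ∈ e).card
  deg_le : ∀ v : V, ((H.filter fun e => v ∈ e).card : ℝ) ≤ (1 + ζ) * d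
  codeg : ∀ u v : V, u ≠ v → ((H.filter fun e => u ∈ e ∧ v ∈ e).card : ℝ) ≤ d * ζ
  sub : ∀ C ∈ 𝒞, C ⊆ H
  two_le : ∀ C ∈ 𝒞, 2 ≤ C.card
  card_le : ∀ C ∈ 𝒞, C.card ≤ ℓ
  deg_conflict : ∀ j, 2 ≤ j → j ≤ ℓ → ∀ e ∈ H,
    ((𝒞.filter fun C => C.card = j ∧ e ∈ C).card : ℝ) ≤ ℓ * d ^ (j - 1)
  codeg_conflict : ∀ j j', 2 ≤ j' → j' < j → j ≤ ℓ → ∀ S : Finset (Finset V), S ⊆ H →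
    S.card = j' → ((𝒞.filter fun C => C.card = j ∧ S ⊆ C).card : ℝ) ≤ d ^ (j - j') * ζ
  pairs : ∀ e ∈ H, ∀ v : V,
    ((H.filter fun f => ({e, f} : Finset (Finset V)) ∈ 𝒞 ∧ v ∈ f).card : ℝ) ≤ d * ζ
  common : ∀ e ∈ H, ∀ f ∈ H, Disjoint e f →
    ((H.filter fun g => ({e, g} : Finset (Finset V)) ∈ 𝒞 ∧
      ({f, g} : Finset (Finset V)) ∈ 𝒞).card : ℝ) ≤ d * ζ

section System

variable {V : Type*} [DecidableEq V] {r ℓ : ℕ} {H : Finset (Finset V)}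
  {𝒞 : Finset (Finset (Finset V))} {d ζ q : ℝ}

theorem System.sum_through_le (hs : System r ℓ H 𝒞 d ζ) (hq : 0 ≤ q) {c : Finset V} (hc : c ∈ H) :
    ∑ C ∈ 𝒞 with c ∈ C, q ^ (C.erase c).card ≤ ∑ j ∈ Icc 2 ℓ, ℓ * (d * q) ^ (j - 1) := by
  rw [← sum_fiberwise_of_maps_to (t := Icc 2 ℓ) (g := card) fun C hC =>
    mem_Icc.2 ⟨hs.two_le C (mem_filter.1 hC).1, hs.card_le C (mem_filter.1 hC).1⟩]
  refine sum_le_sum fun j hj => ?_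
  obtain ⟨h1, h2⟩ := mem_Icc.1 hj
  refine (sum_le_card_nsmul _ _ (q ^ (j - 1)) fun C hC => ?_).trans ?_
  · obtain ⟨h3, h4⟩ := mem_filter.1 hC
    rw [card_erase_of_mem (mem_filter.1 h3).2, h4]
  · rw [nsmul_eq_mul, mul_pow, ← mul_assoc]
    refine mul_le_mul_of_nonneg_right ?_ (by positivity)
    refine le_trans (Nat.cast_le.2 (card_le_card ?_)) (hs.deg_conflict j h1 h2 c hc)
    intro C hC
    simp only [mem_filter] at hC ⊢
    tauto

theorem System.sum_above_le (hs : System r ℓ H 𝒞 d ζ) (hζ : 0 ≤ ζ) (hq : 0 ≤ q)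
    (hdq : 1 ≤ d * q) {S : Finset (Finset V)} (hS : 2 ≤ S.card) :
    ∑ C ∈ 𝒞 with S ⊂ C, q ^ (C \ S).card ≤ ℓ * ((d * q) ^ ℓ * ζ) := by
  by_cases hSH : S ⊆ H
  swap
  · rw [filter_false_of_mem fun C hC h => hSH (h.1.trans (hs.sub C hC)), sum_empty]
    positivity
  rw [← sum_fiberwise_of_maps_to (t := Ioc S.card ℓ) (g := card) fun C hC =>
    mem_Ioc.2 ⟨card_lt_card (mem_filter.1 hC).2, hs.card_le C (mem_filter.1 hC).1⟩]
  refine (sum_le_card_nsmul _ _ ((d * q) ^ ℓ * ζ) fun j hj => ?_).trans ?_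
  · obtain ⟨h1, h2⟩ := mem_Ioc.1 hj
    refine (sum_le_card_nsmul _ _ (q ^ (j - S.card)) fun C hC => ?_).trans ?_
    · obtain ⟨h3, h4⟩ := mem_filter.1 hC
      rw [card_sdiff_of_subset (mem_filter.1 h3).2.1, h4]
    · rw [nsmul_eq_mul]
      calc _ ≤ d ^ (j - S.card) * ζ * q ^ (j - S.card) := by
            refine mul_le_mul_of_nonneg_right ?_ (by positivity)
            refine le_trans (Nat.cast_le.2 (card_le_card ?_))
              (hs.codeg_conflict j S.card hS h1 h2 S hSH rfl)
            intro C hC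
            simp only [mem_filter] at hC ⊢
            exact ⟨hC.1.1, hC.2, hC.1.2.1⟩
        _ = (d * q) ^ (j - S.card) * ζ := by rw [mul_pow]; ring
        _ ≤ (d * q) ^ ℓ * ζ := by
            refine mul_le_mul_of_nonneg_right (pow_le_pow_right₀ hdq (by omega)) hζ
  · rw [nsmul_eq_mul, Nat.card_Ioc]
    refine mul_le_mul_of_nonneg_right ?_ (by positivity)
    exact_mod_cast Nat.sub_le _ _

/-- The weighted number of sets of at least two edges completing both `e` and `f` to a conflict. -/
noncomputable def twinWeight (H : Finset (Finset V)) (𝒞 : Finset (Finset (Finset V))) (q : ℝ)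
    (e f : Finset V) : ℝ :=
  ∑ S ∈ H.powerset with 2 ≤ S.card ∧ e ∉ S ∧ f ∉ S ∧ insert e S ∈ 𝒞 ∧ insert f S ∈ 𝒞, q ^ S.card

/-- The pairs of disjoint edges with large twin weight. -/
noncomputable def twinPairs (H : Finset (Finset V)) (𝒞 : Finset (Finset (Finset V))) (q ν₁ : ℝ) :
    Finset (Finset (Finset V)) :=
  ((H ×ˢ H).filter fun p => Disjoint p.1 p.2 ∧ ν₁ < twinWeight H 𝒞 q p.1 p.2).image
    fun p => {p.1, p.2}

/-- The conflicts consisting of disjoint edges without twins. -/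
noncomputable def properConflicts (H : Finset (Finset V)) (𝒞 : Finset (Finset (Finset V)))
    (q ν₁ : ℝ) : Finset (Finset (Finset V)) :=
  𝒞.filter fun C => (∀ e ∈ C, ∀ f ∈ C, e ≠ f → Disjoint e f) ∧
    ∀ e ∈ C, ∀ f ∈ C, ({e, f} : Finset (Finset V)) ∉ twinPairs H 𝒞 q ν₁

variable {ν₁ : ℝ}

theorem twinWeight_comm (e f : Finset V) : twinWeight H 𝒞 q e f = twinWeight H 𝒞 q f e := by
  unfold twinWeight
  congr 1
  ext S
  simp only [mem_filter]
  tauto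

theorem pair_mem_twinPairs {e f : Finset V} : ({e, f} : Finset (Finset V)) ∈ twinPairs H 𝒞 q ν₁ ↔
    e ∈ H ∧ f ∈ H ∧ Disjoint e f ∧ ν₁ < twinWeight H 𝒞 q e f := by
  rw [twinPairs, mem_image]
  constructor
  · rintro ⟨p, hp, h⟩
    obtain ⟨hp1, hp2, hp3⟩ := mem_filter.1 hp
    obtain ⟨ha, hb⟩ := mem_product.1 hp1
    have he : e = p.1 ∨ e = p.2 := by
      have : e ∈ ({p.1, p.2} : Finset (Finset V)) := h ▸ mem_insert_self _ _
      simpa using this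
    have hf : f = p.1 ∨ f = p.2 := by
      have : f ∈ ({p.1, p.2} : Finset (Finset V)) := h ▸ by simp
      simpa using this
    have h1 : p.1 = e ∨ p.1 = f := by
      have : p.1 ∈ ({e, f} : Finset (Finset V)) := h ▸ by simp
      simpa using this
    have h2 : p.2 = e ∨ p.2 = f := by
      have : p.2 ∈ ({e, f} : Finset (Finset V)) := h ▸ by simp
      simpa using this
    obtain ⟨a, b⟩ := p
    dsimp only at *
    rcases h1 with rfl | rfl
    · rcases h2 with rfl | rfl
      · rcases hf with rfl | rfl <;> exact ⟨ha, hb, hp2, hp3⟩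
      · exact ⟨ha, hb, hp2, hp3⟩
    · rcases h2 with rfl | rfl
      · exact ⟨hb, ha, hp2.symm, twinWeight_comm (H := H) _ _ ▸ hp3⟩
      · rcases he with rfl | rfl <;> exact ⟨ha, hb, hp2, hp3⟩
  · rintro ⟨h1, h2, h3, h4⟩
    exact ⟨(e, f), mem_filter.2 ⟨mem_product.2 ⟨h1, h2⟩, h3, h4⟩, rfl⟩

theorem exists_of_mem_twinPairs {C : Finset (Finset V)} (hC : C ∈ twinPairs H 𝒞 q ν₁) :
    ∃ e ∈ H, ∃ f ∈ H, Disjoint e f ∧ C = {e, f} := by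
  obtain ⟨p, hp, h⟩ := mem_image.1 hC
  obtain ⟨hp1, hp2, hp3⟩ := mem_filter.1 hp
  exact ⟨p.1, (mem_product.1 hp1).1, p.2, (mem_product.1 hp1).2, hp2, h.symm⟩

theorem System.ne_of_disjoint (hs : System r ℓ H 𝒞 d ζ) (hr : 0 < r) {e f : Finset V} (he : e ∈ H)
    (h : Disjoint e f) : e ≠ f := by
  rintro rfl
  have := hs.card_edge e he
  rw [disjoint_self_iff_empty] at h
  rw [h, card_empty] at this
  omega

theorem System.card_of_mem_twinPairs (hs : System r ℓ H 𝒞 d ζ) (hr : 0 < r)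
    {C : Finset (Finset V)} (hC : C ∈ twinPairs H 𝒞 q ν₁) : C.card = 2 := by
  obtain ⟨e, he, f, _, h, rfl⟩ := exists_of_mem_twinPairs hC
  exact card_pair (hs.ne_of_disjoint hr he h)

theorem System.card_twins_le (hs : System r ℓ H 𝒞 d ζ) (hq : 0 ≤ q) (hζ : 0 ≤ ζ) (hd : 0 ≤ d)
    {Λ : ℝ}
    (hΛ : ∀ c ∈ H, ∑ C ∈ 𝒞 with c ∈ C, q ^ (C.erase c).card ≤ Λ) {e : Finset V} (he : e ∈ H) :
    (H.filter fun f => ({e, f} : Finset (Finset V)) ∈ twinPairs H 𝒞 q ν₁).card * ν₁ ≤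
      Λ * (d * ζ) := by
  calc _ ≤ ∑ f ∈ H, twinWeight H 𝒞 q e f := by
        rw [← nsmul_eq_mul]
        refine (card_nsmul_le_sum _ (fun f => twinWeight H 𝒞 q e f) _ fun f hf => ?_).trans
          (sum_le_sum_of_subset_of_nonneg (filter_subset _ _) fun f _ _ => ?_)
        · exact (pair_mem_twinPairs.1 (mem_filter.1 hf).2).2.2.2.le
        · exact sum_nonneg fun _ _ => by positivity
    _ = ∑ S ∈ H.powerset, ∑ f ∈ H, if 2 ≤ S.card ∧ e ∉ S ∧ f ∉ S ∧ insert e S ∈ 𝒞 ∧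
          insert f S ∈ 𝒞 then q ^ S.card else 0 := by
        rw [sum_comm]
        exact sum_congr rfl fun f _ => by rw [twinWeight, sum_filter]
    _ ≤ ∑ S ∈ H.powerset with e ∉ S ∧ insert e S ∈ 𝒞, q ^ S.card * (d * ζ) := by
        rw [sum_filter]
        refine sum_le_sum fun S hS => ?_
        split_ifs with h
        · rw [← sum_filter]
          by_cases h2 : 2 ≤ S.card
          · rw [sum_const, nsmul_eq_mul, mul_comm]
            refine mul_le_mul_of_nonneg_left ?_ (by positivity)
            have hle : S.card + 1 ≤ ℓ := by
              have := hs.card_le _ h.2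
              rwa [card_insert_of_notMem h.1] at this
            have h3 := hs.codeg_conflict (S.card + 1) S.card h2 (by omega) hle S
              (mem_powerset.1 hS) rfl
            rw [Nat.add_sub_cancel_left, pow_one] at h3
            refine le_trans (Nat.cast_le.2 (card_le_card_of_injOn (fun f => insert f S)
              (fun f hf => ?_) fun f hf g hg hfg => ?_)) h3
            · obtain ⟨_, _, _, h4, _, h5⟩ := mem_filter.1 hf
              exact mem_filter.2 ⟨h5, card_insert_of_notMem h4, subset_insert _ _⟩
            · obtain ⟨_, _, _, h4, _, h5⟩ := mem_filter.1 (mem_coe.1 hf)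
              have : f ∈ insert g S := by
                have h6 : f ∈ insert f S := mem_insert_self _ _
                rwa [show insert f S = insert g S from hfg] at h6
              exact (mem_insert.1 this).resolve_right h4
          · rw [filter_false_of_mem fun _ _ h3 => h2 h3.1, sum_empty]
            positivity
        · exact (sum_eq_zero fun f _ => if_neg fun h' => h ⟨h'.2.1, h'.2.2.2.1⟩).le
    _ ≤ Λ * (d * ζ) := by
        rw [← sum_mul]
        refine mul_le_mul_of_nonneg_right (le_trans ?_ (hΛ e he)) (by positivity)
        refine le_of_eq_of_le ?_ (sum_le_sum_of_subset_of_nonneg (s := (H.powerset.filter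
          fun S => e ∉ S ∧ insert e S ∈ 𝒞).image fun S => insert e S) (fun C hC => ?_)
          fun _ _ _ => by positivity)
        · rw [sum_image]
          · refine sum_congr rfl fun S hS => ?_
            rw [erase_insert (mem_filter.1 hS).2.1]
          · intro S hS T hT h
            rw [← erase_insert (mem_filter.1 (mem_coe.1 hS)).2.1,
              ← erase_insert (mem_filter.1 (mem_coe.1 hT)).2.1]
            exact congrArg (fun X => X.erase e) h
        · obtain ⟨S, hS, rfl⟩ := mem_image.1 hC
          exact mem_filter.2 ⟨(mem_filter.1 hS).2.2, mem_insert_self _ _⟩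

theorem not_subset_of_free {M : Finset (Finset V)} (hM : ∀ e ∈ M, ∀ f ∈ M, e ≠ f → Disjoint e f)
    (hfree : ∀ C ∈ properConflicts H 𝒞 q ν₁ ∪ twinPairs H 𝒞 q ν₁, ¬ C ⊆ M) :
    ∀ C ∈ 𝒞, ¬ C ⊆ M := by
  intro C hC hCM
  by_cases h : ∀ e ∈ C, ∀ f ∈ C, ({e, f} : Finset (Finset V)) ∉ twinPairs H 𝒞 q ν₁
  · exact hfree C (mem_union_left _ (mem_filter.2 ⟨hC, fun e he f hf =>
      hM e (hCM he) f (hCM hf), h⟩)) hCM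
  · push Not at h
    obtain ⟨e, he, f, hf, h⟩ := h
    refine hfree _ (mem_union_right _ h) (insert_subset (hCM he) ?_)
    exact singleton_subset_iff.2 (hCM hf)

theorem System.sparse (hs : System r ℓ H 𝒞 d ζ) (hr : 0 < r) (hℓ : 2 ≤ ℓ) {σ : ℝ}
    (hσ : d * ζ ≤ σ) (hτ : ∀ e ∈ H,
      ((H.filter fun f => ({e, f} : Finset (Finset V)) ∈ twinPairs H 𝒞 q ν₁).card : ℝ) ≤ σ) :
    Sparse r ℓ H (properConflicts H 𝒞 q ν₁) (twinPairs H 𝒞 q ν₁) σ where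
  card_edge := hs.card_edge
  codeg u v h := (hs.codeg u v h).trans hσ
  sub C hC := by
    rcases mem_union.1 hC with h | h
    · exact hs.sub C (mem_filter.1 h).1
    · obtain ⟨e, he, f, hf, _, rfl⟩ := exists_of_mem_twinPairs h
      exact insert_subset he (singleton_subset_iff.2 hf)
  card_le C hC := by
    rcases mem_union.1 hC with h | h
    · exact hs.card_le C (mem_filter.1 h).1
    · rw [hs.card_of_mem_twinPairs hr h]; exact hℓ
  pairwise C hC := (mem_filter.1 hC).2.1
  twinfree C hC := (mem_filter.1 hC).2.2
  card_twin C hC := hs.card_of_mem_twinPairs hr hC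
  twins := hτ

theorem sum_filter_union_le {ι : Type*} [DecidableEq ι] {s t : Finset ι} {p : ι → Prop}
    [DecidablePred p] {f : ι → ℝ} (hf : ∀ i, 0 ≤ f i) :
    ∑ i ∈ s ∪ t with p i, f i ≤ ∑ i ∈ s with p i, f i + ∑ i ∈ t with p i, f i := by
  rw [filter_union, ← sum_union_inter]
  exact le_add_of_nonneg_right (sum_nonneg fun i _ => hf i)

theorem System.exists_of_card_eq_two (hs : System r ℓ H 𝒞 d ζ) {c : Finset V}
    {C : Finset (Finset V)} (hC : C ∈ properConflicts H 𝒞 q ν₁ ∪ twinPairs H 𝒞 q ν₁)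
    (hc : c ∈ C) (h2 : C.card = 2) : ∃ g ∈ H, g ≠ c ∧ C = {c, g} := by
  have hCH : C ⊆ H := by
    rcases mem_union.1 hC with h | h
    · exact hs.sub C (mem_filter.1 h).1
    · obtain ⟨e, he, f, hf, _, rfl⟩ := exists_of_mem_twinPairs h
      exact insert_subset he (singleton_subset_iff.2 hf)
  obtain ⟨g, hg⟩ := card_eq_one.1 (show (C.erase c).card = 1 by rw [card_erase_of_mem hc, h2])
  have hgC : g ∈ C.erase c := hg ▸ mem_singleton_self g
  refine ⟨g, hCH (mem_of_mem_erase hgC), ne_of_mem_erase hgC, ?_⟩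
  rw [← hg, insert_erase hc]

theorem System.spread (hs : System r ℓ H 𝒞 d ζ) (hr : 0 < r) (hℓ : 2 ≤ ℓ) (hq : 0 < q)
    (hq1 : q ≤ 1) (hζ : 0 ≤ ζ) (hζ1 : ζ ≤ 1) {Λ ν τ : ℝ} (hΛ1 : 1 ≤ Λ) (hν0 : 0 ≤ ν) (hν1 : ν ≤ 1)
    (hd : 0 ≤ d) (hdq : 2 * (d * q) ≤ Λ) (hν₁ : 0 ≤ ν₁)
    (hΛ : ∀ c ∈ H, ∑ C ∈ 𝒞 with c ∈ C, q ^ (C.erase c).card ≤ Λ)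
    (hν : ∀ S : Finset (Finset V), 2 ≤ S.card → ∑ C ∈ 𝒞 with S ⊂ C, q ^ (C \ S).card ≤ ν)
    (hτ0 : 0 ≤ τ) (hτ : ∀ e ∈ H,
      ((H.filter fun f => ({e, f} : Finset (Finset V)) ∈ twinPairs H 𝒞 q ν₁).card : ℝ) ≤ τ) :
    Spread ℓ H (properConflicts H 𝒞 q ν₁ ∪ twinPairs H 𝒞 q ν₁) (twinPairs H 𝒞 q ν₁) q
      (Λ + q * τ) ν (ν₁ + q * (d * ζ + 2 * τ)) where
  pos := hq
  le_one := hq1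
  one_le := by have : 0 ≤ q * τ := by positivity
               linarith
  ν_nonneg := hν0
  ν_le_one := hν1
  ν'_nonneg := by positivity
  card_le := (hs.sparse hr hℓ (le_max_left _ τ) fun e he =>
    (hτ e he).trans (le_max_right _ _)).card_le
  deg v := by
    have h1 := hs.deg_le v
    have h2 : (1 + ζ) * d ≤ 2 * d := by gcongr; linarith
    have h3 := mul_le_mul_of_nonneg_left (h1.trans h2) hq.le
    have : 0 ≤ q * τ := by positivity
    linarith
  through c hc := by
    refine le_trans (sum_filter_union_le fun _ => by positivity)
      (add_le_add (le_trans ?_ (hΛ c hc)) ?_)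
    · exact sum_le_sum_of_subset_of_nonneg (filter_subset_filter _ (filter_subset _ _))
        fun _ _ _ => by positivity
    · refine (sum_le_card_nsmul _ _ q fun C hC => ?_).trans ?_
      · rw [card_erase_of_mem (mem_filter.1 hC).2,
          hs.card_of_mem_twinPairs hr (mem_filter.1 hC).1, pow_one]
      · rw [nsmul_eq_mul, mul_comm]
        refine mul_le_mul_of_nonneg_left (le_trans (Nat.cast_le.2 ?_) (hτ c hc)) hq.le
        refine (card_le_card fun C hC => ?_).trans (card_image_le (f := fun g => {c, g}))
        obtain ⟨h1, h2⟩ := mem_filter.1 hC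
        obtain ⟨g, hg, _, rfl⟩ := hs.exists_of_card_eq_two (mem_union_right _ h1) h2
          (hs.card_of_mem_twinPairs hr h1)
        exact mem_image.2 ⟨g, mem_filter.2 ⟨hg, h1⟩, rfl⟩
  above S hS := by
    refine le_trans (sum_le_sum_of_subset_of_nonneg (fun C hC => ?_)
      fun _ _ _ => by positivity) (hν S hS)
    obtain ⟨h1, h2⟩ := mem_filter.1 hC
    rcases mem_union.1 h1 with h | h
    · exact mem_filter.2 ⟨(mem_filter.1 h).1, h2⟩
    · have := card_lt_card h2
      rw [hs.card_of_mem_twinPairs hr h] at this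
      omega
  pairs e he v := by
    have h1 : ((H.filter fun f => ({e, f} : Finset (Finset V)) ∈
        properConflicts H 𝒞 q ν₁ ∪ twinPairs H 𝒞 q ν₁ ∧ f ≠ e ∧ v ∈ f).card : ℝ) ≤ d * ζ + τ := by
      refine le_trans ?_ (add_le_add (hs.pairs e he v) (hτ e he))
      rw [← Nat.cast_add, Nat.cast_le]
      refine (card_le_card fun f hf => ?_).trans (card_union_le _ _)
      obtain ⟨h2, h3, h4, h5⟩ := mem_filter.1 hf
      rcases mem_union.1 h3 with h | h
      · exact mem_union_left _ (mem_filter.2 ⟨h2, (mem_filter.1 h).1, h5⟩)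
      · exact mem_union_right _ (mem_filter.2 ⟨h2, h⟩)
    have h2 := mul_le_mul_of_nonneg_left h1 hq.le
    have : 0 ≤ q * τ := by positivity
    linarith
  common c hc c' hc' hd ht := by
    rw [← sum_filter_add_sum_filter_not _ (fun C => C.card = 2), add_comm]
    refine add_le_add ?_ ?_
    · have ht' : twinWeight H 𝒞 q c c' ≤ ν₁ := by
        by_contra h
        exact ht (pair_mem_twinPairs.2 ⟨hc, hc', hd, not_le.1 h⟩)
      rw [twinWeight] at ht'
      refine le_trans (sum_le_sum_of_injOn _ _ _ (fun S : Finset (Finset V) => q ^ S.card) (fun C => C.erase c)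
        (fun _ _ => by positivity) (fun C hC => ?_) (fun C hC C' hC' h => ?_)
        fun C hC => le_rfl) ht'
      · simp only [mem_filter] at hC
        obtain ⟨⟨h1, h2, h3, h4⟩, h5⟩ := hC
        have hcard : (insert c' (C.erase c)).card = C.card := by
          rw [card_insert_of_notMem fun h => h3 (mem_of_mem_erase h), card_erase_add_one h2]
        have hmem : C ∈ 𝒞 := (mem_filter.1 ((mem_union.1 h1).resolve_right
          fun h => h5 (hs.card_of_mem_twinPairs hr h))).1
        have hmem' : insert c' (C.erase c) ∈ 𝒞 := (mem_filter.1 ((mem_union.1 h4).resolve_right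
          fun h => h5 (hcard ▸ hs.card_of_mem_twinPairs hr h))).1
        have := hs.two_le C hmem
        refine mem_filter.2 ⟨mem_powerset.2 ((erase_subset _ _).trans (hs.sub C hmem)), ?_,
          notMem_erase _ _, fun h => h3 (mem_of_mem_erase h), ?_, hmem'⟩
        · rw [card_erase_of_mem h2]; omega
        · rwa [insert_erase h2]
      · simp only [mem_filter] at hC hC'
        rw [← insert_erase hC.1.2.1, ← insert_erase hC'.1.2.1]
        exact congrArg (insert c) h
    · refine (sum_le_card_nsmul _ _ q fun C hC => ?_).trans ?_
      · simp only [mem_filter] at hC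
        rw [card_erase_of_mem hC.1.2.1, hC.2, pow_one]
      · rw [nsmul_eq_mul, mul_comm]
        refine mul_le_mul_of_nonneg_left ?_ hq.le
        have h1 := add_le_add (hs.common c hc c' hc' hd) (add_le_add (hτ c hc) (hτ c' hc'))
        rw [two_mul]
        refine le_trans ?_ h1
        rw [← Nat.cast_add, ← Nat.cast_add, Nat.cast_le]
        refine le_trans ((card_le_card (t := Finset.image (fun g => {c, g}) (_ ∪ (_ ∪ _))) fun C hC => ?_).trans
          card_image_le) ((card_union_le _ _).trans (Nat.add_le_add_left (card_union_le _ _) _))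
        simp only [mem_filter] at hC
        obtain ⟨⟨h1, h2, h3, h4⟩, h5⟩ := hC
        obtain ⟨g, hg, hgc, rfl⟩ := hs.exists_of_card_eq_two h1 h2 h5
        rw [erase_insert (by simpa using hgc.symm)] at h4
        refine mem_image.2 ⟨g, ?_, rfl⟩
        rcases mem_union.1 h1 with h | h
        · rcases mem_union.1 h4 with h' | h'
          · exact mem_union_left _ (mem_filter.2 ⟨hg, (mem_filter.1 h).1, (mem_filter.1 h').1⟩)
          · exact mem_union_right _ (mem_union_right _ (mem_filter.2 ⟨hg, h'⟩))
        · exact mem_union_right _ (mem_union_left _ (mem_filter.2 ⟨hg, h⟩))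

end System

section Numerics

variable {r s ℓ L g₀ : ℕ} {D D' err err' a σ η B y y' : ℝ}

theorem one_sub_pow_le {a : ℝ} (h0 : 0 ≤ a) (h1 : a ≤ 1) (s : ℕ) :
    (1 - a) ^ s ≤ 1 - s * a + s ^ 2 * a ^ 2 := by
  induction s with
  | zero => simp
  | succ s ih =>
    rw [pow_succ]
    refine (mul_le_mul_of_nonneg_right ih (by linarith)).trans ?_
    push_cast
    have : 0 ≤ (s : ℝ) * a ^ 2 := by positivity
    have : 0 ≤ (s : ℝ) ^ 2 * a ^ 3 := by positivity
    nlinarith [sq_nonneg a]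

theorem one_sub_mul_le_pow {a : ℝ} (h1 : a ≤ 1) (s : ℕ) : 1 - s * a ≤ (1 - a) ^ s := by
  have := one_add_mul_le_pow (a := -a) (by linarith) s
  rw [← sub_eq_add_neg] at this
  linarith

theorem one_add_mul_le_inv_pow {a : ℝ} (h0 : 0 ≤ a) (h1 : a < 1) (L : ℕ) :
    1 + L * a ≤ ((1 - a) ^ L)⁻¹ := by
  rw [← inv_pow]
  refine (one_add_mul_le_pow (by linarith) L).trans (pow_le_pow_left₀ (by linarith) ?_ L)
  rw [le_inv_comm₀ (by linarith) (by linarith), ← one_div, le_div_iff₀ (by linarith)]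
  nlinarith

theorem inv_pow_le_one_add {a κ : ℝ} (h0 : 0 ≤ a) (hκ : 0 < κ) (L : ℕ)
    (h : L * (1 + κ) * a ≤ κ) (h1 : a < 1) : ((1 - a) ^ L)⁻¹ ≤ 1 + L * (1 + κ) * a := by
  have hz : 0 ≤ L * a := by positivity
  have h2 : (L : ℝ) * a * (1 + κ) ≤ κ := by linarith
  rw [inv_le_iff_one_le_mul₀ (pow_pos (by linarith) L)]
  have h4 : 0 ≤ 1 + (L : ℝ) * (1 + κ) * a := by positivity
  refine le_trans ?_ (mul_le_mul_of_nonneg_left (one_sub_mul_le_pow h1.le L) h4)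
  nlinarith

theorem degreeScale_of (hs : 1 ≤ s) (hL : 4 * s + 4 * r + 10 ≤ L) (hD : 0 < D) (herr : 0 < err)
    (ha : 0 < a) (hσ : 1 ≤ σ)
    (h1 : D * (1 - s * a) ≤ D') (h2 : D' ≤ D * (1 - s * a + s ^ 2 * a ^ 2))
    (h3 : err * (1 + L * a) ≤ err') (h4 : err' ≤ err * (1 + L * (1 + 1) * a))
    (hB : 10 * (s + L + r + 1) ^ 2 ≤ B) (hB1 : B * err ≤ D) (hB2 : B * (a * D) ≤ err)
    (hB3 : B * (a * D) ≤ σ) (hB4 : B * σ ≤ err) (hη0 : 0 ≤ η) (hη : η * (B * D) ≤ err)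
    (hη1 : η * B ≤ 1) : DegreeScale r s L D D' err err' a σ (η / (2 * (B * σ))) η (B * σ) := by
  have hs' : (1 : ℝ) ≤ s := by exact_mod_cast hs
  have hr0 : (0 : ℝ) ≤ r := by positivity
  have hL0 : (0 : ℝ) ≤ L := by positivity
  have hsum : (1 : ℝ) ≤ s + L + r + 1 := by linarith
  have hlin : 10 * ((s : ℝ) + L + r + 1) ≤ B := by nlinarith
  have hB0 : 0 < B := by linarith
  have haD : 0 < a * D := by positivity
  have hs2 : (s : ℝ) ^ 2 ≤ B := by nlinarith
  have hr2 : (r : ℝ) ^ 2 ≤ B := by nlinarith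
  have hBa : B * a ≤ 1 := by
    have h5 : 1 * err ≤ B * err := by gcongr; linarith
    by_contra! h
    have := mul_lt_mul_of_pos_right h hD
    linarith
  have hsa : s * a ≤ 1 / 2 := by
    have : (2 * s) * a ≤ B * a := by gcongr; linarith
    linarith
  have hLe : 4 * (L * err) ≤ D := by
    have : (4 * L) * err ≤ B * err := by gcongr; linarith
    linarith
  have h1' : D - s * (a * D) ≤ D' := by linarith
  have h2' : D' ≤ D - s * (a * D) + s ^ 2 * (a * D) * a := by linarith
  have h3' : err + L * (a * err) ≤ err' := by linarith
  have h4' : err' ≤ err + 2 * (L * (a * err)) := by linarith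
  have hLa : L * (a * err) * 4 ≤ a * D := by
    have := mul_le_mul_of_nonneg_left hLe ha.le
    linarith
  have hae : 0 ≤ a * err := by positivity
  have hLae : 0 ≤ L * (a * err) := by positivity
  constructor
  · exact hD
  · exact herr.le
  · linarith
  · exact ha
  · exact hσ
  · have h5 := mul_le_mul_of_nonneg_right hsa (show 0 ≤ s * (a * D) by positivity)
    have h6 : 1 * (a * D) ≤ s * (a * D) := by gcongr
    linarith
  · linarith
  · have : s ^ 2 * (a * D) * a ≤ err * a := by
      gcongr
      exact le_trans (by gcongr) hB2
    linarith
  · have : (s + 1) * (a * D) ≤ B * (a * D) := by gcongr; linarith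
    have : 1 * σ ≤ B * σ := by gcongr; linarith
    linarith
  · gcongr; linarith
  · positivity
  · have : 2 * (η / (2 * (B * σ)) * (B * σ)) = η := by field_simp
    exact this.le
  · refine le_trans ?_ hη
    gcongr; linarith
  · refine le_trans ?_ hη1
    gcongr; linarith
  · refine le_trans ?_ hB4
    gcongr
  · refine le_trans ?_ hB2
    gcongr; linarith
  · refine le_trans ?_ hB1
    rw [← mul_assoc]
    gcongr; linarith
  · exact hL

theorem drift_of (hD : 0 < D) (hσ : 1 ≤ σ) (hB0 : 100 ≤ B) (hsr : 100 * ((s : ℝ) + r + 1) ≤ B)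
    (hℓr : 100 * (((ℓ : ℝ) + 1) * (r + 1) ^ 2) ≤ B) (hB1 : B * err ≤ D) (hB4 : B * σ ≤ err) :
    (1 + 1 / B) * (s * (1 + 1 / B) * (D + err) + (1 + 1 / B) * (D / 2)) ≤
      (1 - 1 / B) * ((s + 1) * D - r * err - r ^ 2 * σ - 1 - (ℓ + 1) * ((r + 1) ^ 2 * σ)) := by
  have hs0 : (0 : ℝ) ≤ s := by positivity
  have hr0 : (0 : ℝ) ≤ r := by positivity
  have hℓ0 : (0 : ℝ) ≤ ℓ := by positivity
  have hBp : 0 < B := by linarith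
  have hι : 1 / B ≤ 1 / 100 := one_div_le_one_div_of_le (by norm_num) hB0
  have hι0 : 0 < 1 / B := by positivity
  set ι := 1 / B with hιd
  have hιB : ι * B = 1 := by rw [hιd]; field_simp
  have h100 : 100 * σ ≤ err := le_trans (by gcongr) hB4
  have herr : 0 < err := by linarith
  have e1 : (r + 1) * err ≤ D / 100 := by
    have : (100 * (r + 1)) * err ≤ B * err := by gcongr; linarith
    linarith
  have e2 : s * err ≤ D / 100 := by
    have : (100 * s) * err ≤ B * err := by gcongr; linarith
    linarith
  have e3 : (ℓ + 1) * ((r + 1) ^ 2 * σ) ≤ err / 100 := by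
    have : (100 * (((ℓ : ℝ) + 1) * (r + 1) ^ 2)) * σ ≤ B * σ := by gcongr
    linarith
  have e4 : r ^ 2 * σ ≤ err / 100 := by
    refine le_trans ?_ e3
    have : (r : ℝ) ^ 2 * σ ≤ (r + 1) ^ 2 * σ := by gcongr; linarith
    have : 0 ≤ ℓ * (((r : ℝ) + 1) ^ 2 * σ) := by positivity
    linarith
  have e5 : 1 ≤ err / 100 := by linarith
  have e6 : ι * ((s + 1) * D) ≤ D / 100 := by
    have : 100 * ((s : ℝ) + 1) * (ι * D) ≤ B * (ι * D) := by gcongr; linarith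
    have h2 : B * (ι * D) = D := by rw [← mul_assoc, mul_comm B, hιB, one_mul]
    linarith
  have e7 : s * (1 + ι) * (D + err) + (1 + ι) * (D / 2) ≤ (s + 1 / 2) * D + 3 * D / 100 := by
    have h1 : s * (1 + ι) * (D + err) = s * D + s * err + ι * ((s + 1) * D) - ι * D +
      ι * (s * err) := by ring
    have h2 : ι * (s * err) ≤ 1 / 100 * (D / 100) := by gcongr
    have h3 : ι * D ≤ 1 / 100 * D := by gcongr
    have h4 : 0 < ι * D := by positivity
    linarith
  have e9 : (s + 1) * D - 3 * D / 100 ≤ (s + 1) * D - r * err - r ^ 2 * σ - 1 -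
      (ℓ + 1) * ((r + 1) ^ 2 * σ) := by linarith
  have h4 : 0 < ι * D := by positivity
  have h3 : ι * D ≤ 1 / 100 * D := by gcongr
  calc _ ≤ (1 + ι) * ((s + 1 / 2) * D + 3 * D / 100) := by gcongr
    _ ≤ (1 - ι) * ((s + 1) * D - 3 * D / 100) := by linarith
    _ ≤ _ := mul_le_mul_of_nonneg_left e9 (by linarith)

theorem dangerScale_of (hg₀ : 1 ≤ g₀) (hD : 0 < D) (hσ : 1 ≤ σ) (ha : 0 ≤ a)
    (hy : y * D = 2) (hyy : y ≤ y') {X d : ℝ} (hX : 1 ≤ X) (hd : 0 < d) (hyX : y * d ≤ 2 * X)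
    (hpow : ∀ m ≤ ℓ, y' ^ m - y ^ m ≤ y ^ m * (m * (s * (1 + 1 / B) * a)))
    (hB : 100 * ((s + r + 1) * (ℓ + 1) * (r + 1) ^ 2 * g₀) ≤ B) (hB1 : B * err ≤ D)
    (hB4 : B * σ ≤ err) (hB5 : B * (B * a) ≤ 1) (hB6 : B * (a * d) ≤ σ) :
    DangerScale r s ℓ g₀ D err a y y' σ (1 / B)
      (1 / B / (2 * (B * (X * σ / d)))) (1 / B) (B * (X * σ / d)) := by
  have hg' : (1 : ℝ) ≤ g₀ := by exact_mod_cast hg₀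
  have hs0 : (0 : ℝ) ≤ s := by positivity
  have hr0 : (0 : ℝ) ≤ r := by positivity
  have hℓ0 : (0 : ℝ) ≤ ℓ := by positivity
  have hsr : 100 * ((s : ℝ) + r + 1) ≤ B := by
    refine le_trans ?_ hB
    have h1 : (1 : ℝ) ≤ (ℓ + 1) * ((r + 1) ^ 2 * g₀) := by
      refine one_le_mul_of_one_le_of_one_le (by linarith)
        (one_le_mul_of_one_le_of_one_le (one_le_pow₀ (by linarith)) hg')
    have := mul_le_mul_of_nonneg_left h1 (show (0 : ℝ) ≤ s + r + 1 by positivity)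
    linarith
  have hℓr : 100 * (((ℓ : ℝ) + 1) * (r + 1) ^ 2) ≤ B := by
    refine le_trans ?_ hB
    have h1 : (1 : ℝ) ≤ (s + r + 1) * g₀ := one_le_mul_of_one_le_of_one_le (by linarith) hg'
    have := mul_le_mul_of_nonneg_left h1 (show (0 : ℝ) ≤ (ℓ + 1) * (r + 1) ^ 2 by positivity)
    linarith
  have hsg : 100 * ((s : ℝ) * (ℓ * g₀)) ≤ B := by
    refine le_trans ?_ hB
    have h1 : (1 : ℝ) ≤ (r + 1) ^ 2 := one_le_pow₀ (by linarith)
    calc 100 * ((s : ℝ) * (ℓ * g₀)) ≤ 100 * ((s + r + 1) * (ℓ + 1) * g₀) := by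
          rw [← mul_assoc (s : ℝ)]
          gcongr <;> linarith
      _ ≤ _ := by
          have := mul_le_mul_of_nonneg_left h1 (show 0 ≤ ((s : ℝ) + r + 1) * (ℓ + 1) * g₀ by
            positivity)
          linarith
  have hB0 : 100 ≤ B := by linarith
  have hBp : 0 < B := by linarith
  have hι : 1 / B ≤ 1 / 100 := one_div_le_one_div_of_le (by norm_num) hB0
  have hι0 : 0 < 1 / B := by positivity
  set ι := 1 / B with hιd
  have hιB : ι * B = 1 := by rw [hιd]; field_simp
  have hy0 : 0 < y := by
    by_contra! h
    have := mul_nonpos_of_nonpos_of_nonneg h hD.le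
    linarith
  have hsℓ : (s : ℝ) * ℓ ≤ s * (ℓ * g₀) := by
    have := mul_le_mul_of_nonneg_left hg' (mul_nonneg hs0 hℓ0)
    linarith
  set Y := X * σ / d with hY
  have hY0 : 0 < Y := by positivity
  have hyσ : y * σ ≤ 2 * Y := by
    rw [hY, mul_div_assoc', le_div_iff₀ hd]
    have := mul_le_mul_of_nonneg_right hyX (zero_le_one.trans hσ)
    linarith
  have haY : B * a ≤ Y := by
    rw [hY, le_div_iff₀ hd]
    have := mul_le_mul_of_nonneg_right hX (zero_le_one.trans hσ)
    linarith
  constructor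
  · exact hD
  · exact hy0
  · exact hy
  · exact hyy
  · exact ha
  · exact hι0.le
  · linarith
  · exact hpow
  · have h1 : ℓ * (s * (1 + ι) * a) ≤ B * a := by
      have : ℓ * (s * (1 + ι) * a) = (s * ℓ) * (1 + ι) * a := by ring
      rw [this]
      gcongr
      have h3 := mul_nonneg hs0 hℓ0
      have := mul_le_mul_of_nonneg_left hι h3
      linarith
    refine h1.trans ?_
    rw [hιd, le_div_iff₀ hBp]
    linarith
  · have h1 : 2 * g₀ * (ℓ * (s * (1 + ι) * a)) ≤ B * a := by
      have : 2 * (g₀ : ℝ) * (ℓ * (s * (1 + ι) * a)) = 2 * (s * (ℓ * g₀)) * (1 + ι) * a := by ring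
      rw [this]
      gcongr
      have h3 : 0 ≤ (s : ℝ) * (ℓ * g₀) := by positivity
      have := mul_le_mul_of_nonneg_left hι h3
      linarith
    have h2 : (1 + ι) * (y * σ) ≤ 2 * (2 * Y) := by gcongr; linarith
    have : 100 * Y ≤ B * Y := by gcongr
    linarith
  · calc (r + 1) * (y * σ) ≤ (r + 1) * (2 * Y) := by gcongr
      _ = (2 * (r + 1)) * Y := by ring
      _ ≤ B * Y := by gcongr; linarith
  · positivity
  · have : 2 * (ι / (2 * (B * Y)) * (B * Y)) = ι := by field_simp
    exact this.le
  · linarith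
  · exact drift_of hD hσ hB0 hsr hℓr hB1 hB4

end Numerics

section Schedule

/-- The choice of all quantities in terms of a slowly growing parameter `x`, where
`1 - r * t / n` is the proportion of vertices uncovered by `t` edges. -/
noncomputable def schedule (r s L g₀ k : ℕ) (n x d δ σ B : ℝ) : Params where
  D t := d * (1 - r * t / n) ^ s
  err t := d * δ * ((1 - r * t / n) ^ L)⁻¹
  y t := 2 / (d * (1 - r * t / n) ^ s)
  p t := 2 * x ^ (s + 1) / d * (1 + (1 - r * t / n))
  cX := δ / B / (2 * (B * σ))
  cG := 1 / B / (2 * (B * (x ^ s * σ / d)))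
  σ := σ
  k := k
  g₀ := g₀

theorem scale_schedule {r s ℓ L g₀ k : ℕ} {n x d δ σ B : ℝ} (hr : 1 ≤ r) (hs : 1 ≤ s)
    (hg₀ : 1 ≤ g₀) (hL : 4 * s + 4 * r + 10 ≤ L) (hB₁ : 10 * (s + L + r + 1) ^ 2 ≤ B)
    (hB₂ : 100 * ((s + r + 1) * (ℓ + 1) * (r + 1) ^ 2 * g₀) ≤ B) (hBx : B ≤ x) (hn : 0 < n)
    (hd : 0 < d) (hδ : 0 < δ) (hδx : δ * x ^ (L + s + 1) ≤ 1) (hσ : 1 ≤ σ) (hσδ : B * σ ≤ d * δ)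
    (hσn : B * (r * x * d) ≤ σ * n) {t : ℕ} (ht : n / x < n - r * t) :
    Scale r s ℓ L (schedule r s L g₀ k n x d δ σ B) n (1 / B) (δ / B) (B * σ) (1 / B)
      (B * (x ^ s * σ / d)) t := by
  have hs' : (1 : ℝ) ≤ s := by exact_mod_cast hs
  have hr' : (1 : ℝ) ≤ r := by exact_mod_cast hr
  have hg' : (1 : ℝ) ≤ g₀ := by exact_mod_cast hg₀
  have hL0 : (0 : ℝ) ≤ L := by positivity
  have hℓ0 : (0 : ℝ) ≤ ℓ := by positivity
  have hsL : 10 * ((s : ℝ) + L + r + 1) ≤ B := by nlinarith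
  have hB0 : 10 ≤ B := by linarith
  have hBp : 0 < B := by linarith
  have hx0 : 0 < x := by linarith
  have hx1 : 1 ≤ x := by linarith
  have hsℓ : 2 * ((s : ℝ) * ℓ) ≤ B := by
    refine le_trans ?_ hB₂
    have h1 : (1 : ℝ) ≤ (r + 1) ^ 2 * g₀ :=
      one_le_mul_of_one_le_of_one_le (one_le_pow₀ (by linarith)) hg'
    have h2 : (s : ℝ) * ℓ ≤ (s + r + 1) * (ℓ + 1) := by gcongr <;> linarith
    have h3 := mul_le_mul h2 h1 zero_le_one (by positivity)
    have : 0 ≤ (s : ℝ) * ℓ := by positivity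
    linarith
  set u : ℝ := 1 - r * t / n with hu
  have hun : u * n = n - r * t := by rw [hu]; field_simp
  have hrt : 0 < n - r * t := lt_trans (by positivity) ht
  have hu0 : 0 < u := by
    by_contra! h
    have := mul_nonpos_of_nonpos_of_nonneg h hn.le
    linarith
  have hu1 : u ≤ 1 := by
    have : 0 ≤ (r : ℝ) * t / n := by positivity
    linarith
  have hxu : 1 ≤ x * u := by
    rw [div_lt_iff₀ hx0, ← hun] at ht
    by_contra! h
    have := mul_lt_mul_of_pos_right h hn
    linarith
  set a : ℝ := r / (n - r * t) with ha
  have ha0 : 0 < a := by positivity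
  have hu' : 1 - r * (t + 1 : ℕ) / n = u * (1 - a) := by
    rw [hu, ha]
    have h1 : n - r * t ≠ 0 := hrt.ne'
    have h2 := hn.ne'
    push_cast
    field_simp
    ring
  have had : B * (a * d) ≤ σ := by
    have h1 : a * (n - r * t) = r := by rw [ha]; field_simp
    have h2 : a * n ≤ r * x := by
      rw [div_lt_iff₀ hx0] at ht
      have := mul_le_mul_of_nonneg_left ht.le ha0.le
      calc a * n ≤ a * ((n - r * t) * x) := this
        _ = r * x := by rw [← mul_assoc, h1]
    have h3 := mul_le_mul_of_nonneg_left h2 (show 0 ≤ B * d by positivity)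
    by_contra! h
    have := mul_lt_mul_of_pos_right h hn
    linarith
  have hδ1 : δ ≤ 1 := by
    exact le_trans (le_mul_of_one_le_right hδ.le (one_le_pow₀ hx1)) hδx
  have hBBa : B * (B * a) ≤ 1 := by
    have h1 := mul_le_mul_of_nonneg_left had hBp.le
    have h2 : d * δ ≤ d := mul_le_of_le_one_right hd.le hδ1
    by_contra! h
    have := mul_lt_mul_of_pos_right h hd
    linarith
  have hBa : B * a ≤ 1 / B := by
    rw [le_div_iff₀ hBp]
    linarith
  have hι : 1 / B ≤ 1 / 10 := one_div_le_one_div_of_le (by norm_num) hB0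
  have ha1 : a < 1 := by
    have : 1 * a ≤ B * a := by gcongr; linarith
    linarith
  have h1a : 0 < 1 - a := by linarith
  have hus : 0 < u ^ s := by positivity
  have hus1 : u ^ s ≤ 1 := pow_le_one₀ hu0.le hu1
  have huL : 0 < u ^ L := by positivity
  have huL1 : u ^ L ≤ 1 := pow_le_one₀ hu0.le hu1
  have hD : 0 < d * u ^ s := by positivity
  have hDd : d * u ^ s ≤ d := mul_le_of_le_one_right hd.le hus1
  have herr : 0 < d * δ * (u ^ L)⁻¹ := by positivity
  have herr1 : d * δ ≤ d * δ * (u ^ L)⁻¹ :=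
    le_mul_of_one_le_right (by positivity) ((one_le_inv₀ huL).2 huL1)
  have hBerr : B * (d * δ * (u ^ L)⁻¹) ≤ d * u ^ s := by
    rw [← div_eq_mul_inv, mul_div_assoc', div_le_iff₀ huL]
    have h1 : 1 ≤ (x * u) ^ (L + s) := one_le_pow₀ hxu
    calc B * (d * δ) ≤ x * (d * δ) := by gcongr
      _ ≤ x * (d * δ) * (x * u) ^ (L + s) := le_mul_of_one_le_right (by positivity) h1
      _ = d * (δ * x ^ (L + s + 1)) * (u ^ s * u ^ L) := by rw [mul_pow]; ring
      _ ≤ d * 1 * (u ^ s * u ^ L) := by gcongr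
      _ = d * u ^ s * u ^ L := by ring
  have hBσ : B * σ ≤ d * δ * (u ^ L)⁻¹ := hσδ.trans herr1
  have hσB : σ ≤ B * σ := le_mul_of_one_le_left (by linarith) (by linarith)
  have hBaD : B * (a * (d * u ^ s)) ≤ σ := le_trans (by gcongr) had
  have hyX : 2 / (d * u ^ s) * d ≤ 2 * x ^ s := by
    rw [div_mul_eq_mul_div, div_le_iff₀ hD]
    have h1 : 1 ≤ (x * u) ^ s := one_le_pow₀ hxu
    have h2 := mul_le_mul_of_nonneg_left h1 (show 0 ≤ 2 * d by positivity)
    rw [mul_pow] at h2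
    linarith
  have hxs : x ^ s ≤ x ^ (s + 1) := pow_le_pow_right₀ hx1 (Nat.le_succ s)
  constructor
  · linarith
  · simp only [schedule]
    rw [← hu, hu', mul_pow u, mul_pow u, mul_inv]
    refine degreeScale_of hs hL hD herr ha0 hσ ?_ ?_ ?_ ?_ hB₁ hBerr ?_ hBaD hBσ (by positivity)
      ?_ ?_
    · rw [← mul_assoc]
      gcongr
      exact one_sub_mul_le_pow ha1.le s
    · rw [← mul_assoc]
      gcongr
      exact one_sub_pow_le ha0.le ha1.le s
    · rw [← mul_assoc]
      gcongr
      exact one_add_mul_le_inv_pow ha0.le ha1 L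
    · rw [← mul_assoc]
      gcongr
      refine inv_pow_le_one_add ha0.le one_pos L ?_ ha1
      have : (L * (1 + 1)) * a ≤ B * a := by gcongr; linarith
      linarith
    · linarith
    · have : δ / B * (B * (d * u ^ s)) = δ * (d * u ^ s) := by field_simp
      rw [this]
      refine le_trans ?_ herr1
      rw [mul_comm]
      gcongr
    · rw [div_mul_cancel₀ _ hBp.ne']
      exact hδ1
  · simp only [schedule]
    rw [← hu, hu', mul_pow u]
    have hy' : 2 / (d * (u ^ s * (1 - a) ^ s)) = 2 / (d * u ^ s) * ((1 - a) ^ s)⁻¹ := by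
      rw [← mul_assoc, ← div_div, div_eq_mul_inv _ ((1 - a) ^ s)]
    rw [hy']
    refine dangerScale_of hg₀ hD hσ ha0.le (div_mul_cancel₀ _ hD.ne') ?_
      (one_le_pow₀ hx1) hd hyX (fun m hm => ?_) hB₂ hBerr hBσ hBBa had
    · refine le_mul_of_one_le_right (by positivity) ((one_le_inv₀ (pow_pos h1a s)).2
        (pow_le_one₀ h1a.le (by linarith)))
    · rw [mul_pow, inv_pow, ← pow_mul]
      have hms : ((s * m : ℕ) : ℝ) * (1 + 1 / B) * a ≤ 1 / B := by
        refine le_trans ?_ hBa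
        gcongr
        have h1 : ((s * m : ℕ) : ℝ) ≤ s * ℓ := by push_cast; gcongr
        calc ((s * m : ℕ) : ℝ) * (1 + 1 / B) ≤ s * ℓ * (1 + 1) := by gcongr; linarith
          _ ≤ B := by linarith
      have := inv_pow_le_one_add ha0.le (show 0 < 1 / B by positivity) (s * m) hms ha1
      have h2 := mul_le_mul_of_nonneg_left this
        (show 0 ≤ (2 / (d * u ^ s)) ^ m by positivity)
      push_cast at h2
      linarith
  · simp only [schedule]; positivity
  · simp only [schedule]; positivity
  · simp only [schedule]
    rw [hu']
    positivity
  · simp only [schedule]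
    rw [← hu]
    have h1 : 4 * x ^ (s + 1) ≤ d := by
      have h2 : x ^ (s + 1) ≤ x ^ (L + s + 1) := pow_le_pow_right₀ hx1 (by omega)
      have h3 : d * δ * x ^ (L + s + 1) ≤ d := by
        rw [mul_assoc]
        exact mul_le_of_le_one_right hd.le hδx
      have h4 : 4 * x ^ (L + s + 1) ≤ d * δ * x ^ (L + s + 1) := by
        gcongr
        have : 10 * σ ≤ B * σ := by gcongr
        linarith
      linarith
    calc 2 * x ^ (s + 1) / d * (1 + u) ≤ 2 * x ^ (s + 1) / d * (1 + 1) := by gcongr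
      _ = 4 * x ^ (s + 1) / d := by ring
      _ ≤ 1 := by rw [div_le_one hd]; exact h1
  · simp only [schedule]
    rw [← hu]
    rw [← le_div_iff₀ hd] at hyX
    refine hyX.trans ?_
    calc 2 * x ^ s / d ≤ 2 * x ^ (s + 1) / d := by gcongr
      _ ≤ _ := le_mul_of_one_le_right (by positivity) (by linarith)
  · simp only [schedule]
    rw [← hu, hu']
    set E := d * u ^ s - d * δ * (u ^ L)⁻¹ with hE
    have h1 : d * u ^ s / 2 ≤ E := by
      have : 10 * (d * δ * (u ^ L)⁻¹) ≤ B * (d * δ * (u ^ L)⁻¹) := by gcongr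
      linarith
    have h2 : 1 ≤ (x * u) ^ (s + 1) := one_le_pow₀ hxu
    have h3 : a ≤ 2 * x ^ (s + 1) / d * (u * a) * E := by
      calc a ≤ a * (x * u) ^ (s + 1) := le_mul_of_one_le_right ha0.le h2
        _ = 2 * x ^ (s + 1) / d * (u * a) * (d * u ^ s / 2) := by
          rw [mul_pow]; field_simp; ring
        _ ≤ _ := by gcongr
    linarith

end Schedule

section Initial

theorem card_le_pow {V : Type*} [Fintype V] {r : ℕ} {H : Finset (Finset V)}
    (hr : ∀ e ∈ H, e.card = r) : H.card ≤ Fintype.card V ^ r := by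
  calc H.card ≤ (powersetCard r (univ : Finset V)).card :=
        card_le_card fun e he => mem_powersetCard.2 ⟨subset_univ e, hr e he⟩
    _ = (Fintype.card V).choose r := by rw [card_powersetCard, card_univ]
    _ ≤ _ := Nat.choose_le_pow _ _

variable {V : Type*} [DecidableEq V] {r ℓ : ℕ} {H : Finset (Finset V)}

theorem System.one_le_card [Fintype V] {𝒞 : Finset (Finset (Finset V))} {d ζ : ℝ}
    (hs : System r ℓ H 𝒞 d ζ) (hr : 2 ≤ r) (hd : 0 < d) (hζ : 0 ≤ ζ) (hζ2 : ζ ≤ 1 / 2) (v : V) :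
    1 ≤ 2 * (Fintype.card V * ζ) := by
  have h1 : ∑ e ∈ H with v ∈ e, (e.erase v).card =
      ∑ u ∈ univ.erase v, (H.filter fun e => v ∈ e ∧ u ∈ e).card := by
    simp only [card_eq_sum_ones]
    refine sum_comm' fun e u => ?_
    simp only [mem_filter, mem_erase, mem_univ]
    tauto
  have h2 : ((H.filter fun e => v ∈ e).card : ℝ) ≤ Fintype.card V * (d * ζ) := by
    calc ((H.filter fun e => v ∈ e).card : ℝ) ≤ ∑ e ∈ H with v ∈ e, ((e.erase v).card : ℝ) := by
          rw [card_eq_sum_ones, Nat.cast_sum]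
          refine sum_le_sum fun e he => ?_
          rw [Nat.cast_le, card_erase_of_mem (mem_filter.1 he).2, hs.card_edge e (mem_filter.1 he).1]
          omega
      _ = ∑ u ∈ univ.erase v, ((H.filter fun e => v ∈ e ∧ u ∈ e).card : ℝ) := by exact_mod_cast h1
      _ ≤ (univ.erase v).card • (d * ζ) :=
          sum_le_card_nsmul _ _ _ fun u hu => hs.codeg v u (ne_of_mem_erase hu).symm
      _ ≤ _ := by
          rw [nsmul_eq_mul]
          gcongr
          exact card_le_univ _
  have h3 := (hs.deg_ge v).trans h2
  have h4 : (1 / 2) * d ≤ (1 - ζ) * d := by gcongr; linarith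
  by_contra! h
  have := mul_lt_mul_of_pos_right h hd
  linarith

theorem sum_exp_le {α : Type*} {S : Finset α} {f : α → ℝ} {z w b : ℝ} (hS : (S.card : ℝ) ≤ Real.exp z)
    (hb : 0 ≤ b) (hw : z + b ≤ w) (hf : ∀ i ∈ S, f i ≤ -w) :
    ∑ i ∈ S, Real.exp (f i) ≤ 1 / (b + 1) := by
  refine (sum_le_card_nsmul _ _ (Real.exp (-w)) fun i hi => Real.exp_le_exp.2 (hf i hi)).trans ?_
  rw [nsmul_eq_mul]
  calc S.card * Real.exp (-w) ≤ Real.exp z * Real.exp (-w) := by gcongr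
    _ = Real.exp (-(w - z)) := by rw [← Real.exp_add]; ring_nf
    _ ≤ Real.exp (-b) := Real.exp_le_exp.2 (by linarith)
    _ ≤ 1 / (b + 1) := by
        rw [Real.exp_neg, ← one_div]
        exact one_div_le_one_div_of_le (by linarith) (Real.add_one_le_exp b)

theorem totalMoment_empty_le [Fintype V] {𝒟 𝒯 : Finset (Finset (Finset V))} {π Λ ν ν' : ℝ}
    (hS : Spread ℓ H (𝒟 ∪ 𝒯) 𝒯 π Λ ν ν') (hℓ : 1 ≤ ℓ) (k : ℕ) :
    totalMoment H 𝒟 𝒯 π k ∅ ≤ (H.card * Fintype.card V + H.card * H.card + H.card * H.card) *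
      (((k * (2 * ℓ) + 1 : ℕ) : ℝ) ^ (2 * ℓ) *
        (9 * ℓ * (2 ^ (3 * ℓ + 1)) ^ 2 * Λ * (ν + ν') / π)) ^ k := by
  have hπ := hS.pos
  have hν := hS.ν_nonneg
  have hν' := hS.ν'_nonneg
  have hΛ := hS.one_le
  have hℓ' : (1 : ℝ) ≤ ℓ := by exact_mod_cast hℓ
  have hK : (1 : ℝ) ≤ (2 ^ (3 * ℓ + 1)) ^ 2 := one_le_pow₀ (one_le_pow₀ (by norm_num))
  set K : ℝ := (2 ^ (3 * ℓ + 1)) ^ 2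
  set b := 9 * ℓ * K * Λ * (ν + ν') with hb
  have hb0 : 0 ≤ b := by positivity
  have hℓK : (1 : ℝ) ≤ ℓ * K := one_le_mul_of_one_le_of_one_le hℓ' hK
  have e1 : ℓ * ν ≤ ℓ * K * Λ * ν := by
    gcongr
    rw [mul_assoc]
    exact le_mul_of_one_le_right (by positivity) (one_le_mul_of_one_le_of_one_le hK hΛ)
  have e2 : Λ * ν ≤ ℓ * K * Λ * ν := by
    gcongr
    exact le_mul_of_one_le_left (by positivity) hℓK
  have e3 : ℓ * ν' ≤ ℓ * K * Λ * ν' := by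
    gcongr
    rw [mul_assoc]
    exact le_mul_of_one_le_right (by positivity) (one_le_mul_of_one_le_of_one_le hK hΛ)
  have e4 : ν' ≤ ℓ * ν' := le_mul_of_one_le_left hν' hℓ'
  have e5 : 0 ≤ ℓ * K * Λ * ν := by positivity
  have e6 : 0 ≤ ℓ * K * Λ * ν' := by positivity
  have hbe : b = 9 * (ℓ * K * Λ * ν) + 9 * (ℓ * K * Λ * ν') := by rw [hb]; ring
  have key : ∀ {ι : Type _} (F : Finset ι) (W : ι → Finset (Finset V)),
      (∀ i ∈ F, (W i).card ≤ 2 * ℓ) →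
      (∀ I : Finset (Finset V), π * ∑ i ∈ F with I ⊆ W i, π ^ (W i \ I).card ≤ b) →
      moment F W π ∅ k ∅ ≤ (((k * (2 * ℓ) + 1 : ℕ) : ℝ) ^ (2 * ℓ) * (b / π)) ^ k := by
    intro ι F W h1 h2
    have := moment_empty_le F W hπ (show 0 ≤ b / π by positivity) (2 * ℓ) (k * (2 * ℓ)) h1
      (fun I => by rw [le_div_iff₀' hπ]; exact h2 I) k ∅ (by simp)
    rwa [card_empty, pow_zero, one_mul] at this
  set m : ℝ := (((k * (2 * ℓ) + 1 : ℕ) : ℝ) ^ (2 * ℓ) * (b / π)) ^ k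
  rw [totalMoment, add_mul, add_mul]
  refine add_le_add (add_le_add ?_ ?_) ?_
  · refine (sum_le_card_nsmul _ _ m fun q hq => key _ _ (fun i hi => ?_) fun I => ?_).trans ?_
    · have h1 := hS.card_le i.1 (mem_product.1 (mem_filter.1 hi).1).1
      exact (card_le_card sdiff_subset).trans (by omega)
    · refine (hS.sum_famT_le (mem_product.1 hq).1 q.2 I).trans ?_
      linarith
    · rw [nsmul_eq_mul, card_product, card_univ, Nat.cast_mul]
  · refine (sum_le_card_nsmul _ _ m fun q hq => key _ _ (fun i hi => ?_) fun I => ?_).trans ?_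
    · have h1 := hS.card_le i.1 (mem_product.1 (mem_filter.1 hi).1).1
      exact (card_le_card sdiff_subset).trans (by omega)
    · refine (hS.sum_famR_le q.1 q.2 I).trans ?_
      linarith
    · rw [nsmul_eq_mul, card_product, Nat.cast_mul]
  · refine (sum_le_card_nsmul _ _ m fun q hq => key _ _ (fun i hi => ?_) fun I => ?_).trans ?_
    · obtain ⟨h1, h2⟩ := mem_product.1 (mem_filter.1 hi).1
      have h3 := hS.card_le i.1 h1
      have h4 := hS.card_le i.2.1 (mem_product.1 h2).1
      exact (card_le_card sdiff_subset).trans ((card_union_le _ _).trans (by omega))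
    · obtain ⟨h1, h2, h3⟩ := mem_filter.1 hq
      refine (hS.sum_famP_le (mem_product.1 h1).1 (mem_product.1 h1).2 h2 h3 I).trans ?_
      have : ℓ * (8 * K * Λ * ν + ν') = 8 * (ℓ * K * Λ * ν) + ℓ * ν' := by ring
      linarith
    · rw [nsmul_eq_mul]
      gcongr
      rw [← Nat.cast_mul, ← card_product]
      exact Nat.cast_le.2 (card_le_card (filter_subset _ _))

/-- The potential is at most one in the beginning. -/
theorem potential_empty_le [Fintype V] {𝒞 𝒟 𝒯 : Finset (Finset (Finset V))} {d ζ : ℝ} {P : Params}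
    (hs : System r ℓ H 𝒞 d ζ) (h𝒟 : 𝒟 ⊆ 𝒞) {x : ℝ} (hx : 0 ≤ x) (hr : 1 ≤ r)
    (hn : (Fintype.card V : ℝ) ≤ Real.exp x) (hD : P.D 0 = d) (hcX : 0 ≤ P.cX)
    (hX : x + 15 ≤ P.cX * (P.err 0 - d * ζ)) (hcG : 0 ≤ P.cG) (hy : 0 ≤ P.y 0)
    (hG : r * x + 7 ≤ P.cG * P.g₀)
    (hdanger : ∀ f ∈ H, ∑ C ∈ 𝒞 with f ∈ C, P.y 0 ^ (C.erase f).card ≤ P.g₀)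
    (hσ : 0 < P.σ) (hk : 2 * r * x + 11 ≤ P.k) {m : ℝ} (hm : 0 ≤ m)
    (hmoment : totalMoment H 𝒟 𝒯 (P.p 0) P.k ∅ ≤
      (H.card * Fintype.card V + H.card * H.card + H.card * H.card) * m ^ P.k)
    (hmσ : m * Real.exp 1 ≤ P.σ) : potential H 𝒟 𝒯 P ∅ H ≤ 1 := by
  have hr' : (1 : ℝ) ≤ r := by exact_mod_cast hr
  have hH : (H.card : ℝ) ≤ Real.exp (r * x) := by
    rw [mul_comm, Real.exp_mul, Real.rpow_natCast]
    refine le_trans ?_ (pow_le_pow_left₀ (Nat.cast_nonneg _) hn r)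
    exact_mod_cast card_le_pow hs.card_edge
  have h1 : ∑ v ∈ uncovered (∅ : Finset (Finset V)), degPot H d (P.err 0) P.cX v ≤ 1 / 16 + 1 / 16 := by
    have hc : ((uncovered (∅ : Finset (Finset V))).card : ℝ) ≤ Real.exp x :=
      le_trans (Nat.cast_le.2 (card_le_univ _)) hn
    simp only [degPot]
    rw [sum_add_distrib]
    refine add_le_add ?_ ?_
    · refine (sum_exp_le hc (by norm_num) hX fun v _ => ?_).trans (by norm_num)
      have := hs.deg_le v
      rw [← mul_neg]
      refine mul_le_mul_of_nonneg_left ?_ hcX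
      unfold deg
      linarith
    · refine (sum_exp_le hc (by norm_num) hX fun v _ => ?_).trans (by norm_num)
      have := hs.deg_ge v
      rw [← mul_neg]
      refine mul_le_mul_of_nonneg_left ?_ hcX
      unfold deg
      linarith
  have h2 : ∑ f ∈ H, dangerPot 𝒟 ∅ H (P.y 0) P.cG P.g₀ f ≤ 1 / 8 := by
    simp only [dangerPot]
    refine (sum_exp_le hH (by norm_num) hG fun f hf => ?_).trans (by norm_num)
    rw [← mul_neg]
    refine mul_le_mul_of_nonneg_left ?_ hcG
    have : danger 𝒟 ∅ H (P.y 0) f ≤ P.g₀ := by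
      refine le_trans ?_ (hdanger f hf)
      unfold danger live
      refine le_trans (sum_le_sum_of_subset_of_nonneg (t := 𝒞.filter fun C => f ∈ C) ?_
        fun _ _ _ => by positivity) (by simp)
      intro C hC
      obtain ⟨h1, h2, _⟩ := mem_filter.1 hC
      exact mem_filter.2 ⟨h𝒟 h1, h2⟩
    linarith
  have h3 : totalMoment H 𝒟 𝒯 (P.p 0) P.k ∅ / P.σ ^ P.k ≤ 1 / 4 := by
    rw [div_le_iff₀ (by positivity)]
    refine hmoment.trans ?_
    have e1 : m ^ P.k * Real.exp (2 * r * x + 11) ≤ P.σ ^ P.k := by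
      refine le_trans ?_ (pow_le_pow_left₀ (by positivity) hmσ P.k)
      rw [mul_pow, ← Real.exp_nat_mul, mul_one]
      gcongr
    have e2 : Real.exp x ≤ Real.exp (r * x) := Real.exp_le_exp.2 (by nlinarith)
    have e3 : (H.card * Fintype.card V + H.card * H.card + H.card * H.card : ℝ) ≤
        3 * Real.exp (2 * r * x) := by
      have : Real.exp (2 * r * x) = Real.exp (r * x) * Real.exp (r * x) := by
        rw [← Real.exp_add]; ring_nf
      rw [this]
      have i1 : (H.card * Fintype.card V : ℝ) ≤ Real.exp (r * x) * Real.exp (r * x) := by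
        gcongr
        exact hn.trans e2
      have i2 : (H.card * H.card : ℝ) ≤ Real.exp (r * x) * Real.exp (r * x) := by gcongr
      linarith
    have e4 : (12 : ℝ) ≤ Real.exp 11 := by
      have := Real.add_one_le_exp (11 : ℝ)
      linarith
    calc _ ≤ 3 * Real.exp (2 * r * x) * m ^ P.k := by gcongr
      _ ≤ (Real.exp 11 / 4) * Real.exp (2 * r * x) * m ^ P.k := by gcongr; linarith
      _ = 1 / 4 * (m ^ P.k * Real.exp (2 * r * x + 11)) := by rw [Real.exp_add]; ring
      _ ≤ _ := by gcongr
  unfold potential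
  rw [card_empty, hD]
  linarith

end Initial

section Assembly

variable {V : Type*} [DecidableEq V] {r ℓ : ℕ} {H : Finset (Finset V)}
  {𝒞 : Finset (Finset (Finset V))} {d ζ : ℝ}

theorem sum_Icc_mul_pow_le (ℓ : ℕ) {z : ℝ} (hz : 1 ≤ z) :
    ∑ j ∈ Icc 2 ℓ, (ℓ : ℝ) * z ^ (j - 1) ≤ ℓ ^ 2 * z ^ ℓ := by
  refine (sum_le_card_nsmul _ _ (ℓ * z ^ ℓ) fun j hj => ?_).trans ?_
  · have := (mem_Icc.1 hj).2
    gcongr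
    omega
  · rw [nsmul_eq_mul, sq, mul_assoc]
    have : (0 : ℝ) ≤ ℓ * z ^ ℓ := by positivity
    gcongr
    simp only [Nat.card_Icc]
    omega

theorem System.sum_through_le_pow (hs : System r ℓ H 𝒞 d ζ) {q : ℝ} (hq : 0 ≤ q)
    (hdq : 1 ≤ d * q) {c : Finset V} (hc : c ∈ H) :
    ∑ C ∈ 𝒞 with c ∈ C, q ^ (C.erase c).card ≤ ℓ ^ 2 * (d * q) ^ ℓ :=
  (hs.sum_through_le hq hc).trans (sum_Icc_mul_pow_le ℓ hdq)

theorem System.card_twins_le_mul (hs : System r ℓ H 𝒞 d ζ) {q η : ℝ} (hq : 0 ≤ q) (hdq : 1 ≤ d * q)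
    (hd : 0 ≤ d) (hζ : 0 ≤ ζ) (hη : 0 < η) (hζη : ℓ ^ 2 * (d * q) ^ ℓ * ζ ≤ η ^ 2)
    {e : Finset V} (he : e ∈ H) :
    ((H.filter fun f => ({e, f} : Finset (Finset V)) ∈ twinPairs H 𝒞 q η).card : ℝ) ≤ d * η := by
  have h1 := hs.card_twins_le (ν₁ := η) hq hζ hd (fun c hc => hs.sum_through_le_pow hq hdq hc) he
  refine le_of_mul_le_mul_right (h1.trans ?_) hη
  calc _ = d * (ℓ ^ 2 * (d * q) ^ ℓ * ζ) := by ring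
    _ ≤ d * η ^ 2 := by gcongr
    _ = _ := by ring

theorem System.spread_twins (hs : System r ℓ H 𝒞 d ζ) (hr : 0 < r) (hℓ : 2 ≤ ℓ) {q η : ℝ}
    (hq : 0 < q) (hq1 : q ≤ 1) (hdq : 1 ≤ d * q) (hd : 0 ≤ d) (hζ : 0 ≤ ζ) (hζ1 : ζ ≤ 1)
    (hη : 0 < η) (hη1 : η ≤ 1) (hζη : ℓ ^ 2 * (d * q) ^ ℓ * ζ ≤ η ^ 2) :
    Spread ℓ H (properConflicts H 𝒞 q η ∪ twinPairs H 𝒞 q η) (twinPairs H 𝒞 q η) q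
      (ℓ ^ 2 * (d * q) ^ ℓ + q * (d * η)) η (η + q * (d * ζ + 2 * (d * η))) := by
  have hℓ' : (2 : ℝ) ≤ ℓ := by exact_mod_cast hℓ
  have hz := le_self_pow₀ hdq (show ℓ ≠ 0 by omega)
  have h2 : (2 : ℝ) ≤ ℓ ^ 2 := by nlinarith
  have h3 : 2 * (d * q) ≤ ℓ ^ 2 * (d * q) ^ ℓ := by gcongr
  refine hs.spread hr hℓ hq hq1 hζ hζ1 (by linarith) hη.le hη1 hd h3 hη.le
    (fun c hc => hs.sum_through_le_pow hq.le hdq hc) (fun S hS => ?_) (by positivity)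
    fun e he => hs.card_twins_le_mul hq.le hdq hd hζ hη hζη he
  refine (hs.sum_above_le hζ hq.le hdq hS).trans ?_
  calc (ℓ : ℝ) * ((d * q) ^ ℓ * ζ) ≤ ℓ ^ 2 * ((d * q) ^ ℓ * ζ) := by
        gcongr
        nlinarith
    _ ≤ η ^ 2 := by rw [← mul_assoc]; exact hζη
    _ ≤ η := by rw [sq]; exact mul_le_of_le_one_left hη.le hη1

theorem moment_base_le {K₁ K₂ q η z x σ : ℝ} {N a₁ : ℕ} (hq : 0 < q) (hd : 0 ≤ d)
    (hz : d * q = z) (hz1 : 1 ≤ z) (hη : 0 < η) (hη1 : η ≤ 1) (hζ : 0 ≤ ζ) (hζη : ζ ≤ η) {Λ : ℝ} (hzΛ : z ≤ Λ)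
    (hK₁ : 0 ≤ K₁) (hK₂ : 0 ≤ K₂) (hx : 0 < x) (hK : K₁ * K₂ * (10 * 3) * Λ ≤ x ^ N)
    (hηx : η * x ^ (N + a₁) ≤ 1) (hσ : σ = d / x ^ a₁) :
    K₁ * (K₂ * (Λ + q * (d * η)) * (η + (η + q * (d * ζ + 2 * (d * η)))) / q) * Real.exp 1 ≤ σ := by
  have e1 : Λ + q * (d * η) ≤ 2 * Λ := by
    have : q * (d * η) = z * η := by rw [← hz]; ring
    have : z * η ≤ z := mul_le_of_le_one_right (by linarith) hη1
    linarith
  have e2 : η + (η + q * (d * ζ + 2 * (d * η))) ≤ 5 * (z * η) := by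
    have h1 : q * (d * ζ + 2 * (d * η)) = z * ζ + 2 * (z * η) := by rw [← hz]; ring
    have h2 : z * ζ ≤ z * η := by gcongr
    have h3 : η ≤ z * η := le_mul_of_one_le_left hη.le hz1
    linarith
  have e3 : Real.exp 1 ≤ 3 := by linarith [Real.exp_one_lt_d9]
  have hΛ : 0 ≤ Λ := by linarith
  rw [hσ, le_div_iff₀ (by positivity)]
  calc _ ≤ K₁ * (K₂ * (2 * Λ) * (5 * (z * η)) / q) * 3 * x ^ a₁ := by gcongr
    _ = K₁ * K₂ * (10 * 3) * Λ * (η * x ^ a₁) * d := by rw [← hz]; field_simp; ring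
    _ ≤ x ^ N * (η * x ^ a₁) * d := by gcongr
    _ = η * x ^ (N + a₁) * d := by rw [pow_add]; ring
    _ ≤ 1 * d := by gcongr
    _ = d := one_mul d

theorem properConflicts_subset {q ν₁ : ℝ} : properConflicts H 𝒞 q ν₁ ⊆ 𝒞 := by
  unfold properConflicts
  exact filter_subset _ _

theorem Valid.empty [Fintype V] (hH : ∀ C ∈ 𝒞, 2 ≤ C.card) : Valid r H 𝒞 ∅ H where
  subM := empty_subset _
  subA := Subset.rfl
  matching := by simp
  disj := by simp
  free C hC h := by
    have := hH C hC
    rw [subset_empty.1 h] at this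
    simp at this
  avail a _ C hC h := by
    have h1 := hH C hC
    have h2 := card_le_card h
    simp at h2
    omega

set_option maxHeartbeats 1000000 in
/-- The main result for conflict systems whose relative error is polynomially small in `x`. -/
theorem System.exists_matching [Fintype V] (hs : System r ℓ H 𝒞 d ζ) (hr : 2 ≤ r) (hℓ : 2 ≤ ℓ)
    {g₀ s L b a₁ N Q' Q : ℕ} {x B : ℝ} (hg₀ : g₀ = ℓ ^ 2 * 2 ^ ℓ) (hsg : s = r + g₀)
    (hL : L = 4 * s + 4 * r + 10) (hb : b = L + s + 1) (ha₁ : a₁ = 2 * b + 4)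
    (hN : N = 4 * ℓ + 1 + (ℓ * (s + 2) + 1)) (hQ' : Q' = N + a₁)
    (hQ : Q = ℓ * (s + 2) + 1 + 2 * Q')
    (hB₁ : 10 * ((s : ℝ) + L + r + 1) ^ 2 ≤ B)
    (hB₂ : 100 * (((s : ℝ) + r + 1) * (ℓ + 1) * (r + 1) ^ 2 * g₀) ≤ B)
    (hB₃ : 9 * ℓ * (2 ^ (3 * ℓ + 1)) ^ 2 * (10 * 3) ≤ B) (hB₄ : 100 * ((r : ℝ) * ℓ) ≤ B)
    (hBx : B ≤ x) (hxd : x ^ Q ≤ d) (hζ : 0 ≤ ζ) (hζx : ζ * x ^ Q ≤ 1)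
    (hn : (Fintype.card V : ℝ) ≤ Real.exp x) (hn0 : 0 < Fintype.card V) :
    ∃ M ⊆ H, (∀ e ∈ M, ∀ f ∈ M, e ≠ f → Disjoint e f) ∧ (∀ C ∈ 𝒞, ¬ C ⊆ M) ∧
      ((uncovered M).card : ℝ) ≤ Fintype.card V / x := by
  have hr' : (2 : ℝ) ≤ r := by exact_mod_cast hr
  have hℓ' : (2 : ℝ) ≤ ℓ := by exact_mod_cast hℓ
  have hrℓ : (r : ℝ) * 2 ≤ r * ℓ := by gcongr
  have hℓr : (ℓ : ℝ) * 2 ≤ r * ℓ := by rw [mul_comm]; gcongr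
  have hx1 : 400 ≤ x := by linarith
  have hx0 : 0 < x := by linarith
  have hx1' : 1 ≤ x := by linarith
  have hpow : ∀ {i j : ℕ}, i ≤ j → x ^ i ≤ x ^ j := fun h => pow_le_pow_right₀ hx1' h
  have hd1 : 1 ≤ d := (one_le_pow₀ hx1').trans hxd
  have hd0 : 0 < d := by linarith
  have hB0 : 1 ≤ B := by linarith
  have hg1 : 1 ≤ g₀ := by rw [hg₀]; exact Nat.one_le_iff_ne_zero.2 (by positivity)
  have hg1' : (1 : ℝ) ≤ g₀ := by exact_mod_cast hg1
  have hζpow : ∀ {i j : ℕ}, i + j ≤ Q → ζ * x ^ i ≤ (x ^ j)⁻¹ := by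
    intro i j hij
    rw [← one_div, le_div_iff₀ (by positivity), mul_assoc, ← pow_add]
    exact (mul_le_mul_of_nonneg_left (hpow hij) hζ).trans hζx
  have hsQ : s + 2 ≤ ℓ * (s + 2) := Nat.le_mul_of_pos_left _ (by omega)
  have hg₀B : (g₀ : ℝ) ≤ B := by
    refine le_trans ?_ hB₂
    have h1 : (1 : ℝ) ≤ ((s : ℝ) + r + 1) * (ℓ + 1) * (r + 1) ^ 2 :=
      one_le_mul_of_one_le_of_one_le (one_le_mul_of_one_le_of_one_le
        (by have := Nat.cast_nonneg (α := ℝ) s; linarith) (by linarith)) (one_le_pow₀ (by linarith))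
    have h2 := le_mul_of_one_le_left (Nat.cast_nonneg (α := ℝ) g₀) h1
    linarith
  have hℓB : (ℓ : ℝ) ^ 2 ≤ B := by
    refine le_trans ?_ hg₀B
    rw [hg₀]
    exact_mod_cast Nat.le_mul_of_pos_right _ (by positivity)
  set n : ℝ := (Fintype.card V : ℝ) with hndef
  have hn0' : 0 < n := by rw [hndef]; exact_mod_cast hn0
  set δ : ℝ := (x ^ b)⁻¹ with hδ
  set σ : ℝ := d / x ^ a₁ with hσ
  set η : ℝ := (x ^ Q')⁻¹ with hη
  obtain ⟨k, hkdef⟩ : ∃ k : ℕ, k = ⌈2 * r * x + 11⌉₊ := ⟨_, rfl⟩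
  obtain ⟨P, hP⟩ : ∃ P, P = schedule r s L g₀ k n x d δ σ B := ⟨_, rfl⟩
  set q : ℝ := 4 * x ^ (s + 1) / d with hq
  have hδ0 : 0 < δ := by positivity
  have hσ0 : 0 < σ := by positivity
  have hη0 : 0 < η := by positivity
  have hq0 : 0 < q := by positivity
  have hη1 : η ≤ 1 := inv_le_one_of_one_le₀ (one_le_pow₀ hx1')
  have hdq : d * q = 4 * x ^ (s + 1) := by rw [hq]; field_simp
  have hz1 : 1 ≤ d * q := by
    rw [hdq]
    have : 1 ≤ x ^ (s + 1) := one_le_pow₀ hx1'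
    linarith
  have hzx : d * q ≤ x ^ (s + 2) := by
    rw [hdq, pow_succ x (s + 1), mul_comm]
    gcongr
    linarith
  have hq1 : q ≤ 1 := by
    refine le_of_mul_le_mul_left ?_ hd0
    rw [mul_one]
    exact (hzx.trans (hpow (by omega))).trans hxd
  have hΛ : (ℓ : ℝ) ^ 2 * (d * q) ^ ℓ ≤ x ^ (ℓ * (s + 2) + 1) := by
    rw [pow_succ' x, mul_comm ℓ, pow_mul]
    gcongr
    exact hℓB.trans hBx
  have hζ1 : ζ ≤ 1 := by simpa using hζpow (i := 0) (j := 0) (by omega)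
  have hζη : (ℓ : ℝ) ^ 2 * (d * q) ^ ℓ * ζ ≤ η ^ 2 := by
    refine (mul_le_mul_of_nonneg_right hΛ hζ).trans ?_
    rw [mul_comm, hη, inv_pow, ← pow_mul]
    exact hζpow (by omega)
  have hζη' : ζ ≤ η := by simpa using hζpow (i := 0) (j := Q') (by omega)
  have hησ : d * η ≤ σ := by
    rw [hσ, hη, div_eq_mul_inv]
    gcongr
    omega
  have hP0 : P.p 0 = q := by rw [hP]; simp [schedule, hq]; ring
  have hPy : P.y 0 = 2 / d := by rw [hP]; simp [schedule]
  have hPD : P.D 0 = d := by rw [hP]; simp [schedule]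
  have hPe : P.err 0 = d * δ := by rw [hP]; simp [schedule]
  have hPX : P.cX = δ / B / (2 * (B * σ)) := by rw [hP]; rfl
  have hPG : P.cG = 1 / B / (2 * (B * (x ^ s * σ / d))) := by rw [hP]; rfl
  have hPσ : P.σ = σ := by rw [hP]; rfl
  have hPk : P.k = k := by rw [hP]; rfl
  have hPg : P.g₀ = g₀ := by rw [hP]; rfl
  have hδx : δ * x ^ (L + s + 1) ≤ 1 := by rw [hδ, hb, inv_mul_cancel₀ (by positivity)]
  have hσ1 : 1 ≤ σ := by
    rw [hσ, one_le_div (by positivity)]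
    exact (hpow (by omega)).trans hxd
  have hσδ : B * σ ≤ d * δ := by
    rw [hσ, hδ, mul_div_assoc', div_le_iff₀ (by positivity), mul_assoc, mul_comm B]
    refine mul_le_mul_of_nonneg_left ?_ hd0.le
    rw [← div_eq_inv_mul, le_div_iff₀ (by positivity)]
    calc B * x ^ b ≤ x * x ^ b := by gcongr
      _ = x ^ (b + 1) := (pow_succ' x b).symm
      _ ≤ x ^ a₁ := hpow (by omega)
  have hσn : B * (r * x * d) ≤ σ * n := by
    obtain ⟨v⟩ := Fintype.card_pos_iff.1 hn0
    have hζ2 : ζ ≤ 1 / 2 := by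
      have h1 : ζ * x ≤ 1 := by simpa using hζpow (i := 1) (j := 0) (by omega)
      have h2 : ζ * 2 ≤ ζ * x := by gcongr; linarith
      linarith
    have h1 := hs.one_le_card hr hd0 hζ hζ2 v
    have h2 : x ^ (a₁ + 3) ≤ n := by
      have h3 : ζ * 2 * x ^ (a₁ + 3) ≤ 1 := by
        calc ζ * 2 * x ^ (a₁ + 3) ≤ ζ * x * x ^ (a₁ + 3) := by gcongr; linarith
          _ = ζ * x ^ (a₁ + 4) := by ring
          _ ≤ 1 := (mul_le_mul_of_nonneg_left (hpow (by omega)) hζ).trans hζx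
      have h4 : 0 < ζ := by
        refine hζ.lt_of_ne fun h => ?_
        rw [← h] at h1
        norm_num at h1
      refine le_of_mul_le_mul_left ?_ h4
      linarith
    rw [hσ, div_mul_eq_mul_div, le_div_iff₀ (by positivity)]
    have hrx : (r : ℝ) ≤ x := by linarith
    calc B * (r * x * d) * x ^ a₁ ≤ x * (x * x * d) * x ^ a₁ := by gcongr
      _ = d * x ^ (a₁ + 3) := by ring
      _ ≤ d * n := by gcongr
  have hscale : ∀ t : ℕ, n / x < n - r * t → Scale r s ℓ L P n (1 / B) (δ / B) (B * σ) (1 / B)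
      (B * (x ^ s * σ / d)) t := by
    intro t ht
    rw [hP]
    exact scale_schedule (by omega) (by omega) hg1 hL.ge hB₁ hB₂ hBx hn0' hd0 hδ0 hδx
      hσ1 hσδ hσn ht
  have htw := fun e he => (hs.card_twins_le_mul hq0.le hz1 hd0.le hζ hη0 hζη (e := e) he)
  have hspread := hs.spread_twins (by omega) hℓ hq0 hq1 hz1 hd0.le hζ hζ1 hη0 hη1 hζη
  have hmoment := totalMoment_empty_le hspread (by omega) P.k
  have hsparse := hs.sparse (q := q) (ν₁ := η) (by omega) hℓ (σ := σ)
    ((mul_le_mul_of_nonneg_left hζη' hd0.le).trans hησ) fun e he => (htw e he).trans hησ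
  have hδζ : ζ ≤ δ / 2 := by
    have h1 : ζ * x ≤ δ := by simpa using hζpow (i := 1) (j := b) (by omega)
    have h2 : ζ * 2 ≤ ζ * x := by gcongr; linarith
    linarith
  have hxx : 400 * x ≤ x ^ 2 := by rw [sq]; gcongr
  have hB2 : B ^ 2 ≤ x ^ 2 := by gcongr
  have hcX : x + 15 ≤ P.cX * (P.err 0 - d * ζ) := by
    rw [hPX, hPe]
    calc x + 15 ≤ x ^ 2 / 4 := by linarith
      _ = x ^ 4 / (4 * x ^ 2) := by field_simp
      _ ≤ x ^ 4 / (4 * B ^ 2) := by gcongr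
      _ = δ / B / (2 * (B * σ)) * (d * (δ / 2)) := by
        rw [hσ, hδ, ha₁, pow_add, mul_comm 2 b, pow_mul]
        field_simp
        norm_num
      _ ≤ _ := by
        refine mul_le_mul_of_nonneg_left ?_ (by positivity)
        rw [← mul_sub]
        exact mul_le_mul_of_nonneg_left (by linarith) hd0.le
  have hcG : r * x + 7 ≤ P.cG * P.g₀ := by
    rw [hPG, hPg]
    have hrx : r * 100 * 2 ≤ x := by linarith
    have hrx' : (r : ℝ) * 100 * 2 * x ≤ x ^ 2 := by rw [sq]; gcongr
    calc r * x + 7 ≤ x ^ 2 / 2 := by linarith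
      _ = x ^ 4 / (2 * x ^ 2) := by field_simp
      _ ≤ x ^ (a₁ - s) / (2 * B ^ 2) := by
        gcongr ?_ / (2 * ?_)
        exact hpow (by omega)
      _ = 1 / B / (2 * (B * (x ^ s * σ / d))) := by
        rw [hσ, show a₁ = s + (a₁ - s) by omega, pow_add, Nat.add_sub_cancel_left]
        field_simp
      _ ≤ _ := le_mul_of_one_le_right (by positivity) hg1'
  have hk : 2 * r * x + 11 ≤ P.k := by
    rw [hPk, hkdef]
    exact Nat.le_ceil _
  have hk' : ((P.k * (2 * ℓ) + 1 : ℕ) : ℝ) ≤ x ^ 2 := by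
    have h1 : (P.k : ℝ) ≤ 2 * r * x + 12 := by
      rw [hPk, hkdef]
      linarith [Nat.ceil_lt_add_one (show 0 ≤ 2 * r * x + 11 by positivity)]
    push_cast
    calc (P.k : ℝ) * (2 * ℓ) + 1 ≤ (2 * r * x + 12) * (2 * ℓ) + 1 := by gcongr
      _ = 4 * (r * ℓ) * x + 24 * ℓ + 1 := by ring
      _ ≤ 4 * (r * ℓ) * x + (24 * ℓ + 1) * x := by
        have : (24 * ℓ + 1 : ℝ) * 1 ≤ (24 * ℓ + 1) * x := by gcongr
        linarith
      _ = (4 * (r * ℓ) + 24 * ℓ + 1) * x := by ring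
      _ ≤ x * x := by gcongr; linarith
      _ = x ^ 2 := (sq x).symm
  have hpot : potential H (properConflicts H 𝒞 q η) (twinPairs H 𝒞 q η) P ∅ H ≤ 1 := by
    refine potential_empty_le hs properConflicts_subset hx0.le (by omega) hn hPD ?_ hcX ?_ ?_ hcG
      (fun f hf => ?_) (by rw [hPσ]; exact hσ0) hk ?_ (by rw [hP0]; exact hmoment) ?_
    · rw [hPX]; positivity
    · rw [hPG]; positivity
    · rw [hPy]; positivity
    · rw [hPy, hPg]
      refine (hs.sum_through_le_pow (by positivity) ?_ hf).trans_eq ?_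
      · rw [mul_div_cancel₀ _ hd0.ne']; norm_num
      · rw [mul_div_cancel₀ _ hd0.ne', hg₀]
        push_cast
        rfl
    · have := hspread.one_le
      have := hspread.ν'_nonneg
      positivity
    · rw [hPσ]
      refine moment_base_le (N := N) (a₁ := a₁) hq0 hd0.le rfl hz1 hη0 hη1 hζ hζη' ?_ (by positivity)
        (by positivity) hx0 ?_ ?_ hσ
      · refine (le_self_pow₀ hz1 (by omega)).trans (le_mul_of_one_le_left (by positivity) ?_)
        exact one_le_pow₀ (by linarith)
      · rw [hN, pow_add x, pow_succ x, mul_assoc (_ ^ (2 * ℓ))]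
        have h1 : ((P.k * (2 * ℓ) + 1 : ℕ) : ℝ) ^ (2 * ℓ) ≤ x ^ (4 * ℓ) := by
          rw [show 4 * ℓ = 2 * (2 * ℓ) by ring, pow_mul x]
          exact pow_le_pow_left₀ (Nat.cast_nonneg _) hk' (2 * ℓ)
        have h2 := hB₃.trans hBx
        gcongr
      · rw [← hQ', hη, inv_mul_cancel₀ (by positivity)]
  have hvalid : Valid r H (properConflicts H 𝒞 q η ∪ twinPairs H 𝒞 q η) ∅ H := by
    refine Valid.empty fun C hC => ?_
    rcases mem_union.1 hC with h | h
    · exact hs.two_le C (properConflicts_subset h)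
    · exact (hs.card_of_mem_twinPairs (by omega) h).ge
  obtain ⟨M, A, hM, hθ⟩ := exists_matching_of_potential (θ := n / x) (L := L) (s := s) (by omega)
    (by rw [hPg, hsg])
    (by rw [hPk, hkdef]; positivity) (by rw [hPσ]; exact hsparse) hscale hvalid hpot
  exact ⟨M, hM.subM, hM.matching, not_subset_of_free hM.matching hM.free, hθ⟩

end Assembly

theorem exists_exponent (r ℓ : ℕ) (hr : 2 ≤ r) (hℓ : 2 ≤ ℓ) :
    ∃ (Q : ℕ) (B : ℝ), 1 ≤ B ∧ ∀ (V : Type) [Fintype V] [DecidableEq V] (H : Finset (Finset V))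
      (𝒞 : Finset (Finset (Finset V))) (d ζ x : ℝ), System r ℓ H 𝒞 d ζ → B ≤ x → x ^ Q ≤ d →
      0 ≤ ζ → ζ * x ^ Q ≤ 1 → (Fintype.card V : ℝ) ≤ Real.exp x →
      ∃ M ⊆ H, (∀ e ∈ M, ∀ f ∈ M, e ≠ f → Disjoint e f) ∧ (∀ C ∈ 𝒞, ¬ C ⊆ M) ∧
        ((uncovered M).card : ℝ) ≤ Fintype.card V / x := by
  obtain ⟨g₀, hg₀⟩ : ∃ g₀ : ℕ, g₀ = ℓ ^ 2 * 2 ^ ℓ := ⟨_, rfl⟩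
  obtain ⟨s, hs⟩ : ∃ s : ℕ, s = r + g₀ := ⟨_, rfl⟩
  obtain ⟨L, hL⟩ : ∃ L : ℕ, L = 4 * s + 4 * r + 10 := ⟨_, rfl⟩
  obtain ⟨N, hN⟩ : ∃ N : ℕ, N = 4 * ℓ + 1 + (ℓ * (s + 2) + 1) := ⟨_, rfl⟩
  obtain ⟨b, hb⟩ : ∃ b : ℕ, b = L + s + 1 := ⟨_, rfl⟩
  obtain ⟨a₁, ha₁⟩ : ∃ a₁ : ℕ, a₁ = 2 * b + 4 := ⟨_, rfl⟩
  obtain ⟨Q', hQ'⟩ : ∃ Q' : ℕ, Q' = N + a₁ := ⟨_, rfl⟩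
  set B₁ : ℝ := 10 * ((s : ℝ) + L + r + 1) ^ 2 with hB₁
  set B₂ : ℝ := 100 * (((s : ℝ) + r + 1) * (ℓ + 1) * (r + 1) ^ 2 * g₀) with hB₂
  set B₃ : ℝ := 9 * ℓ * (2 ^ (3 * ℓ + 1)) ^ 2 * (10 * 3) with hB₃
  set B₄ : ℝ := 100 * ((r : ℝ) * ℓ) with hB₄
  have h1 : 0 ≤ B₁ := by positivity
  have h2 : 0 ≤ B₂ := by positivity
  have h3 : 0 ≤ B₃ := by positivity
  have h4 : 0 ≤ B₄ := by positivity
  refine ⟨ℓ * (s + 2) + 1 + 2 * Q', 1 + B₁ + B₂ + B₃ + B₄, by linarith,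
    fun V _ _ H 𝒞 d ζ x hS hBx hxd hζ hζx hn => ?_⟩
  rcases Nat.eq_zero_or_pos (Fintype.card V) with hV | hV
  · refine ⟨∅, empty_subset _, by simp, fun C hC h => ?_, ?_⟩
    · have := hS.two_le C hC
      rw [subset_empty.1 h] at this
      simp at this
    · have := Fintype.card_eq_zero_iff.1 hV
      simp [uncovered]
  · exact hS.exists_matching hr hℓ hg₀ hs hL hb ha₁ hN hQ' rfl (B := 1 + B₁ + B₂ + B₃ + B₄)
      (by linarith) (by linarith) (by linarith) (by linarith) hBx hxd hζ hζx hn hV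

end ConflictFree

/-- Conflict-free hypergraph matchings (Theorem 1.3 of Glock–Joos–Kim–Kühn–Lichev). -/
theorem conflict_free_matching (r ℓ : ℕ) (hr : 2 ≤ r) (hℓ : 2 ≤ ℓ) :
    ∃ ε₀ : ℝ, 0 < ε₀ ∧ ∀ ε : ℝ, 0 < ε → ε < ε₀ → ∃ d₀ : ℝ, ∀ d : ℝ, d₀ ≤ d →
      ∀ (V : Type) [Fintype V] [DecidableEq V] (H : Finset (Finset V)),
      -- H is an r-uniform hypergraph on V with at most exp(d^{ε³}) vertices
      (∀ e ∈ H, e.card = r) →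
      (Fintype.card V : ℝ) ≤ Real.exp (d ^ (ε ^ 3)) →
      -- every vertex lies in (1 ± d^{-ε})·d edges
      (∀ v : V, (1 - d ^ (-ε)) * d ≤ ((H.filter fun e => v ∈ e).card : ℝ) ∧
        ((H.filter fun e => v ∈ e).card : ℝ) ≤ (1 + d ^ (-ε)) * d) →
      -- every pair of distinct vertices lies in at most d^{1-ε} edges
      (∀ u v : V, u ≠ v →
        ((H.filter fun e => u ∈ e ∧ v ∈ e).card : ℝ) ≤ d ^ (1 - ε)) →
      -- 𝒞 is a conflict system: its vertices are edges of H, its edges have size in [2, ℓ]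
      ∀ 𝒞 : Finset (Finset (Finset V)),
      (∀ C ∈ 𝒞, C ⊆ H ∧ 2 ≤ C.card ∧ C.card ≤ ℓ) →
      -- (C1): Δ(𝒞⁽ʲ⁾) ≤ ℓ d^{j-1} for all 2 ≤ j ≤ ℓ
      (∀ j, 2 ≤ j → j ≤ ℓ → ∀ e ∈ H,
        ((𝒞.filter fun C => C.card = j ∧ e ∈ C).card : ℝ) ≤ (ℓ : ℝ) * d ^ ((j : ℝ) - 1)) →
      -- (C2): Δ_{j'}(𝒞⁽ʲ⁾) ≤ d^{j-j'-ε} for all 2 ≤ j' < j ≤ ℓ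
      (∀ j j', 2 ≤ j' → j' < j → j ≤ ℓ → ∀ S : Finset (Finset V), S ⊆ H → S.card = j' →
        ((𝒞.filter fun C => C.card = j ∧ S ⊆ C).card : ℝ) ≤ d ^ ((j : ℝ) - (j' : ℝ) - ε)) →
      -- (C3)
      (∀ e ∈ H, ∀ v : V,
        ((H.filter fun f => ({e, f} : Finset (Finset V)) ∈ 𝒞 ∧ v ∈ f).card : ℝ) ≤
          d ^ (1 - ε)) →
      -- (C4)
      (∀ e ∈ H, ∀ f ∈ H, Disjoint e f →
        ((H.filter fun g => ({e, g} : Finset (Finset V)) ∈ 𝒞 ∧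
            ({f, g} : Finset (Finset V)) ∈ 𝒞).card : ℝ) ≤ d ^ (1 - ε)) →
      -- conclusion: a 𝒞-free matching covering all but d^{-ε³}·|V(H)| vertices
      ∃ M ⊆ H, (∀ e ∈ M, ∀ f ∈ M, e ≠ f → Disjoint e f) ∧
        (∀ C ∈ 𝒞, ¬ C ⊆ M) ∧
        (((Finset.univ.filter fun v : V => ∀ e ∈ M, v ∉ e).card : ℝ) ≤
          d ^ (-(ε ^ 3)) * (Fintype.card V : ℝ)) := by
  obtain ⟨Q, B, hB, hQ⟩ := ConflictFree.exists_exponent r ℓ hr hℓ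
  refine ⟨1 / (Q + 1), by positivity, fun ε hε hεQ => ⟨B ^ (1 / ε ^ 3), fun d hd V _ _ H hH hn hdeg
    hcodeg 𝒞 h𝒞 hC₁ hC₂ hC₃ hC₄ => ?_⟩⟩
  have hε3 : 0 < ε ^ 3 := by positivity
  have hd1 : 1 ≤ d := (Real.one_le_rpow hB (by positivity)).trans hd
  have hd0 : 0 < d := by linarith
  have hBx : B ≤ d ^ (ε ^ 3) := by
    have h := Real.rpow_le_rpow (by positivity) hd hε3.le
    rwa [← Real.rpow_mul (by linarith), one_div_mul_cancel hε3.ne', Real.rpow_one] at h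
  have hxQ : (d ^ (ε ^ 3)) ^ Q = d ^ (ε ^ 3 * Q) := by
    rw [← Real.rpow_natCast, ← Real.rpow_mul hd0.le]
  have hεQ' : ε * Q ≤ 1 := by
    rw [lt_div_iff₀ (by positivity)] at hεQ
    linarith
  have hε1 : ε ≤ 1 := by
    refine hεQ.le.trans ?_
    rw [div_le_one (by positivity)]
    linarith [Nat.cast_nonneg (α := ℝ) Q]
  have hε3Q : ε ^ 3 * Q ≤ ε := by
    calc ε ^ 3 * Q = ε * (ε * (ε * Q)) := by ring
      _ ≤ ε * (1 * 1) := by gcongr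
      _ = ε := by ring
  have hdε : d ^ (1 - ε) = d * d ^ (-ε) := by
    rw [sub_eq_add_neg, Real.rpow_add hd0, Real.rpow_one]
  have hS : ConflictFree.System r ℓ H 𝒞 d (d ^ (-ε)) :=
    { card_edge := hH
      deg_ge := fun v => (hdeg v).1
      deg_le := fun v => (hdeg v).2
      codeg := fun u v h => hdε ▸ hcodeg u v h
      sub := fun C hC => (h𝒞 C hC).1
      two_le := fun C hC => (h𝒞 C hC).2.1
      card_le := fun C hC => (h𝒞 C hC).2.2
      deg_conflict := fun j h2 hj e he => by
        rw [← Real.rpow_natCast, Nat.cast_sub (by omega), Nat.cast_one]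
        exact hC₁ j h2 hj e he
      codeg_conflict := fun j j' h2 hj' hj S hS hSj => by
        rw [← Real.rpow_natCast, Nat.cast_sub hj'.le, ← Real.rpow_add hd0, ← sub_eq_add_neg]
        exact hC₂ j j' h2 hj' hj S hS hSj
      pairs := fun e he v => hdε ▸ hC₃ e he v
      common := fun e he f hf h => hdε ▸ hC₄ e he f hf h }
  obtain ⟨M, hM, hdisj, hfree, hcard⟩ := hQ V H 𝒞 d _ _ hS hBx
    (by
      rw [hxQ]
      exact (Real.rpow_le_rpow_of_exponent_le hd1 (hε3Q.trans hε1)).trans_eq (Real.rpow_one d))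
    (by positivity)
    (by
      rw [hxQ, ← Real.rpow_add hd0]
      exact Real.rpow_le_one_of_one_le_of_nonpos hd1 (by linarith)) hn
  refine ⟨M, hM, hdisj, hfree, hcard.trans_eq ?_⟩
  rw [Real.rpow_neg hd0.le, div_eq_inv_mul]
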